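/- Interior Hessian estimate for augmented Hessian equations, scalar case (a priori form of Theorem 1.4, Case 2). Let n ≥ 3, let Ω ⊆ ℝⁿ be a domain, let 2 ≤ k ≤ n and p > (k+1)n/2. Let f : Ω×ℝ×ℝⁿ → ℝ be positive and C^{1,1}_loc, let H₂ : Ω×ℝ×ℝⁿ → ℝ be C^{1,1}_loc, and set H(x,z,ξ) := H₂(x,z,ξ) I. Fix concentric open balls B_R ⊂ B_{2R} with closure(B_{2R}) ⊂ Ω and a constant M > 0. Then there exists a constant C, depending only on n, k, p, R, f, H₂ and M, such that every u ∈ C²(Ω) satisfying σ_k(A_H[u](x)) = f(x,u(x),∇u(x))^k and λ(A_H[u](x)) ∈ Γ_k^+ for every x ∈ Ω, together with ‖u‖_{W^{2,p}(B_{2R})} ≤ M, obeys sup_{x ∈ B_R} |∇²u(x)| ≤ C. -/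

import Mathlib

open MeasureTheory Metric Set Matrix

noncomputable section

/-- The `k`-th elementary symmetric polynomial of the eigenvalues of an `n × n` real
matrix, defined via the coefficients of the characteristic polynomial. -/
def esymmMat {n : ℕ} (k : ℕ) (A : Matrix (Fin n) (Fin n) ℝ) : ℝ :=
  (-1 : ℝ) ^ k * A.charpoly.coeff (n - k)

/-- `λ(A) ∈ Γ_k^+`, i.e. `σ_j(A) > 0` for all `1 ≤ j ≤ k`. -/
def GammaPlus {n : ℕ} (k : ℕ) (A : Matrix (Fin n) (Fin n) ℝ) : Prop :=
  ∀ j : ℕ, 1 ≤ j → j ≤ k → 0 < esymmMat j A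

/-- The Newton tensors `T_0(A) = I`, `T_j(A) = σ_j(A) I - T_{j-1}(A) A`. -/
def newtonT {n : ℕ} : ℕ → Matrix (Fin n) (Fin n) ℝ → Matrix (Fin n) (Fin n) ℝ
  | 0, _ => 1
  | (j + 1), A => esymmMat (j + 1) A • (1 : Matrix (Fin n) (Fin n) ℝ) - newtonT j A * A

/-- `i`-th partial derivative. -/
def pd {n : ℕ} (i : Fin n) (w : (Fin n → ℝ) → ℝ) (x : Fin n → ℝ) : ℝ :=
  fderiv ℝ w x (Pi.single i 1)

/-- Gradient as a vector. -/
def grad {n : ℕ} (w : (Fin n → ℝ) → ℝ) (x : Fin n → ℝ) : Fin n → ℝ :=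
  fun i => pd i w x

/-- Hessian matrix. -/
def hess {n : ℕ} (w : (Fin n → ℝ) → ℝ) (x : Fin n → ℝ) : Matrix (Fin n) (Fin n) ℝ :=
  Matrix.of fun i j => pd i (pd j w) x

/-- Squared Euclidean norm of a vector. -/
def normSq {n : ℕ} (ξ : Fin n → ℝ) : ℝ := ∑ i, ξ i ^ 2

/-- Euclidean norm of a vector. -/
def vnorm {n : ℕ} (ξ : Fin n → ℝ) : ℝ := Real.sqrt (∑ i, ξ i ^ 2)

/-- Operator norm of a matrix, viewed as a linear map between Euclidean spaces. -/
def matNorm {n : ℕ} (M : Matrix (Fin n) (Fin n) ℝ) : ℝ :=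
  ‖LinearMap.toContinuousLinearMap (Matrix.toEuclideanLin M)‖

/-- Laplacian. -/
def lapl {n : ℕ} (w : (Fin n → ℝ) → ℝ) (x : Fin n → ℝ) : ℝ := ∑ l, pd l (pd l w) x

/-- `W^{2,p}` norm (with classical derivatives) on a set. -/
def W2pNorm {n : ℕ} (p : ℝ) (w : (Fin n → ℝ) → ℝ) (B : Set (Fin n → ℝ)) : ℝ :=
  (∫ x in B, (|w x| ^ p + vnorm (grad w x) ^ p + matNorm (hess w x) ^ p)) ^ (1 / p)

/-- `C^{1,1}_loc` on a set: continuously differentiable with locally Lipschitz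
first derivatives. -/
def C11On {E F : Type*} [NormedAddCommGroup E] [NormedSpace ℝ E]
    [NormedAddCommGroup F] [NormedSpace ℝ F] (f : E → F) (s : Set E) : Prop :=
  ContDiffOn ℝ 1 f s ∧
    ∀ x ∈ s, ∃ (K : NNReal) (t : Set E), t ∈ nhdsWithin x s ∧
      LipschitzOnWith K (fderivWithin ℝ f s) t

/-- First order difference quotient `∇_l^h`. -/
def dq {n : ℕ} (l : Fin n) (h : ℝ) (w : (Fin n → ℝ) → ℝ) (x : Fin n → ℝ) : ℝ :=
  (w (x + h • (Pi.single l 1 : Fin n → ℝ)) - w x) / h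

/-- Second order difference quotient `Δ_{ll}^h`. -/
def ddq {n : ℕ} (l : Fin n) (h : ℝ) (w : (Fin n → ℝ) → ℝ) (x : Fin n → ℝ) : ℝ :=
  (w (x + h • (Pi.single l 1 : Fin n → ℝ)) - 2 * w x + w (x - h • (Pi.single l 1 : Fin n → ℝ))) / h ^ 2

/-- `L^s` seminorm (as an extended real number) of a function on a set. -/
def lpN {n : ℕ} (s : ℝ) (w : (Fin n → ℝ) → ℝ) (S : Set (Fin n → ℝ)) : ENNReal :=
  (∫⁻ x in S, ENNReal.ofReal (|w x| ^ s)) ^ (1 / s)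

end


/-! ### Elementary symmetric functions of vectors -/

/-- elementary symmetric function of `lam` over the index set `s` -/
noncomputable def EE {ι : Type*} (lam : ι → ℝ) (s : Finset ι) (k : ℕ) : ℝ :=
  ∑ t ∈ s.powersetCard k, ∏ i ∈ t, lam i

section EEsec
variable {ι : Type*} [DecidableEq ι]

lemma EE_zero (lam : ι → ℝ) (s : Finset ι) : EE lam s 0 = 1 := by
  simp [EE]

lemma EE_insert (lam : ι → ℝ) {s : Finset ι} {a : ι} (ha : a ∉ s) (k : ℕ) :
    EE lam (insert a s) (k + 1) = EE lam s (k + 1) + lam a * EE lam s k := by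
  unfold EE
  rw [Finset.powersetCard_succ_insert ha, Finset.sum_union, Finset.sum_image, Finset.mul_sum]
  · congr 1
    apply Finset.sum_congr rfl
    intro t ht
    rw [Finset.prod_insert]
    exact fun h => ha ((Finset.mem_powersetCard.1 ht).1 h)
  · intro t ht t' ht' h
    have h1 : a ∉ t := fun h => ha ((Finset.mem_powersetCard.1 ht).1 h)
    have h2 : a ∉ t' := fun h => ha ((Finset.mem_powersetCard.1 ht').1 h)
    rw [← Finset.erase_insert h1, ← Finset.erase_insert h2, h]
  · rw [Finset.disjoint_left]
    intro t ht ht'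
    obtain ⟨t', _, rfl⟩ := Finset.mem_image.1 ht'
    exact ha ((Finset.mem_powersetCard.1 ht).1 (Finset.mem_insert_self _ _))

lemma EE_erase (lam : ι → ℝ) {s : Finset ι} {a : ι} (ha : a ∈ s) (k : ℕ) :
    EE lam s (k + 1) = EE lam (s.erase a) (k + 1) + lam a * EE lam (s.erase a) k := by
  conv_lhs => rw [← Finset.insert_erase ha]
  exact EE_insert lam (Finset.notMem_erase a s) k

lemma EE_one (lam : ι → ℝ) (s : Finset ι) : EE lam s 1 = ∑ i ∈ s, lam i := by
  simp [EE, Finset.powersetCard_one]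

lemma EE_empty (lam : ι → ℝ) (k : ℕ) : EE lam ∅ (k + 1) = 0 := by
  unfold EE
  rw [Finset.powersetCard_eq_empty.2 (by simp)]
  simp

lemma EE_euler (lam : ι → ℝ) (s : Finset ι) : ∀ k : ℕ,
    ∑ i ∈ s, lam i * EE lam (s.erase i) k = (k + 1 : ℝ) * EE lam s (k + 1) := by
  induction s using Finset.induction_on with
  | empty => intro k; simp [EE_empty]
  | @insert a s ha ih =>
    intro k
    rw [Finset.sum_insert ha, Finset.erase_insert ha, EE_insert lam ha]
    cases k with
    | zero =>
      have h := ih 0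
      simp only [EE_zero] at *
      simp only [mul_one, CharP.cast_eq_zero, zero_add, one_mul] at *
      rw [h]; ring
    | succ k =>
      have h1 : ∀ i ∈ s, lam i * EE lam ((insert a s).erase i) (k + 1)
          = lam i * EE lam (s.erase i) (k + 1) + lam a * (lam i * EE lam (s.erase i) k) := by
        intro i hi
        have hia : i ≠ a := fun h => ha (h ▸ hi)
        rw [Finset.erase_insert_of_ne hia.symm, EE_insert]
        · ring
        · exact fun h => ha (Finset.mem_of_mem_erase h)
      rw [Finset.sum_congr rfl h1, Finset.sum_add_distrib, ← Finset.mul_sum, ih (k + 1), ih k]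
      push_cast
      ring

lemma EE_smul (lam : ι → ℝ) (s : Finset ι) (t : ℝ) (k : ℕ) :
    EE (t • lam) s k = t ^ k * EE lam s k := by
  unfold EE
  rw [Finset.mul_sum]
  apply Finset.sum_congr rfl
  intro u hu
  simp only [Pi.smul_apply, smul_eq_mul]
  rw [Finset.prod_mul_distrib, Finset.prod_const, (Finset.mem_powersetCard.1 hu).2]

end EEsec

/-! Newton's inequality -/
open Polynomial in
lemma splits_real_derivative {p : ℝ[X]} (hp : p.Splits) : (derivative p).Splits := by
  by_cases h0 : p.natDegree = 0
  · rw [Polynomial.derivative_of_natDegree_zero h0]; exact Splits.zero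
  have h1 := Polynomial.card_roots_le_derivative p
  have h2 := Polynomial.splits_iff_card_roots.1 hp
  have h3 := Polynomial.card_roots' (derivative p)
  have h4 := Polynomial.natDegree_derivative_lt h0
  rw [Polynomial.splits_iff_card_roots]
  omega

open Polynomial in
lemma splits_real_laguerre {p : ℝ[X]} (hp : p.Splits) (x : ℝ) :
    p.eval x * (derivative (derivative p)).eval x ≤ ((derivative p).eval x) ^ 2 := by
  obtain ⟨m, hm⟩ := Polynomial.splits_iff_exists_multiset.1 hp
  rw [hm]
  clear hm
  generalize p.leadingCoeff = c
  simp only [derivative_mul, derivative_C, zero_mul, zero_add, eval_mul, eval_C]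
  suffices h : eval x (m.map fun a => X - C a).prod *
      eval x (derivative (derivative (m.map fun a => X - C a).prod)) ≤
      (eval x (derivative (m.map fun a => X - C a).prod)) ^ 2 by
    nlinarith [mul_le_mul_of_nonneg_left h (sq_nonneg c)]
  induction m using Multiset.induction_on with
  | empty => simp
  | cons a m ih =>
    simp only [Multiset.map_cons, Multiset.prod_cons, derivative_mul, derivative_add, eval_mul,
      eval_add, derivative_sub, derivative_X, derivative_C, derivative_one, eval_sub, eval_X, eval_C, eval_one,
      sub_zero, eval_zero, one_mul, zero_mul, zero_add]
    nlinarith [mul_le_mul_of_nonneg_left ih (sq_nonneg (x - a)),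
      sq_nonneg (eval x (m.map fun a => X - C a).prod)]

open Polynomial in
lemma EE_newton {ι : Type*} [DecidableEq ι] (lam : ι → ℝ) (s : Finset ι) (k : ℕ) :
    EE lam s k * EE lam s (k + 2) ≤ EE lam s (k + 1) ^ 2 := by
  -- polynomial with coefficients EE in increasing order, up to `k`-th derivative
  set p : ℝ[X] := ∏ i ∈ s, (1 + C (lam i) * X) with hp
  have hs : p.Splits := by
    apply Polynomial.Splits.prod
    intro i _
    apply Polynomial.Splits.of_natDegree_le_one
    compute_degree
  have hc : ∀ j, p.coeff j = EE lam s j := by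
    rw [hp]
    clear hs hp p
    induction s using Finset.induction_on with
    | empty =>
      intro j
      cases j with
      | zero => simp [EE_zero]
      | succ j => simp [EE_empty, coeff_one]
    | @insert a s ha ih =>
      intro j
      rw [Finset.prod_insert ha, add_mul, one_mul, coeff_add, mul_assoc, coeff_C_mul]
      cases j with
      | zero => simp [EE_zero, ih]
      | succ j => rw [EE_insert lam ha, coeff_X_mul, ih, ih]
  have hd : ∀ j, (derivative^[j] p).Splits := by
    intro j
    induction j with
    | zero => simpa using hs
    | succ j ih => rw [Function.iterate_succ_apply']; exact splits_real_derivative ih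
  have h := splits_real_laguerre (hd k) 0
  rw [← Function.iterate_succ_apply' derivative, ← Function.iterate_succ_apply' derivative] at h
  simp only [← coeff_zero_eq_eval_zero, coeff_iterate_derivative, zero_add, hc, nsmul_eq_mul,
    Nat.descFactorial_self] at h
  have e1 : ((k + 1).factorial : ℝ) = (k + 1) * k.factorial := by
    rw [Nat.factorial_succ]; push_cast; ring
  have e2 : ((k + 1 + 1).factorial : ℝ) = (k + 2) * (k + 1) * k.factorial := by
    rw [Nat.factorial_succ, Nat.factorial_succ]; push_cast; ring
  simp only [Nat.succ_eq_add_one] at h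
  rw [e1, e2] at h
  have hf : (0 : ℝ) < k.factorial := by exact_mod_cast Nat.factorial_pos k
  have h' : (k + 2 : ℝ) * (EE lam s k * EE lam s (k + 2)) ≤ (k + 1) * EE lam s (k + 1) ^ 2 := by
    have hpos : 0 < (k + 1 : ℝ) * k.factorial ^ 2 := by positivity
    refine le_of_mul_le_mul_left ?_ hpos
    have : k + 1 + 1 = k + 2 := rfl
    rw [this] at h
    nlinarith [h]
  by_cases hneg : EE lam s k * EE lam s (k + 2) ≤ 0
  · exact hneg.trans (sq_nonneg _)
  · push Not at hneg
    have hk : (0 : ℝ) ≤ k := Nat.cast_nonneg k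
    have hb := sq_nonneg (EE lam s (k + 1))
    by_contra hcon
    push Not at hcon
    nlinarith

/-! The cones -/

/-- the Garding cone for vectors -/
def GG {ι : Type*} (lam : ι → ℝ) (s : Finset ι) (k : ℕ) : Prop :=
  ∀ j ≤ k, 0 < EE lam s j

section cone
variable {ι : Type*} [DecidableEq ι]

lemma GG_zero (lam : ι → ℝ) (s : Finset ι) : GG lam s 0 := by
  intro j hj
  rw [Nat.le_zero.1 hj, EE_zero]; exact one_pos

lemma GG.mono {lam : ι → ℝ} {s : Finset ι} {k l : ℕ} (h : GG lam s k) (hl : l ≤ k) : GG lam s l :=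
  fun j hj => h j (hj.trans hl)

lemma GG.succ {lam : ι → ℝ} {s : Finset ι} {k : ℕ} (h : GG lam s k) (h' : 0 < EE lam s (k + 1)) :
    GG lam s (k + 1) := by
  intro j hj
  rcases Nat.lt_or_ge j (k + 1) with h1 | h1
  · exact h j (by omega)
  · have : j = k + 1 := by omega
    rw [this]; exact h'

lemma GG_erase {lam : ι → ℝ} {s : Finset ι} {i : ι} (hi : i ∈ s) : ∀ {k : ℕ}, GG lam s (k + 1) →
    GG lam (s.erase i) k := by
  intro k
  induction k with
  | zero => intro _; exact GG_zero _ _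
  | succ k ih =>
    intro h
    have hk := ih (h.mono (by omega))
    refine hk.succ ?_
    by_contra hcon
    push Not at hcon
    have h1 := h (k + 1) (by omega)
    have h2 := h (k + 2) (by omega)
    have h0 := hk k le_rfl
    rw [EE_erase lam hi] at h1 h2
    have hN := EE_newton lam (s.erase i) k
    set A := EE lam (s.erase i) k
    set B := EE lam (s.erase i) (k + 1)
    set D := EE lam (s.erase i) (k + 2)
    -- B + l A > 0, D + l B > 0, B ≤ 0, A > 0, A D ≤ B^2
    nlinarith [mul_pos h0 h2, mul_nonneg (neg_nonneg.2 hcon) h1.le]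

/-- formula for quotients -/
lemma EE_quot {lam : ι → ℝ} {s : Finset ι} {k : ℕ} (h : GG lam s (k + 1)) :
    (k + 2 : ℝ) * (EE lam s (k + 2) / EE lam s (k + 1)) =
      ∑ i ∈ s, (lam i - lam i ^ 2 /
        (lam i + EE lam (s.erase i) (k + 1) / EE lam (s.erase i) k)) := by
  have he := EE_euler lam s (k + 1)
  have hpos := h (k + 1) le_rfl
  rw [← mul_div_assoc]
  have : (k + 2 : ℝ) * EE lam s (k + 2) = ∑ i ∈ s, lam i * EE lam (s.erase i) (k + 1) := by
    rw [he]; push_cast; ring_nf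
  rw [this, Finset.sum_div]
  apply Finset.sum_congr rfl
  intro i hi
  have h0 := (GG_erase hi h) k le_rfl
  have h1 := EE_erase lam hi k
  have h2 : lam i + EE lam (s.erase i) (k + 1) / EE lam (s.erase i) k =
      EE lam s (k + 1) / EE lam (s.erase i) k := by
    field_simp
    rw [h1]; ring
  rw [h2]
  field_simp
  rw [h1]; ring

lemma titu {x y z w t : ℝ} (hz : 0 < z) (hw : 0 < w) (ht : z + w ≤ t) :
    (x + y) ^ 2 / t ≤ x ^ 2 / z + y ^ 2 / w := by
  calc (x + y) ^ 2 / t ≤ (x + y) ^ 2 / (z + w) := by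
        apply div_le_div_of_nonneg_left (sq_nonneg _) (by positivity) ht
    _ ≤ _ := by
        rw [div_add_div _ _ hz.ne' hw.ne', div_le_div_iff₀ (by positivity) (by positivity)]
        nlinarith [sq_nonneg (x * w - y * z), mul_pos hz hw]

lemma GG_add (k : ℕ) : ∀ {lam mu : ι → ℝ} {s : Finset ι}, GG lam s k → GG mu s k →
    GG (lam + mu) s k ∧ EE lam s (k + 1) / EE lam s k + EE mu s (k + 1) / EE mu s k ≤
      EE (lam + mu) s (k + 1) / EE (lam + mu) s k := by
  induction k with
  | zero =>
    intro lam mu s _ _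
    refine ⟨GG_zero _ _, ?_⟩
    simp [EE_zero, EE_one, Finset.sum_add_distrib]
  | succ k ih =>
    intro lam mu s hl hm
    obtain ⟨g1, g2⟩ := ih (hl.mono (Nat.le_succ k)) (hm.mono (Nat.le_succ k))
    have hG : GG (lam + mu) s (k + 1) := by
      refine g1.succ ?_
      have p1 : 0 < EE lam s (k + 1) / EE lam s k := div_pos (hl _ le_rfl) (hl _ (by omega))
      have p2 : 0 < EE mu s (k + 1) / EE mu s k := div_pos (hm _ le_rfl) (hm _ (by omega))
      have p3 := (add_pos p1 p2).trans_le g2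
      exact (div_pos_iff_of_pos_right (g1 k le_rfl)).1 p3
    refine ⟨hG, ?_⟩
    have hk : (0 : ℝ) < k + 2 := by positivity
    refine le_of_mul_le_mul_left ?_ hk
    rw [mul_add, EE_quot hl, EE_quot hm, EE_quot hG, ← Finset.sum_add_distrib]
    apply Finset.sum_le_sum
    intro i hi
    obtain ⟨_, q2⟩ := ih (GG_erase hi hl) (GG_erase hi hm)
    have zpos : ∀ {nu : ι → ℝ}, GG nu s (k + 1) →
        0 < nu i + EE nu (s.erase i) (k + 1) / EE nu (s.erase i) k := by
      intro nu hn
      have h0 := (GG_erase hi hn) k le_rfl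
      have h1 := EE_erase nu hi k
      have h2 : nu i + EE nu (s.erase i) (k + 1) / EE nu (s.erase i) k =
          EE nu s (k + 1) / EE nu (s.erase i) k := by
        field_simp
        rw [h1]; ring
      rw [h2]
      exact div_pos (hn _ le_rfl) h0
    have ht := titu (x := lam i) (y := mu i) (zpos hl) (zpos hm)
      (t := (lam + mu) i + EE (lam + mu) (s.erase i) (k + 1) / EE (lam + mu) (s.erase i) k)
      (by simp only [Pi.add_apply]; linarith)
    simp only [Pi.add_apply] at *
    linarith

lemma EE_le_one_mul {lam : ι → ℝ} {s : Finset ι} {k : ℕ} (h : GG lam s (k + 1)) :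
    EE lam s (k + 2) ≤ EE lam s 1 * EE lam s (k + 1) := by
  have h1 := EE_quot h
  have hpos := h (k + 1) le_rfl
  have hone := h 1 (by omega)
  have h2 : (k + 2 : ℝ) * (EE lam s (k + 2) / EE lam s (k + 1)) ≤ EE lam s 1 := by
    rw [h1, EE_one]
    apply Finset.sum_le_sum
    intro i hi
    have h0 := (GG_erase hi h) k le_rfl
    have h1 := EE_erase lam hi k
    have h2 : lam i + EE lam (s.erase i) (k + 1) / EE lam (s.erase i) k =
        EE lam s (k + 1) / EE lam (s.erase i) k := by
      field_simp
      rw [h1]; ring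
    rw [h2]
    have : 0 ≤ lam i ^ 2 / (EE lam s (k + 1) / EE lam (s.erase i) k) := by positivity
    linarith
  by_cases hn : EE lam s (k + 2) ≤ 0
  · exact hn.trans (by positivity)
  push Not at hn
  have h3 : EE lam s (k + 2) / EE lam s (k + 1) ≤ EE lam s 1 := by
    have : 0 < EE lam s (k + 2) / EE lam s (k + 1) := div_pos hn hpos
    nlinarith [Nat.cast_nonneg (α := ℝ) k]
  rwa [div_le_iff₀ hpos] at h3

lemma EE_le_pow {lam : ι → ℝ} {s : Finset ι} {k : ℕ} (h : GG lam s k) :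
    ∀ j ≤ k, EE lam s j ≤ EE lam s 1 ^ j := by
  intro j
  induction j with
  | zero => intro _; simp [EE_zero]
  | succ j ih =>
    intro hj
    cases j with
    | zero => simp
    | succ j =>
      have h1 := EE_le_one_mul (h.mono (l := j + 1) (by omega))
      have h2 := ih (by omega)
      have h3 := h 1 (by omega)
      calc _ ≤ _ := h1
        _ ≤ EE lam s 1 * EE lam s 1 ^ (j + 1) := by gcongr
        _ = _ := by ring

/-- lower bound of the linearised coefficients -/
lemma EE_lower {lam : ι → ℝ} {s : Finset ι} {k : ℕ} (h : GG lam s (k + 2)) {i : ι} (hi : i ∈ s) :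
    EE lam s (k + 2) ≤ EE lam s 1 * EE lam (s.erase i) (k + 1) := by
  have h1 := EE_le_one_mul (GG_erase hi h)
  have h2 := EE_erase lam hi (k + 1)
  have h3 := EE_erase lam hi 0
  rw [EE_zero] at h3
  simp only [zero_add, mul_one] at h3
  rw [h2, h3]
  have : k + 1 + 1 = k + 2 := rfl
  rw [this]
  nlinarith

lemma EE_prod_quot {lam : ι → ℝ} {s : Finset ι} : ∀ {k : ℕ}, GG lam s k →
    EE lam s k = ∏ j ∈ Finset.range k, (EE lam s (j + 1) / EE lam s j) := by
  intro k h
  induction k with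
  | zero => simp [EE_zero]
  | succ k ih =>
    rw [Finset.prod_range_succ, ← ih (h.mono (Nat.le_succ k))]
    have := h k (Nat.le_succ k)
    field_simp

lemma EE_hasDerivAt (lam mu : ι → ℝ) (s : Finset ι) : ∀ k : ℕ,
    HasDerivAt (fun t : ℝ => EE (lam + t • mu) s (k + 1))
      (∑ i ∈ s, mu i * EE lam (s.erase i) k) 0 := by
  induction s using Finset.induction_on with
  | empty => intro k; simpa [EE_empty] using hasDerivAt_const (0 : ℝ) (0 : ℝ)
  | @insert a s ha ih =>
    intro k
    simp only [EE_insert _ ha]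
    rw [Finset.sum_insert ha, Finset.erase_insert ha]
    have hl : HasDerivAt (fun t : ℝ => (lam + t • mu) a) (mu a) 0 := by
      simpa using ((hasDerivAt_id (0 : ℝ)).mul_const (mu a)).const_add (lam a)
    cases k with
    | zero =>
      simp only [EE_zero, mul_one]
      have h := ih 0
      simp only [EE_zero, mul_one] at h
      have := h.add hl
      exact this.congr_deriv (add_comm _ _)
    | succ k =>
      have h := (ih (k + 1)).add (hl.mul (ih k))
      refine h.congr_deriv ?_
      have h1 : ∀ i ∈ s, mu i * EE lam ((insert a s).erase i) (k + 1)
          = mu i * EE lam (s.erase i) (k + 1) + lam a * (mu i * EE lam (s.erase i) k) := by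
        intro i hi
        have hia : i ≠ a := fun h => ha (h ▸ hi)
        rw [Finset.erase_insert_of_ne hia.symm, EE_insert]
        · ring
        · exact fun h => ha (Finset.mem_of_mem_erase h)
      rw [Finset.sum_congr rfl h1, Finset.sum_add_distrib, ← Finset.mul_sum]
      simp
      ring

lemma amgm_range (k : ℕ) (x : ℕ → ℝ) (hx : ∀ j, j < k + 1 → 0 < x j) {c : ℝ} (hc : 0 < c)
    (hprod : ∏ j ∈ Finset.range (k + 1), x j = c ^ (k + 1)) :
    (k + 1 : ℝ) * c ≤ ∑ j ∈ Finset.range (k + 1), x j := by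
  have h := Real.geom_mean_le_arith_mean_weighted (Finset.range (k + 1)) (fun _ => (1 : ℝ) / (k + 1)) x
    (fun _ _ => by positivity) (by simp; field_simp)
    (fun i hi => (hx i (Finset.mem_range.1 hi)).le)
  rw [Real.finsetProd_rpow _ _ (fun i hi => (hx i (Finset.mem_range.1 hi)).le), hprod,
    ← Finset.mul_sum] at h
  have h2 : (c ^ (k + 1)) ^ ((1 : ℝ) / (k + 1)) = c := by
    rw [← Real.rpow_natCast, ← Real.rpow_mul hc.le]
    push_cast
    rw [mul_one_div_cancel (by positivity), Real.rpow_one]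
  rw [h2] at h
  rw [one_div, inv_mul_eq_div, le_div_iff₀ (by positivity)] at h
  linarith

/-- Garding's inequality for vectors -/
lemma EE_garding {lam mu : ι → ℝ} {s : Finset ι} {k : ℕ} (hl : GG lam s (k + 1))
    (hm : GG mu s (k + 1)) {α β : ℝ} (hα : 0 < α) (hβ : 0 < β)
    (hlα : EE lam s (k + 1) = α ^ (k + 1)) (hmβ : EE mu s (k + 1) = β ^ (k + 1)) :
    (k + 1 : ℝ) * α ^ k * β ≤ ∑ i ∈ s, mu i * EE lam (s.erase i) k := by
  set q : ℕ → ℝ := fun j => EE lam s (j + 1) / EE lam s j with hq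
  set r : ℕ → ℝ := fun j => EE mu s (j + 1) / EE mu s j with hr
  have hqpos : ∀ j, j < k + 1 → 0 < q j := fun j hj => div_pos (hl _ (by omega)) (hl _ (by omega))
  have hrpos : ∀ j, j < k + 1 → 0 < r j := fun j hj => div_pos (hm _ (by omega)) (hm _ (by omega))
  have key : ∀ t : ℝ, 0 ≤ t → ∏ j ∈ Finset.range (k + 1), (q j + t * r j) ≤
      EE (lam + t • mu) s (k + 1) := by
    intro t ht
    rcases ht.eq_or_lt with rfl | ht
    · simp [EE_prod_quot hl, hq]
    have htm : ∀ j, EE (t • mu) s j = t ^ j * EE mu s j := EE_smul mu s t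
    have hG : GG (t • mu) s (k + 1) := by
      intro j hj; rw [htm]; have := hm j hj; positivity
    rw [EE_prod_quot (GG_add _ hl hG).1]
    apply Finset.prod_le_prod
    · intro j hj
      have hj := Finset.mem_range.1 hj
      have := hqpos j hj
      have := hrpos j hj
      positivity
    · intro j hj
      have hj := Finset.mem_range.1 hj
      have h := (GG_add j (hl.mono hj.le) (hG.mono hj.le)).2
      have h2 : EE (t • mu) s (j + 1) / EE (t • mu) s j = t * r j := by
        rw [htm, htm, hr]
        have := hm j (by omega)
        field_simp
        ring
      rw [h2] at h
      exact h
  -- compare derivatives at zero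
  have hd1 := EE_hasDerivAt lam mu s k
  have hd2 : HasDerivAt (fun t : ℝ => ∏ j ∈ Finset.range (k + 1), (q j + t * r j))
      (∑ j ∈ Finset.range (k + 1), (∏ i ∈ (Finset.range (k + 1)).erase j, q i) * r j) 0 := by
    have := HasDerivAt.fun_finset_prod (u := Finset.range (k + 1)) (f := fun j t => q j + t * r j)
      (f' := fun j => r j) (x := (0:ℝ)) (fun j _ => by
        simpa using ((hasDerivAt_id (0 : ℝ)).mul_const (r j)).const_add (q j))
    simpa using this
  have hd := hd1.sub hd2
  have hge : 0 ≤ (∑ i ∈ s, mu i * EE lam (s.erase i) k) -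
      ∑ j ∈ Finset.range (k + 1), (∏ i ∈ (Finset.range (k + 1)).erase j, q i) * r j := by
    have ht := hd.hasDerivWithinAt (s := Ici 0)
    have ht := (hasDerivWithinAt_iff_tendsto_slope.1 ht)
    have hne : (nhdsWithin (0 : ℝ) (Ici 0 \ {0})).NeBot := by
      rw [show Ici (0 : ℝ) \ {0} = Ioi 0 by ext x; simp [lt_iff_le_and_ne, eq_comm]]; infer_instance
    refine ge_of_tendsto ht ?_
    filter_upwards [self_mem_nhdsWithin] with t ht
    have ht0 : 0 ≤ t := ht.1
    have h0 : EE lam s (k + 1) = ∏ j ∈ Finset.range (k + 1), q j := EE_prod_quot hl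
    rw [slope_def_field]
    apply div_nonneg _ (by simpa using ht0)
    have := key t ht0
    simp only [Pi.sub_apply, zero_smul, add_zero, zero_mul, h0]
    linarith
  have hP : ∏ j ∈ Finset.range (k + 1), q j = α ^ (k + 1) := by rw [← hlα]; exact (EE_prod_quot hl).symm
  have hR : ∏ j ∈ Finset.range (k + 1), r j = β ^ (k + 1) := by rw [← hmβ]; exact (EE_prod_quot hm).symm
  have hsum : ∑ j ∈ Finset.range (k + 1), (∏ i ∈ (Finset.range (k + 1)).erase j, q i) * r j =
      α ^ (k + 1) * ∑ j ∈ Finset.range (k + 1), r j / q j := by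
    rw [Finset.mul_sum]
    apply Finset.sum_congr rfl
    intro j hj
    rw [← hP, ← Finset.mul_prod_erase _ _ hj]
    have := hqpos j (Finset.mem_range.1 hj)
    field_simp
  have ham := amgm_range k (fun j => r j / q j)
    (fun j hj => div_pos (hrpos j hj) (hqpos j hj)) (c := β / α) (by positivity)
    (by rw [Finset.prod_div_distrib, hP, hR, div_pow])
  rw [hsum] at hge
  have h3 : (k + 1 : ℝ) * α ^ k * β = α ^ (k + 1) * ((k + 1) * (β / α)) := by
    field_simp
    ring
  rw [h3]
  have := mul_le_mul_of_nonneg_left ham (pow_pos hα (k + 1)).le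
  linarith

end cone


section MatSec
variable {n : ℕ}

lemma spec_exists (A : Matrix (Fin n) (Fin n) ℝ) (hA : Aᵀ = A) :
    ∃ (U : Matrix (Fin n) (Fin n) ℝ) (lam : Fin n → ℝ), U * Uᵀ = 1 ∧ Uᵀ * U = 1 ∧
      A = U * diagonal lam * Uᵀ ∧ ∀ j ≤ n, esymmMat j A = EE lam Finset.univ j := by
  have hH : A.IsHermitian := by
    rw [Matrix.IsHermitian, Matrix.conjTranspose_eq_transpose_of_trivial, hA]
  refine ⟨(hH.eigenvectorUnitary : Matrix (Fin n) (Fin n) ℝ), hH.eigenvalues, ?_, ?_, ?_, ?_⟩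
  · have := Unitary.mul_star_self_of_mem hH.eigenvectorUnitary.2
    rwa [Matrix.star_eq_conjTranspose, Matrix.conjTranspose_eq_transpose_of_trivial] at this
  · have := Unitary.star_mul_self_of_mem hH.eigenvectorUnitary.2
    rwa [Matrix.star_eq_conjTranspose, Matrix.conjTranspose_eq_transpose_of_trivial] at this
  · have := hH.spectral_theorem
    conv_lhs => rw [this]
    rw [Unitary.conjStarAlgAut_apply, Matrix.star_eq_conjTranspose, Matrix.conjTranspose_eq_transpose_of_trivial]
    rfl
  · intro j hj
    unfold esymmMat
    rw [hH.charpoly_eq]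
    have h := Multiset.prod_X_sub_C_coeff (Multiset.map hH.eigenvalues (Finset.univ : Finset (Fin n)).val)
      (k := n - j) (by simp)
    rw [Multiset.map_map] at h
    have e : (∏ i, (Polynomial.X - Polynomial.C ((hH.eigenvalues i : ℝ) ))) = (Multiset.map ((fun t => Polynomial.X - Polynomial.C t) ∘ hH.eigenvalues) (Finset.univ : Finset (Fin n)).val).prod := rfl
    change (-1) ^ j * (∏ i, (Polynomial.X - Polynomial.C ((hH.eigenvalues i : ℝ) ))).coeff (n - j) = _
    rw [e, h]
    have e2 : (Multiset.map hH.eigenvalues (Finset.univ : Finset (Fin n)).val).card - (n - j) = j := by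
      simp; omega
    rw [e2, Finset.esymm_map_val, ← mul_assoc, ← pow_add, Even.neg_one_pow ⟨j, rfl⟩, one_mul]
    rfl

lemma newtonT_spec {U A : Matrix (Fin n) (Fin n) ℝ} {lam : Fin n → ℝ}
    (h1 : U * Uᵀ = 1) (h2 : Uᵀ * U = 1) (hA : A = U * diagonal lam * Uᵀ)
    (hs : ∀ j ≤ n, esymmMat j A = EE lam Finset.univ j) :
    ∀ j ≤ n, newtonT j A = U * diagonal (fun i => EE lam (Finset.univ.erase i) j) * Uᵀ := by
  intro j
  induction j with
  | zero =>
    intro _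
    simp only [EE_zero, newtonT]
    rw [show (diagonal fun i : Fin n => (1:ℝ)) = 1 from diagonal_one]
    simp [h1]
  | succ j ih =>
    intro hj
    rw [newtonT, ih (by omega), hs _ hj]
    conv_lhs => rw [hA]
    have e : ∀ (D D' : Matrix (Fin n) (Fin n) ℝ), U * D * Uᵀ * (U * D' * Uᵀ) = U * (D * D') * Uᵀ := by
      intro D D'
      calc U * D * Uᵀ * (U * D' * Uᵀ) = U * D * (Uᵀ * U) * D' * Uᵀ := by simp only [Matrix.mul_assoc]
        _ = _ := by rw [h2]; simp only [Matrix.mul_assoc, Matrix.mul_one, Matrix.one_mul]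
    rw [e]
    have e1 : EE lam Finset.univ (j+1) • (1 : Matrix (Fin n) (Fin n) ℝ) = U * Matrix.diagonal (fun _ => EE lam Finset.univ (j+1)) * Uᵀ := by
      rw [← smul_one_eq_diagonal]; simp [h1]
    rw [e1, ← Matrix.sub_mul, ← Matrix.mul_sub, diagonal_mul_diagonal, diagonal_sub]
    congr 3
    funext i
    rw [EE_erase lam (Finset.mem_univ i) j]; ring

lemma esymm_zero (A : Matrix (Fin n) (Fin n) ℝ) : esymmMat 0 A = 1 := by
  have h := (Matrix.charpoly_monic A).coeff_natDegree
  rw [Matrix.charpoly_natDegree_eq_dim] at h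
  simpa [esymmMat] using h

lemma esymm_one (hn : 1 ≤ n) (A : Matrix (Fin n) (Fin n) ℝ) : esymmMat 1 A = A.trace := by
  haveI : Nonempty (Fin n) := ⟨⟨0, hn⟩⟩
  rw [Matrix.trace_eq_neg_charpoly_coeff]
  simp [esymmMat]

lemma trace_conj {U : Matrix (Fin n) (Fin n) ℝ} (h2 : Uᵀ * U = 1) (D : Matrix (Fin n) (Fin n) ℝ) :
    (U * D * Uᵀ).trace = D.trace := by
  rw [Matrix.trace_mul_comm, ← Matrix.mul_assoc, h2, Matrix.one_mul]

lemma newtonT_symm (A : Matrix (Fin n) (Fin n) ℝ) (hA : Aᵀ = A) (j : ℕ) :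
    (newtonT j A)ᵀ = newtonT j A ∧ newtonT j A * A = A * newtonT j A := by
  induction j with
  | zero => simp [newtonT]
  | succ j ih =>
    obtain ⟨i1, i2⟩ := ih
    constructor
    · rw [newtonT, Matrix.transpose_sub, Matrix.transpose_mul, i1, hA, i2]
      simp
    · rw [newtonT, Matrix.sub_mul, Matrix.mul_sub]
      congr 1
      · simp
      · conv_lhs => rw [i2]
        simp only [Matrix.mul_assoc]

lemma EE_sum_erase (lam : Fin n → ℝ) : ∀ (s : Finset (Fin n)) (j : ℕ), 
    ∑ i ∈ s, EE lam (s.erase i) j = ((s.card : ℝ) - j) * EE lam s j := by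
  intro s j
  cases j with
  | zero => simp [EE_zero]
  | succ j =>
    have h := EE_euler lam s j
    have : ∑ i ∈ s, EE lam (s.erase i) (j+1) = ∑ i ∈ s, (EE lam s (j+1) - lam i * EE lam (s.erase i) j) := by
      apply Finset.sum_congr rfl
      intro i hi
      rw [EE_erase lam hi j]; ring
    rw [this, Finset.sum_sub_distrib, h]
    simp; ring

lemma trace_newton (A : Matrix (Fin n) (Fin n) ℝ) (hA : Aᵀ = A) {j : ℕ} (hj : j ≤ n) :
    (newtonT j A).trace = ((n:ℝ) - j) * esymmMat j A := by
  obtain ⟨U, lam, h1, h2, hU, hs⟩ := spec_exists A hA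
  rw [newtonT_spec h1 h2 hU hs j hj, trace_conj h2, hs j hj, trace_diagonal, EE_sum_erase]
  simp

lemma trace_newton_mul (A : Matrix (Fin n) (Fin n) ℝ) (hA : Aᵀ = A) {j : ℕ} (hj : j + 1 ≤ n) :
    (newtonT j A * A).trace = ((j:ℝ) + 1) * esymmMat (j+1) A := by
  have h := trace_newton A hA hj
  rw [newtonT, trace_sub, trace_smul, trace_one] at h
  simp only [smul_eq_mul, Fintype.card_fin] at h
  push_cast at h
  linarith

lemma GG_of_GammaPlus {k : ℕ} (hk : k ≤ n) {A : Matrix (Fin n) (Fin n) ℝ} {lam : Fin n → ℝ}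
    (hs : ∀ j ≤ n, esymmMat j A = EE lam Finset.univ j) (h : GammaPlus k A) :
    GG lam Finset.univ k := by
  intro j hj
  rcases Nat.eq_zero_or_pos j with rfl | hj0
  · rw [EE_zero]; norm_num
  · rw [← hs j (by omega)]; exact h j hj0 hj

end MatSec


section MatSec2
variable {n : ℕ}

lemma EE_perm (mu : Fin n → ℝ) (e : Equiv.Perm (Fin n)) (j : ℕ) :
    EE (fun i => mu (e i)) Finset.univ j = EE mu Finset.univ j := by
  unfold EE
  apply Finset.sum_bij (fun t _ => t.map e.toEmbedding)
  · intro t ht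
    rw [Finset.mem_powersetCard] at ht ⊢
    simpa using ht.2
  · intro a _ b _ h
    exact Finset.map_injective _ h
  · intro b hb
    refine ⟨b.map e.symm.toEmbedding, ?_, ?_⟩
    · rw [Finset.mem_powersetCard] at hb ⊢
      simpa using hb.2
    · ext x; simp
  · intro a _
    rw [Finset.prod_map]; rfl

lemma mat_garding {k : ℕ} (hk : k + 1 ≤ n) {A B : Matrix (Fin n) (Fin n) ℝ} (hA : Aᵀ = A) (hB : Bᵀ = B)
    (gA : GammaPlus (k+1) A) (gB : GammaPlus (k+1) B) {α β : ℝ} (hα : 0 < α) (hβ : 0 < β)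
    (eA : esymmMat (k+1) A = α ^ (k+1)) (eB : esymmMat (k+1) B = β ^ (k+1)) :
    ((k:ℝ)+1) * α ^ k * β ≤ (newtonT k A * B).trace := by
  obtain ⟨U, lam, h1, h2, hU, hs⟩ := spec_exists A hA
  obtain ⟨W, mu, w1, w2, hW, ws⟩ := spec_exists B hB
  have gl := GG_of_GammaPlus hk hs gA
  have gm := GG_of_GammaPlus hk ws gB
  set τ : Fin n → ℝ := fun i => EE lam (Finset.univ.erase i) k with hτ
  set P := Uᵀ * W with hP
  have PPt : P * Pᵀ = 1 := by
    rw [hP, Matrix.transpose_mul, Matrix.transpose_transpose, Matrix.mul_assoc, ← Matrix.mul_assoc W, w1,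
      Matrix.one_mul, h2]
  have PtP : Pᵀ * P = 1 := by
    rw [hP, Matrix.transpose_mul, Matrix.transpose_transpose, Matrix.mul_assoc, ← Matrix.mul_assoc U, h1,
      Matrix.one_mul, w2]
  have tr : (newtonT k A * B).trace = ∑ i, ∑ j, τ i * mu j * (P i j ^ 2) := by
    rw [newtonT_spec h1 h2 hU hs k (by omega), hW]
    have : (U * Matrix.diagonal τ * Uᵀ * (W * Matrix.diagonal mu * Wᵀ)).trace
        = (Matrix.diagonal τ * (P * Matrix.diagonal mu) * Pᵀ).trace := by
      rw [hP, Matrix.transpose_mul, Matrix.transpose_transpose]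
      rw [← trace_conj h2 (Matrix.diagonal τ * (Uᵀ * W * Matrix.diagonal mu) * (Wᵀ * U))]
      congr 1
      simp only [Matrix.mul_assoc]
      rw [h1, Matrix.mul_one]
    rw [this, Matrix.trace]
    apply Finset.sum_congr rfl
    intro i _
    rw [Matrix.diag_apply, Matrix.mul_apply]
    apply Finset.sum_congr rfl
    intro j _
    rw [Matrix.diagonal_mul, Matrix.mul_diagonal, Matrix.transpose_apply]; ring
  have hS : (Matrix.of fun i j => P i j ^ 2) ∈ doublyStochastic ℝ (Fin n) := by
    rw [mem_doublyStochastic_iff_sum]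
    refine ⟨fun i j => by simp; positivity, fun i => ?_, fun j => ?_⟩
    · have := congrFun (congrFun PPt i) i
      rw [Matrix.mul_apply, Matrix.one_apply_eq] at this
      rw [← this]; apply Finset.sum_congr rfl; intro j _; simp [sq]
    · have := congrFun (congrFun PtP j) j
      rw [Matrix.mul_apply, Matrix.one_apply_eq] at this
      rw [← this]; apply Finset.sum_congr rfl; intro i _; simp [sq]
  obtain ⟨w, w0, wsum, wS⟩ := exists_eq_sum_perm_of_mem_doublyStochastic hS
  have key : ∀ e : Equiv.Perm (Fin n), ((k:ℝ)+1) * α ^ k * β ≤ ∑ i, mu (e i) * τ i := by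
    intro e
    apply EE_garding gl _ hα hβ (by rw [← hs _ hk, eA]) (by rw [EE_perm, ← ws _ hk, eB])
    intro j hj
    rw [EE_perm]; exact gm j hj
  have ent : ∀ i j, P i j ^ 2 = ∑ e, w e * (if e i = j then 1 else 0) := by
    intro i j
    have := congrFun (congrFun wS i) j
    simp only [Matrix.sum_apply, Matrix.smul_apply, Equiv.Perm.permMatrix, Matrix.of_apply, smul_eq_mul, PEquiv.toMatrix_apply, Equiv.toPEquiv_apply, Option.mem_some_iff] at this
    rw [← this]
  rw [tr]
  calc ((k:ℝ)+1) * α ^ k * β = ∑ e, w e * (((k:ℝ)+1) * α ^ k * β) := by rw [← Finset.sum_mul, wsum, one_mul]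
    _ ≤ ∑ e, w e * ∑ i, mu (e i) * τ i := by
        apply Finset.sum_le_sum; intro e _
        exact mul_le_mul_of_nonneg_left (key e) (w0 e)
    _ = _ := by
        simp_rw [ent, Finset.mul_sum]
        rw [Finset.sum_comm]
        apply Finset.sum_congr rfl; intro i _
        rw [Finset.sum_comm]
        apply Finset.sum_congr rfl; intro e _
        simp; ring

lemma mat_lower {k : ℕ} (hk : k + 2 ≤ n) {A : Matrix (Fin n) (Fin n) ℝ} (hA : Aᵀ = A)
    (gA : GammaPlus (k+2) A) (ξ : Fin n → ℝ) :
    esymmMat (k+2) A * ∑ i, ξ i ^ 2 ≤ A.trace * (ξ ⬝ᵥ (newtonT (k+1) A *ᵥ ξ)) := by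
  obtain ⟨U, lam, h1, h2, hU, hs⟩ := spec_exists A hA
  have gl := GG_of_GammaPlus hk hs gA
  set ζ := Uᵀ *ᵥ ξ with hζ
  have q : ξ ⬝ᵥ (newtonT (k+1) A *ᵥ ξ) = ∑ i, EE lam (Finset.univ.erase i) (k+1) * ζ i ^ 2 := by
    rw [newtonT_spec h1 h2 hU hs (k+1) (by omega), ← Matrix.mulVec_mulVec, ← Matrix.mulVec_mulVec,
      Matrix.dotProduct_mulVec, ← Matrix.mulVec_transpose]
    simp only [dotProduct, Matrix.mulVec_diagonal]
    apply Finset.sum_congr rfl; intro i _; rw [← hζ]; ring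
  have nn : ∑ i, ξ i ^ 2 = ∑ i, ζ i ^ 2 := by
    have e1 : ∑ i, ξ i ^ 2 = ξ ⬝ᵥ ((U * Uᵀ) *ᵥ ξ) := by
      rw [h1, Matrix.one_mulVec]; simp [dotProduct, sq]
    rw [e1, ← Matrix.mulVec_mulVec, Matrix.dotProduct_mulVec, ← Matrix.mulVec_transpose]
    simp [dotProduct, sq, ← hζ]
  rw [q, nn, ← esymm_one (by omega), hs _ hk, hs 1 (by omega), Finset.mul_sum, Finset.mul_sum]
  apply Finset.sum_le_sum
  intro i _
  have := EE_lower gl (Finset.mem_univ i)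
  nlinarith [sq_nonneg (ζ i)]

lemma mat_esymm_le {k : ℕ} (hk : k ≤ n) {A : Matrix (Fin n) (Fin n) ℝ} (hA : Aᵀ = A)
    (gA : GammaPlus k A) (hn : 1 ≤ n) {j : ℕ} (hj : j ≤ k) :
    0 < esymmMat j A ∧ esymmMat j A ≤ A.trace ^ j := by
  obtain ⟨U, lam, h1, h2, hU, hs⟩ := spec_exists A hA
  have gl := GG_of_GammaPlus hk hs gA
  rw [hs j (by omega), ← esymm_one hn, hs 1 hn]
  exact ⟨gl j hj, EE_le_pow gl j hj⟩

lemma mat_entry_le {k : ℕ} (hk : k ≤ n) (hk2 : 2 ≤ k) {A : Matrix (Fin n) (Fin n) ℝ} (hA : Aᵀ = A)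
    (gA : GammaPlus k A) (i j : Fin n) : |A i j| ≤ A.trace := by
  have h := trace_newton_mul A hA (j := 1) (by omega)
  have h0 := gA 2 (by norm_num) hk2
  have ht : 0 < A.trace := by rw [← esymm_one (by omega)]; exact gA 1 le_rfl (by omega)
  simp only [newtonT, Matrix.one_mul, Matrix.sub_mul, trace_sub, Matrix.smul_mul, trace_smul, smul_eq_mul] at h
  rw [zero_add, esymm_one (by omega)] at h
  have hsq : (A * A).trace ≤ A.trace ^ 2 := by
    norm_num at h; nlinarith
  have he : A i j ^ 2 ≤ (A * A).trace := by
    have e : (A * A).trace = ∑ i, ∑ j, A i j ^ 2 := by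
      rw [Matrix.trace]
      apply Finset.sum_congr rfl; intro i _
      rw [Matrix.diag_apply, Matrix.mul_apply]
      apply Finset.sum_congr rfl; intro j _
      have := congrFun (congrFun hA i) j
      rw [Matrix.transpose_apply] at this
      rw [this]; ring
    rw [e]
    calc A i j ^ 2 ≤ ∑ j, A i j ^ 2 := Finset.single_le_sum (f := fun j => A i j ^ 2) (fun _ _ => sq_nonneg _) (Finset.mem_univ j)
      _ ≤ _ := Finset.single_le_sum (f := fun i => ∑ j, A i j ^ 2) (fun _ _ => Finset.sum_nonneg fun _ _ => sq_nonneg _) (Finset.mem_univ i)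
  exact abs_le_of_sq_le_sq (he.trans hsq) ht.le

lemma mat_newton_le {k : ℕ} (hk : k ≤ n) (hk2 : 2 ≤ k) {A : Matrix (Fin n) (Fin n) ℝ} (hA : Aᵀ = A)
    (gA : GammaPlus k A) : ∀ j ≤ k, ∀ i l : Fin n, |newtonT j A i l| ≤ ((n:ℝ)+1) ^ j * A.trace ^ j := by
  intro j
  have ht : 0 < A.trace := by rw [← esymm_one (by omega)]; exact gA 1 le_rfl (by omega)
  induction j with
  | zero =>
    intro _ i l
    simp only [newtonT, pow_zero, mul_one, Matrix.one_apply]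
    split_ifs <;> norm_num
  | succ j ih =>
    intro hj i l
    have hσ := mat_esymm_le hk hA gA (by omega) hj
    have h1 : |(newtonT j A * A) i l| ≤ n * (((n:ℝ)+1) ^ j * A.trace ^ j * A.trace) := by
      rw [Matrix.mul_apply]
      refine (Finset.abs_sum_le_sum_abs _ _).trans ?_
      refine (Finset.sum_le_card_nsmul _ _ (((n:ℝ)+1) ^ j * A.trace ^ j * A.trace) ?_).trans_eq (by simp)
      intro m _
      rw [abs_mul]
      exact mul_le_mul (ih (by omega) i m) (mat_entry_le hk hk2 hA gA m l) (abs_nonneg _) (by positivity)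
    have h2 : |(esymmMat (j+1) A • (1 : Matrix (Fin n) (Fin n) ℝ)) i l| ≤ A.trace ^ (j+1) := by
      rw [Matrix.smul_apply, Matrix.one_apply, smul_eq_mul]
      split_ifs
      · rw [mul_one, abs_of_pos hσ.1]; exact hσ.2
      · simp; positivity
    rw [newtonT, Matrix.sub_apply]
    refine (abs_sub _ _).trans ((add_le_add h2 h1).trans ?_)
    have h3 : (1:ℝ) ≤ ((n:ℝ)+1)^j := one_le_pow₀ (by linarith [(Nat.cast_nonneg n : (0:ℝ) ≤ n)])
    have h4 : A.trace ^ (j+1) ≤ ((n:ℝ)+1)^j * A.trace^(j+1) := by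
      apply le_mul_of_one_le_left _ h3; positivity
    calc _ ≤ ((n:ℝ)+1)^j * A.trace^(j+1) + n * (((n:ℝ)+1) ^ j * A.trace ^ j * A.trace) := by linarith
      _ = _ := by ring

end MatSec2


section MatSec3
variable {n : ℕ}

lemma mvpoly_contDiff {σ : Type*} [Fintype σ] (P : MvPolynomial σ ℝ) :
    ContDiff ℝ 2 (fun x : σ → ℝ => MvPolynomial.eval x P) := by
  induction P using MvPolynomial.induction_on with
  | C a => simp only [MvPolynomial.eval_C]; exact contDiff_const
  | add p q hp hq => simp only [map_add]; exact hp.add hq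
  | mul_X p i hp => 
    simp only [map_mul, MvPolynomial.eval_X]
    exact hp.mul (contDiff_apply ℝ ℝ i)

lemma coeff_eq_eval (A : Matrix (Fin n) (Fin n) ℝ) (m : ℕ) :
    A.charpoly.coeff m = MvPolynomial.eval (fun ij : Fin n × Fin n => A ij.1 ij.2) ((Matrix.charpoly.univ ℝ (Fin n)).coeff m) := by
  have := Matrix.charpoly.univ_coeff_eval₂Hom (Fin n) (RingHom.id ℝ) (fun ij : Fin n × Fin n => A ij.1 ij.2) m
  rw [MvPolynomial.coe_eval₂Hom] at this
  rw [show MvPolynomial.eval (fun ij : Fin n × Fin n => A ij.1 ij.2) ((Matrix.charpoly.univ ℝ (Fin n)).coeff m) = MvPolynomial.eval₂ (RingHom.id ℝ) (fun ij : Fin n × Fin n => A ij.1 ij.2) ((Matrix.charpoly.univ ℝ (Fin n)).coeff m) from rfl, this]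
  rfl

lemma newton_horner (A : Matrix (Fin n) (Fin n) ℝ) (t : ℝ) (m : ℕ) :
    (∑ j ∈ Finset.range m, ((-1:ℝ) ^ j * t ^ (m - 1 - j)) • newtonT j A) * (t • (1 : Matrix (Fin n) (Fin n) ℝ) - A)
      = (∑ j ∈ Finset.range (m+1), (-1:ℝ)^j * esymmMat j A * t ^ (m - j)) • (1 : Matrix (Fin n) (Fin n) ℝ)
        - (-1:ℝ)^m • newtonT m A := by
  induction m with
  | zero => simp [newtonT, esymm_zero]
  | succ m ih =>
    have e1 : ∑ j ∈ Finset.range (m+1), ((-1:ℝ) ^ j * t ^ (m + 1 - 1 - j)) • newtonT j A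
        = t • (∑ j ∈ Finset.range m, ((-1:ℝ) ^ j * t ^ (m - 1 - j)) • newtonT j A) + (-1:ℝ)^m • newtonT m A := by
      rw [Finset.sum_range_succ, Finset.smul_sum]
      congr 1
      · apply Finset.sum_congr rfl; intro j hj
        rw [Finset.mem_range] at hj
        rw [smul_smul, show m + 1 - 1 - j = (m - 1 - j) + 1 by omega, pow_succ]; congr 1; ring
      · simp
    have e2 : ∑ j ∈ Finset.range (m+1+1), (-1:ℝ)^j * esymmMat j A * t ^ (m + 1 - j)
        = t * (∑ j ∈ Finset.range (m+1), (-1:ℝ)^j * esymmMat j A * t ^ (m - j)) + (-1:ℝ)^(m+1) * esymmMat (m+1) A := by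
      rw [Finset.sum_range_succ, Finset.mul_sum]
      congr 1
      · apply Finset.sum_congr rfl; intro j hj
        rw [Finset.mem_range] at hj
        rw [show m + 1 - j = (m - j) + 1 by omega, pow_succ]; ring
      · simp
    rw [e1, e2, Matrix.add_mul, Matrix.smul_mul, ih]
    simp only [newtonT]
    rw [Matrix.smul_mul, Matrix.mul_sub]
    ext a b
    simp only [Matrix.add_apply, Matrix.sub_apply, Matrix.smul_apply, smul_eq_mul, Matrix.mul_smul, Matrix.mul_one, Matrix.one_apply]
    ring

lemma newtonT_top (A : Matrix (Fin n) (Fin n) ℝ) (hA : Aᵀ = A) : newtonT n A = 0 := by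
  obtain ⟨U, lam, h1, h2, hU, hs⟩ := spec_exists A hA
  rw [newtonT_spec h1 h2 hU hs n le_rfl]
  have : (fun i => EE lam (Finset.univ.erase i) n) = fun _ => (0:ℝ) := by
    funext i
    unfold EE
    rw [Finset.powersetCard_eq_empty.2, Finset.sum_empty]
    rw [Finset.card_erase_of_mem (Finset.mem_univ i)]
    simp
    exact i.pos
  rw [this]
  have z : (Matrix.diagonal fun _ : Fin n => (0:ℝ)) = 0 := Matrix.diagonal_zero
  rw [z]; simp

lemma charpoly_eval_esymm (A : Matrix (Fin n) (Fin n) ℝ) (t : ℝ) :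
    A.charpoly.eval t = ∑ j ∈ Finset.range (n+1), (-1:ℝ)^j * esymmMat j A * t ^ (n - j) := by
  rw [Polynomial.eval_eq_sum_range, Matrix.charpoly_natDegree_eq_dim, Fintype.card_fin, ← Finset.sum_range_reflect]
  apply Finset.sum_congr rfl; intro j hj
  rw [Finset.mem_range] at hj
  unfold esymmMat
  rw [show n + 1 - 1 - j = n - j by omega, ← mul_assoc, ← pow_add, Even.neg_one_pow ⟨j, rfl⟩, one_mul]

lemma charmat_adj (A : Matrix (Fin n) (Fin n) ℝ) (hA : Aᵀ = A) (t : ℝ) (ht : A.charpoly.eval t ≠ 0) :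
    (t • (1 : Matrix (Fin n) (Fin n) ℝ) - A)⁻¹ = 
     (A.charpoly.eval t)⁻¹ • ∑ j ∈ Finset.range n, ((-1:ℝ) ^ j * t ^ (n - 1 - j)) • newtonT j A := by
  apply Matrix.inv_eq_left_inv
  rw [Matrix.smul_mul, newton_horner, newtonT_top A hA, ← charpoly_eval_esymm, smul_zero, sub_zero, smul_smul,
    inv_mul_cancel₀ ht, one_smul]

lemma charpoly_eval_det (A : Matrix (Fin n) (Fin n) ℝ) (t : ℝ) :
    A.charpoly.eval t = (t • (1 : Matrix (Fin n) (Fin n) ℝ) - A).det := by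
  rw [Matrix.eval_charpoly]; congr 1; rw [Matrix.smul_one_eq_diagonal]; rfl

lemma det_line (M N : Matrix (Fin n) (Fin n) ℝ) (hM : M.det ≠ 0) :
    HasDerivAt (fun s : ℝ => (M + s • N).det) (M.det * (M⁻¹ * N).trace) 0 := by
  have e : (fun s : ℝ => (M + s • N).det) = fun s : ℝ => M.det * (1 + s • (M⁻¹ * N)).det := by
    funext s
    rw [← Matrix.det_mul, Matrix.mul_add, Matrix.mul_one, Matrix.mul_smul, ← Matrix.mul_assoc,
      Matrix.mul_nonsing_inv _ (isUnit_iff_ne_zero.2 hM), Matrix.one_mul]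
  rw [e]
  apply HasDerivAt.const_mul
  set P := (M⁻¹ * N)
  set Q := ((1 + (Polynomial.X : Polynomial ℝ) • P.map Polynomial.C).det.divX.divX)
  have e2 : (fun s : ℝ => (1 + s • P).det) = fun s => 1 + P.trace * s + Q.eval s * s ^ 2 := by
    funext s; exact Matrix.det_one_add_smul s P
  rw [e2]
  have h1 : HasDerivAt (fun s : ℝ => 1 + P.trace * s) P.trace 0 := by
    simpa using ((hasDerivAt_id (0:ℝ)).const_mul P.trace).const_add 1
  have h2 : HasDerivAt (fun s : ℝ => Q.eval s * s ^ 2) 0 0 := by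
    have := (Q.hasDerivAt (0:ℝ)).mul (hasDerivAt_pow 2 (0:ℝ))
    simpa using! this
  simpa using! h1.add h2

end MatSec3


section MatSec4
variable {n : ℕ}

/-- characteristic coefficients as a function of the entries -/
noncomputable def coefF (n m : ℕ) (a : Fin n × Fin n → ℝ) : ℝ :=
  MvPolynomial.eval a ((Matrix.charpoly.univ ℝ (Fin n)).coeff m)

lemma coefF_line (A N : Matrix (Fin n) (Fin n) ℝ) (hA : Aᵀ = A) {j : ℕ} (hj : j + 1 ≤ n) :
    (-1:ℝ)^(j+1) * fderiv ℝ (coefF n (n-(j+1))) (fun ij => A ij.1 ij.2) (fun ij => N ij.1 ij.2)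
      = (newtonT j A * N).trace := by
  set a : Fin n × Fin n → ℝ := fun ij => A ij.1 ij.2 with ha
  set b : Fin n × Fin n → ℝ := fun ij => N ij.1 ij.2 with hb
  set d : ℕ → ℝ := fun m => fderiv ℝ (coefF n m) a b with hd
  have hder : ∀ m, HasDerivAt (fun s : ℝ => (A + s • N).charpoly.coeff m) (d m) 0 := by
    intro m
    have h1 : HasFDerivAt (coefF n m) (fderiv ℝ (coefF n m) a) (a + (0:ℝ) • b) := by
      rw [zero_smul, add_zero]
      exact ((mvpoly_contDiff _).differentiable (by norm_num) a).hasFDerivAt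
    have h2 : HasDerivAt (fun s : ℝ => a + s • b) b 0 := by
      simpa using ((hasDerivAt_id (0:ℝ)).smul_const b).const_add a
    have h3 := h1.comp_hasDerivAt (0:ℝ) h2
    refine h3.congr_of_eventuallyEq (Filter.Eventually.of_forall fun s => ?_)
    simp only [Function.comp]
    rw [coeff_eq_eval]; rfl
  have hpoly : ∀ t : ℝ, A.charpoly.eval t ≠ 0 →
      ∑ m ∈ Finset.range (n+1), d m * t ^ m = -∑ j ∈ Finset.range n, ((-1:ℝ) ^ j * t ^ (n - 1 - j)) * (newtonT j A * N).trace := by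
    intro t ht
    have h1 : HasDerivAt (fun s : ℝ => ∑ m ∈ Finset.range (n+1), (A + s • N).charpoly.coeff m * t ^ m)
        (∑ m ∈ Finset.range (n+1), d m * t ^ m) 0 :=
      HasDerivAt.fun_sum fun m _ => (hder m).mul_const _
    have e : (fun s : ℝ => ∑ m ∈ Finset.range (n+1), (A + s • N).charpoly.coeff m * t ^ m)
        = fun s : ℝ => ((t • (1 : Matrix (Fin n) (Fin n) ℝ) - A) + s • (-N)).det := by
      funext s
      have := charpoly_eval_det (A + s • N) t
      rw [Polynomial.eval_eq_sum_range, Matrix.charpoly_natDegree_eq_dim, Fintype.card_fin] at this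
      rw [this]; congr 1
      rw [smul_neg]; abel
    rw [e] at h1
    have h2 := det_line (t • (1 : Matrix (Fin n) (Fin n) ℝ) - A) (-N) (by rwa [← charpoly_eval_det])
    rw [h1.unique h2, charmat_adj A hA t ht, ← charpoly_eval_det, Matrix.smul_mul, trace_smul, smul_eq_mul,
      mul_inv_cancel_left₀ ht, Matrix.mul_neg, Matrix.trace_neg, Finset.sum_mul, trace_sum]
    congr 1
    apply Finset.sum_congr rfl; intro j _
    rw [Matrix.smul_mul, trace_smul, smul_eq_mul]
  have hP : (∑ m ∈ Finset.range (n+1), Polynomial.monomial m (d m)) = 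
     -∑ j ∈ Finset.range n, Polynomial.monomial (n - 1 - j) ((-1:ℝ) ^ j * (newtonT j A * N).trace) := by
    apply Polynomial.eq_of_infinite_eval_eq
    apply Set.Infinite.mono (s := {t : ℝ | A.charpoly.eval t ≠ 0})
    · intro t ht
      have := hpoly t ht
      simp only [Set.mem_setOf_eq, Polynomial.eval_finset_sum, Polynomial.eval_neg, Polynomial.eval_monomial]
      rw [this]; congr 1; apply Finset.sum_congr rfl; intro j _; ring
    · have hfin : {t : ℝ | A.charpoly.eval t = 0}.Finite := by
        have h0 : A.charpoly ≠ 0 := (Matrix.charpoly_monic A).ne_zero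
        refine (A.charpoly.roots.toFinset.finite_toSet).subset ?_
        intro t ht
        simp only [Finset.mem_coe, Multiset.mem_toFinset, Polynomial.mem_roots h0]
        exact ht
      exact hfin.infinite_compl
  have hc := congrArg (fun P => Polynomial.coeff P (n - (j+1))) hP
  simp only [Polynomial.finset_sum_coeff, Polynomial.coeff_neg, Polynomial.coeff_monomial] at hc
  rw [Finset.sum_ite_eq' (Finset.range (n+1))] at hc
  rw [if_pos (Finset.mem_range.2 (by omega))] at hc
  rw [Finset.sum_eq_single j] at hc
  · rw [if_pos (by omega)] at hc
    change (-1:ℝ)^(j+1) * d (n-(j+1)) = _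
    rw [hc, pow_succ]
    have : (-1:ℝ)^j * (-1:ℝ)^j = 1 := by rw [← pow_add, Even.neg_one_pow ⟨j, rfl⟩]
    linear_combination (newtonT j A * N).trace * this
  · intro i hi hij
    rw [Finset.mem_range] at hi
    rw [if_neg (by omega)]
  · intro h; exact absurd (Finset.mem_range.2 (by omega)) h

variable {E : Type*} [NormedAddCommGroup E] [NormedSpace ℝ E]

lemma esymm_eq_coefF (A : Matrix (Fin n) (Fin n) ℝ) (j : ℕ) :
    esymmMat j A = (-1:ℝ)^j * coefF n (n-j) (fun ij => A ij.1 ij.2) := by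
  unfold esymmMat coefF; rw [coeff_eq_eval]

lemma coefF_contDiff (m : ℕ) : ContDiff ℝ 2 (coefF n m) := mvpoly_contDiff _

lemma esymm_fderiv {B : E → Matrix (Fin n) (Fin n) ℝ} {x : E} (hB : ∀ a b, DifferentiableAt ℝ (fun x => B x a b) x)
    (hs : (B x)ᵀ = B x) {j : ℕ} (hj : j + 1 ≤ n) (v : E) :
    fderiv ℝ (fun x => esymmMat (j+1) (B x)) x v 
      = (newtonT j (B x) * Matrix.of fun a b => fderiv ℝ (fun x => B x a b) x v).trace := by
  rw [← coefF_line _ _ hs hj]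
  have e : (fun x => esymmMat (j+1) (B x)) = fun x => (-1:ℝ)^(j+1) * coefF n (n-(j+1)) ((fun x (ij : Fin n × Fin n) => B x ij.1 ij.2) x) := by
    funext x; exact esymm_eq_coefF _ _
  have h2 : HasFDerivAt (fun x (ij : Fin n × Fin n) => B x ij.1 ij.2) 
      (ContinuousLinearMap.pi fun ij : Fin n × Fin n => fderiv ℝ (fun x => B x ij.1 ij.2) x) x := by
    rw [hasFDerivAt_pi]
    intro ij; exact (hB _ _).hasFDerivAt
  have h1 : HasFDerivAt (coefF n (n-(j+1))) (fderiv ℝ (coefF n (n-(j+1))) (fun ij => B x ij.1 ij.2)) (fun ij => B x ij.1 ij.2) :=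
    ((coefF_contDiff _).differentiable (by norm_num) _).hasFDerivAt
  have h3 := (h1.comp x h2).const_mul ((-1:ℝ)^(j+1))
  rw [e]
  have h4 := h3.fderiv
  simp only [Function.comp_def] at h4
  rw [h4]
  simp

lemma esymm_contDiffOn {B : E → Matrix (Fin n) (Fin n) ℝ} {s : Set E} {N : WithTop ℕ∞} (hN : N ≤ 2)
    (hB : ∀ a b, ContDiffOn ℝ N (fun x => B x a b) s) (j : ℕ) :
    ContDiffOn ℝ N (fun x => esymmMat j (B x)) s := by
  have e : (fun x => esymmMat (j) (B x)) = fun x => (-1:ℝ)^(j) * coefF n (n-(j)) ((fun x (ij : Fin n × Fin n) => B x ij.1 ij.2) x) := by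
    funext x; exact esymm_eq_coefF _ _
  rw [e]
  exact contDiffOn_const.mul (((coefF_contDiff _).of_le hN).comp_contDiffOn (contDiffOn_pi.2 fun ij => hB _ _))

lemma newton_contDiffOn {B : E → Matrix (Fin n) (Fin n) ℝ} {s : Set E} {N : WithTop ℕ∞} (hN : N ≤ 2)
    (hB : ∀ a b, ContDiffOn ℝ N (fun x => B x a b) s) (j : ℕ) :
    ∀ i l, ContDiffOn ℝ N (fun x => newtonT j (B x) i l) s := by
  induction j with
  | zero => intro i l; simp only [newtonT]; exact contDiffOn_const
  | succ j ih =>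
    intro i l
    simp only [newtonT, Matrix.sub_apply, Matrix.smul_apply, smul_eq_mul, Matrix.mul_apply]
    exact ((esymm_contDiffOn hN hB _).mul contDiffOn_const).sub (ContDiffOn.sum fun m _ => (ih i m).mul (hB m l))

lemma esymm_continuousOn {X : Type*} [TopologicalSpace X] {B : X → Matrix (Fin n) (Fin n) ℝ} {s : Set X} 
    (hB : ∀ a b, ContinuousOn (fun x => B x a b) s) (j : ℕ) :
    ContinuousOn (fun x => esymmMat j (B x)) s := by
  have e : (fun x => esymmMat (j) (B x)) = fun x => (-1:ℝ)^(j) * coefF n (n-(j)) ((fun x (ij : Fin n × Fin n) => B x ij.1 ij.2) x) := by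
    funext x; exact esymm_eq_coefF _ _
  rw [e]
  exact continuousOn_const.mul ((coefF_contDiff _).continuous.comp_continuousOn (continuousOn_pi.2 fun ij => hB _ _))

lemma newton_continuousOn {X : Type*} [TopologicalSpace X] {B : X → Matrix (Fin n) (Fin n) ℝ} {s : Set X}
    (hB : ∀ a b, ContinuousOn (fun x => B x a b) s) (j : ℕ) :
    ∀ i l, ContinuousOn (fun x => newtonT j (B x) i l) s := by
  induction j with
  | zero => intro i l; simp only [newtonT]; exact continuousOn_const
  | succ j ih =>
    intro i l
    simp only [newtonT, Matrix.sub_apply, Matrix.smul_apply, smul_eq_mul, Matrix.mul_apply]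
    exact ((esymm_continuousOn hB _).mul continuousOn_const).sub (continuousOn_finset_sum _ fun m _ => (ih i m).mul (hB m l))

end MatSec4


section PdSec
variable {n : ℕ}

lemma pd_contDiffOn {U : Set (Fin n → ℝ)} (hU : IsOpen U) {w : (Fin n → ℝ) → ℝ} {m N : WithTop ℕ∞}
    (hw : ContDiffOn ℝ N w U) (hm : m + 1 ≤ N) (i : Fin n) : ContDiffOn ℝ m (pd i w) U :=
  (hw.fderiv_of_isOpen hU hm).clm_apply contDiffOn_const

lemma pd_contDiff {w : (Fin n → ℝ) → ℝ} {m N : WithTop ℕ∞}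
    (hw : ContDiff ℝ N w) (hm : m + 1 ≤ N) (i : Fin n) : ContDiff ℝ m (pd i w) :=
  (hw.fderiv_right hm).clm_apply contDiff_const

lemma diffAt_of_on {U : Set (Fin n → ℝ)} (hU : IsOpen U) {w : (Fin n → ℝ) → ℝ} 
    (hw : ContDiffOn ℝ 1 w U) {x} (hx : x ∈ U) : DifferentiableAt ℝ w x :=
  (hw.contDiffAt (hU.mem_nhds hx)).differentiableAt (by norm_num)

lemma pd_comm {U : Set (Fin n → ℝ)} (hU : IsOpen U) {w : (Fin n → ℝ) → ℝ} 
    (hw : ContDiffOn ℝ 2 w U) {x} (hx : x ∈ U) (i j : Fin n) : pd i (pd j w) x = pd j (pd i w) x := by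
  have hc : ContDiffAt ℝ 2 w x := hw.contDiffAt (hU.mem_nhds hx)
  have hs := hc.isSymmSndFDerivAt (by simp)
  have hd : DifferentiableAt ℝ (fderiv ℝ w) x :=
    (hc.fderiv_right (m := 1) (by norm_num)).differentiableAt (by norm_num)
  have e : ∀ i j, pd i (pd j w) x = fderiv ℝ (fderiv ℝ w) x (Pi.single i 1) (Pi.single j 1) := by
    intro i j
    unfold pd
    rw [fderiv_clm_apply hd (differentiableAt_const _)]
    simp
  rw [e, e]; exact hs _ _

lemma pd_congr {w v : (Fin n → ℝ) → ℝ} {x} (h : w =ᶠ[nhds x] v) (i : Fin n) : pd i w x = pd i v x := by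
  unfold pd; rw [h.fderiv_eq]

lemma pd_congr_ev {w v : (Fin n → ℝ) → ℝ} {x} (h : w =ᶠ[nhds x] v) (i : Fin n) : pd i w =ᶠ[nhds x] pd i v := by
  filter_upwards [h.eventuallyEq_nhds] with y hy
  exact pd_congr hy i

lemma pd_add {w v : (Fin n → ℝ) → ℝ} {x} (hw : DifferentiableAt ℝ w x) (hv : DifferentiableAt ℝ v x) (i : Fin n) :
    pd i (fun y => w y + v y) x = pd i w x + pd i v x := by
  unfold pd; rw [fderiv_fun_add hw hv]; rfl

lemma pd_sub {w v : (Fin n → ℝ) → ℝ} {x} (hw : DifferentiableAt ℝ w x) (hv : DifferentiableAt ℝ v x) (i : Fin n) :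
    pd i (fun y => w y - v y) x = pd i w x - pd i v x := by
  unfold pd; rw [fderiv_fun_sub hw hv]; rfl

lemma pd_mul {w v : (Fin n → ℝ) → ℝ} {x} (hw : DifferentiableAt ℝ w x) (hv : DifferentiableAt ℝ v x) (i : Fin n) :
    pd i (fun y => w y * v y) x = w x * pd i v x + pd i w x * v x := by
  unfold pd; rw [fderiv_fun_mul hw hv]; simp; ring

lemma pd_sum {ι : Type*} {s : Finset ι} {w : ι → (Fin n → ℝ) → ℝ} {x} (hw : ∀ a ∈ s, DifferentiableAt ℝ (w a) x) (i : Fin n) :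
    pd i (fun y => ∑ a ∈ s, w a y) x = ∑ a ∈ s, pd i (w a) x := by
  unfold pd; rw [fderiv_fun_sum hw]; simp

lemma pd_mul_const {w : (Fin n → ℝ) → ℝ} {x} (hw : DifferentiableAt ℝ w x) (c : ℝ) (i : Fin n) :
    pd i (fun y => w y * c) x = pd i w x * c := by
  unfold pd; rw [fderiv_mul_const hw]; simp; ring

/-- shifted Newton tensors -/
noncomputable def newtonP {n : ℕ} : ℕ → Matrix (Fin n) (Fin n) ℝ → Matrix (Fin n) (Fin n) ℝ
  | 0, _ => 0
  | (j + 1), A => newtonT j A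

lemma newtonT_eq_P (j : ℕ) (A : Matrix (Fin n) (Fin n) ℝ) :
    newtonT j A = esymmMat j A • (1 : Matrix (Fin n) (Fin n) ℝ) - newtonP j A * A := by
  cases j with
  | zero => simp [newtonT, newtonP, esymm_zero]
  | succ j => rfl

lemma newtonP_symm (A : Matrix (Fin n) (Fin n) ℝ) (hA : Aᵀ = A) (j : ℕ) :
    (newtonP j A)ᵀ = newtonP j A ∧ newtonP j A * A = A * newtonP j A := by
  cases j with
  | zero => simp [newtonP]
  | succ j => exact newtonT_symm A hA j

lemma newton_div {B : (Fin n → ℝ) → Matrix (Fin n) (Fin n) ℝ} {x : Fin n → ℝ} {γ : Fin n → ℝ}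
    (hB : ∀ a b, ContDiff ℝ 1 (fun x => B x a b)) (hs : ∀ x, (B x)ᵀ = B x)
    (hd : ∀ i a b, pd i (fun x => B x a b) x - pd a (fun x => B x i b) x 
      = - γ i * (if a = b then 1 else 0) + γ a * (if i = b then 1 else 0)) :
    ∀ j ≤ n, ∀ l, ∑ i, pd i (fun x => newtonT j (B x) i l) x = -((n:ℝ) - j) * ∑ i, newtonP j (B x) i l * γ i := by
  intro j
  induction j with
  | zero =>
    intro _ l
    simp [newtonT, newtonP, pd]
  | succ j ih =>
    intro hj l
    have hBd : ∀ a b, DifferentiableAt ℝ (fun x => B x a b) x := fun a b => (hB a b).differentiable (by norm_num) x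
    have hTd : ∀ a b, DifferentiableAt ℝ (fun x => newtonT j (B x) a b) x := fun a b => by
      have := newton_contDiffOn (N := 1) (by norm_num) (fun a b => (hB a b).contDiffOn (s := univ)) j a b
      exact diffAt_of_on isOpen_univ this (mem_univ _)
    have hσd : DifferentiableAt ℝ (fun x => esymmMat (j+1) (B x)) x := by
      have := esymm_contDiffOn (N := 1) (by norm_num) (fun a b => (hB a b).contDiffOn (s := univ)) (j+1)
      exact diffAt_of_on isOpen_univ this (mem_univ _)
    have hσ : ∀ i, pd i (fun x => esymmMat (j+1) (B x)) x = ∑ a, ∑ b, newtonT j (B x) a b * pd i (fun x => B x b a) x := by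
      intro i
      unfold pd
      rw [esymm_fderiv hBd (hs x) hj, Matrix.trace]
      simp [Matrix.mul_apply]
    have e : ∀ i, pd i (fun x => newtonT (j+1) (B x) i l) x = 
        pd i (fun x => esymmMat (j+1) (B x)) x * (if i = l then 1 else 0) 
         - ∑ m, (newtonT j (B x) i m * pd i (fun x => B x m l) x + pd i (fun x => newtonT j (B x) i m) x * B x m l) := by
      intro i
      have : (fun x => newtonT (j+1) (B x) i l) = fun x => esymmMat (j+1) (B x) * (if i = l then 1 else 0) - ∑ m, newtonT j (B x) i m * B x m l := by
        funext x
        simp [newtonT, Matrix.mul_apply, Matrix.one_apply]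
      rw [this, pd_sub, pd_mul_const hσd, pd_sum]
      · congr 1; apply Finset.sum_congr rfl; intro m _; rw [pd_mul (hTd _ _) (hBd _ _)]
      · intro m _; exact (hTd _ _).mul (hBd _ _)
      · exact hσd.mul_const _
      · exact DifferentiableAt.fun_sum fun m _ => (hTd _ _).mul (hBd _ _)
    simp_rw [e]
    rw [Finset.sum_sub_distrib]
    have s1 : ∑ i, pd i (fun x => esymmMat (j+1) (B x)) x * (if i = l then 1 else 0) = ∑ a, ∑ b, newtonT j (B x) a b * pd l (fun x => B x b a) x := by
      simp [hσ]
    have s2 : ∑ i, ∑ m, (newtonT j (B x) i m * pd i (fun x => B x m l) x + pd i (fun x => newtonT j (B x) i m) x * B x m l)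
       = ∑ i, ∑ m, newtonT j (B x) i m * pd i (fun x => B x m l) x + ∑ m, (∑ i, pd i (fun x => newtonT j (B x) i m) x) * B x m l := by
      simp_rw [Finset.sum_add_distrib]
      congr 1
      rw [Finset.sum_comm]; apply Finset.sum_congr rfl; intro m _; rw [Finset.sum_mul]
    have hBs : ∀ x a b, B x a b = B x b a := fun x a b => by
      have := congrFun (congrFun (hs x) b) a; rwa [Matrix.transpose_apply] at this
    have s3 : ∑ a, ∑ b, newtonT j (B x) a b * pd l (fun x => B x b a) x - ∑ i, ∑ m, newtonT j (B x) i m * pd i (fun x => B x m l) x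
       = - γ l * (newtonT j (B x)).trace + ∑ i, newtonT j (B x) i l * γ i := by
      rw [← Finset.sum_sub_distrib]
      have : ∀ a, ∑ b, newtonT j (B x) a b * pd l (fun x => B x b a) x - ∑ m, newtonT j (B x) a m * pd a (fun x => B x m l) x
          = - γ l * newtonT j (B x) a a + newtonT j (B x) a l * γ a := by
        intro a
        rw [← Finset.sum_sub_distrib]
        have : ∀ b, newtonT j (B x) a b * pd l (fun x => B x b a) x - newtonT j (B x) a b * pd a (fun x => B x b l) x
          = - γ l * (newtonT j (B x) a b * (if a = b then 1 else 0)) + γ a * (newtonT j (B x) a b * (if l = b then 1 else 0)) := by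
          intro b
          have h1 : (fun x => B x b a) = fun x => B x a b := by funext y; exact hBs y b a
          have h2 : (fun x => B x b l) = fun x => B x l b := by funext y; exact hBs y b l
          rw [h1, h2]
          linear_combination (newtonT j (B x) a b) * hd l a b
        simp_rw [this, Finset.sum_add_distrib, ← Finset.mul_sum]
        simp; ring
      simp_rw [this, Finset.sum_add_distrib, ← Finset.mul_sum]
      rfl
    have s4 : ∑ m, (∑ i, pd i (fun x => newtonT j (B x) i m) x) * B x m l = 
       -((n:ℝ)-j) * (esymmMat j (B x) * γ l - ∑ i, newtonT j (B x) i l * γ i) := by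
      have hmat : newtonP j (B x) * B x = esymmMat j (B x) • (1 : Matrix (Fin n) (Fin n) ℝ) - newtonT j (B x) := by
        rw [newtonT_eq_P]; abel
      have : ∀ i, ∑ m, newtonP j (B x) i m * B x m l = esymmMat j (B x) * (if i = l then 1 else 0) - newtonT j (B x) i l := by
        intro i
        have := congrFun (congrFun hmat i) l
        simpa [Matrix.mul_apply, Matrix.one_apply] using this
      simp_rw [ih (by omega), mul_assoc, ← Finset.mul_sum]
      congr 1
      simp_rw [Finset.sum_mul]
      rw [Finset.sum_comm]
      have : ∀ i, ∑ m, newtonP j (B x) i m * γ i * B x m l = (esymmMat j (B x) * (if i = l then 1 else 0) - newtonT j (B x) i l) * γ i := by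
        intro i; rw [← this, Finset.sum_mul]; apply Finset.sum_congr rfl; intro m _; ring
      simp_rw [this, sub_mul, Finset.sum_sub_distrib]
      simp
    rw [s1, s2, ← sub_sub, s3, s4, trace_newton _ (hs x) (by omega)]
    simp only [newtonP]
    push_cast
    ring

end PdSec


section WeakSec
variable {n : ℕ}

/-- augmented matrix field -/
noncomputable def augM (u g : (Fin n → ℝ) → ℝ) (x : Fin n → ℝ) : Matrix (Fin n) (Fin n) ℝ :=
  hess u x - g x • (1 : Matrix (Fin n) (Fin n) ℝ)

lemma augM_apply (u g : (Fin n → ℝ) → ℝ) (x : Fin n → ℝ) (a b : Fin n) :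
    augM u g x a b = pd a (pd b u) x - g x * (if a = b then 1 else 0) := by
  simp [augM, hess, Matrix.one_apply]

lemma pd_continuous {w : (Fin n → ℝ) → ℝ} (hw : ContDiff ℝ 1 w) (i : Fin n) : Continuous (pd i w) :=
  (pd_contDiff (m := 0) hw (by norm_num) i).continuous

lemma pd_hasCompactSupport {w : (Fin n → ℝ) → ℝ} (hw : HasCompactSupport w) (i : Fin n) :
    HasCompactSupport (pd i w) := hw.fderiv_apply ℝ _

lemma newtonP_continuousOn {X : Type*} [TopologicalSpace X] {B : X → Matrix (Fin n) (Fin n) ℝ} {s : Set X}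
    (hB : ∀ a b, ContinuousOn (fun x => B x a b) s) (j : ℕ) :
    ∀ i l, ContinuousOn (fun x => newtonP j (B x) i l) s := by
  cases j with
  | zero => intro i l; simp only [newtonP]; exact continuousOn_const
  | succ j => exact newton_continuousOn hB j

lemma augM_symm_on {U : Set (Fin n → ℝ)} (hU : IsOpen U) {u : (Fin n → ℝ) → ℝ} (g : (Fin n → ℝ) → ℝ)
    (hu : ContDiffOn ℝ 2 u U) {x} (hx : x ∈ U) : (augM u g x)ᵀ = augM u g x := by
  ext a b
  rw [Matrix.transpose_apply, augM_apply, augM_apply, pd_comm hU hu hx]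
  simp [eq_comm]

lemma weak_smooth {w g : (Fin n → ℝ) → ℝ} (hw : ContDiff ℝ 3 w) (hg : ContDiff ℝ 1 g)
    {X : Fin n → (Fin n → ℝ) → ℝ} (hX : ∀ l, ContDiff ℝ 1 (X l)) (hXc : ∀ l, HasCompactSupport (X l))
    {j : ℕ} (hj : j ≤ n) :
    ∫ x, ∑ i, ∑ l, newtonT j (augM w g x) i l * pd i (X l) x
      = ((n:ℝ) - j) * ∫ x, ∑ i, ∑ l, newtonP j (augM w g x) i l * pd i g x * X l x := by
  have hB : ∀ a b, ContDiff ℝ 1 (fun x => augM w g x a b) := by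
    intro a b
    simp_rw [augM_apply]
    exact (pd_contDiff (N := 2) (pd_contDiff hw (by norm_num) b) (by norm_num) a).sub (hg.mul contDiff_const)
  have hs : ∀ x, (augM w g x)ᵀ = augM w g x := fun x =>
    augM_symm_on isOpen_univ g ((hw.of_le (by norm_num)).contDiffOn) (mem_univ x)
  have hT : ∀ i l, ContDiff ℝ 1 (fun x => newtonT j (augM w g x) i l) := fun i l => by
    have := newton_contDiffOn (N := 1) (by norm_num) (fun a b => (hB a b).contDiffOn (s := univ)) j i l
    exact contDiffOn_univ.1 this
  have hd : ∀ x i a b, pd i (fun x => augM w g x a b) x - pd a (fun x => augM w g x i b) x 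
      = - pd i g x * (if a = b then 1 else 0) + pd a g x * (if i = b then 1 else 0) := by
    intro x i a b
    have h2 : ∀ i a b, pd i (fun x => augM w g x a b) x = pd i (pd a (pd b w)) x - pd i g x * (if a = b then 1 else 0) := by
      intro i a b
      simp_rw [augM_apply]
      have hgd : DifferentiableAt ℝ g x := hg.differentiable (by norm_num) x
      rw [pd_sub _ (hgd.mul_const _), pd_mul_const hgd]
      exact ((pd_contDiff (m := 1) (N := 2) (pd_contDiff hw (by norm_num) b) (by norm_num) a).differentiable (by norm_num)) x
    rw [h2, h2, pd_comm isOpen_univ (w := pd b w) ((pd_contDiff hw (by norm_num) b).contDiffOn) (mem_univ x)]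
    ring
  have hdiv := fun x => newton_div hB hs (hd x) j hj
  have i1 : ∀ i l, Integrable (fun x => newtonT j (augM w g x) i l * pd i (X l) x) := fun i l =>
    ((hT i l).continuous.mul (pd_continuous (hX l) i)).integrable_of_hasCompactSupport
      ((pd_hasCompactSupport (hXc l) i).mul_left)
  have i2 : ∀ i l, Integrable (fun x => pd i (fun x => newtonT j (augM w g x) i l) x * X l x) := fun i l =>
    ((pd_continuous (hT i l) i).mul (hX l).continuous).integrable_of_hasCompactSupport ((hXc l).mul_left)
  have i3 : ∀ i l, Integrable (fun x => newtonT j (augM w g x) i l * X l x) := fun i l =>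
    ((hT i l).continuous.mul (hX l).continuous).integrable_of_hasCompactSupport ((hXc l).mul_left)
  have ibp : ∀ i l, ∫ x, newtonT j (augM w g x) i l * pd i (X l) x = - ∫ x, pd i (fun x => newtonT j (augM w g x) i l) x * X l x := by
    intro i l
    exact integral_mul_fderiv_eq_neg_fderiv_mul_of_integrable (i2 i l) (i1 i l) (i3 i l)
      (fun x _ => (hT i l).differentiable (by norm_num) x) (fun x _ => (hX l).differentiable (by norm_num) x)
  rw [integral_finset_sum _ (fun i _ => integrable_finset_sum _ fun l _ => i1 i l)]
  simp_rw [integral_finset_sum _ (fun l _ => i1 _ l), ibp, Finset.sum_neg_distrib]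
  simp_rw [← integral_finset_sum _ (fun l _ => i2 _ l)]
  rw [← integral_finset_sum _ (fun i _ => integrable_finset_sum _ fun l _ => i2 i l), ← integral_neg, ← integral_const_mul]
  congr 1
  funext x
  rw [Finset.sum_comm]
  simp_rw [← Finset.sum_mul, hdiv x]
  rw [Finset.sum_comm (f := fun i l => newtonP j (augM w g x) i l * pd i g x * X l x), Finset.mul_sum, ← Finset.sum_neg_distrib]
  apply Finset.sum_congr rfl; intro l _
  rw [← Finset.sum_mul]; ring

lemma conv_pd {u φ : (Fin n → ℝ) → ℝ} (hφ : LocallyIntegrable φ volume) (hu : ContDiff ℝ 1 u) (hc : HasCompactSupport u) (i : Fin n) :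
    pd i (convolution φ u (ContinuousLinearMap.lsmul ℝ ℝ) volume) = convolution φ (pd i u) (ContinuousLinearMap.lsmul ℝ ℝ) volume := by
  funext x
  unfold pd
  rw [(hc.hasFDerivAt_convolution_right (ContinuousLinearMap.lsmul ℝ ℝ) hφ hu x).fderiv]
  rw [convolution_precompR_apply _ hφ (hc.fderiv ℝ) (hu.continuous_fderiv (by norm_num))]

lemma moll {u : (Fin n → ℝ) → ℝ} (hu : ContDiff ℝ 2 u) (hc : HasCompactSupport u) {ε : ℝ} (hε : 0 < ε) :
    ∃ w : (Fin n → ℝ) → ℝ, ContDiff ℝ 3 w ∧ ∀ x a b, |pd a (pd b w) x - pd a (pd b u) x| ≤ ε := by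
  have huc : ∀ a b, UniformContinuous (pd a (pd b u)) := fun a b =>
    (pd_hasCompactSupport (pd_hasCompactSupport hc b) a).uniformContinuous_of_continuous
      (pd_continuous (pd_contDiff hu (by norm_num) b) a)
  have : ∃ δ > 0, ∀ a b x y, dist x y < δ → dist (pd a (pd b u) x) (pd a (pd b u) y) < ε := by
    have h : ∀ ab : Fin n × Fin n, ∃ δ > 0, ∀ x y, dist x y < δ → dist (pd ab.1 (pd ab.2 u) x) (pd ab.1 (pd ab.2 u) y) < ε := 
      fun ab => by
        obtain ⟨δ, h1, h2⟩ := Metric.uniformContinuous_iff.1 (huc ab.1 ab.2) ε hε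
        exact ⟨δ, h1, fun x y h => h2 h⟩
    choose d d0 hd using h
    rcases isEmpty_or_nonempty (Fin n × Fin n) with he | he
    · exact ⟨1, one_pos, fun a b => (he.false (a,b)).elim⟩
    · refine ⟨Finset.univ.inf' Finset.univ_nonempty d, ?_, ?_⟩
      · rw [gt_iff_lt, Finset.lt_inf'_iff]; exact fun ab _ => d0 ab
      · intro a b x y h
        exact hd (a,b) x y (h.trans_le (Finset.inf'_le _ (Finset.mem_univ _)))
  obtain ⟨δ, δ0, hδ⟩ := this
  let φ : ContDiffBump (0 : Fin n → ℝ) := ⟨δ/2, δ, by linarith, by linarith⟩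
  have hφ : LocallyIntegrable (φ.normed volume) volume := φ.continuous_normed.locallyIntegrable
  refine ⟨convolution (φ.normed volume) u (ContinuousLinearMap.lsmul ℝ ℝ) volume, ?_, ?_⟩
  · exact (φ.hasCompactSupport_normed).contDiff_convolution_left (n := 3) _ φ.contDiff_normed hu.continuous.locallyIntegrable
  · intro x a b
    rw [conv_pd hφ (hu.of_le (by norm_num)) hc, conv_pd hφ (pd_contDiff hu (by norm_num) b) (pd_hasCompactSupport hc b)]
    rw [← Real.dist_eq]
    apply ContDiffBump.dist_normed_convolution_le (huc a b).continuous.aestronglyMeasurable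
    intro y hy
    exact (hδ a b y x hy).le

lemma entry_bound (M : ℝ) (j : ℕ) : ∃ C, ∀ A : Matrix (Fin n) (Fin n) ℝ, (∀ a b, |A a b| ≤ M) → ∀ i l,
    |newtonT j A i l| ≤ C ∧ |newtonP j A i l| ≤ C := by
  have hcont : ∀ i l : Fin n, Continuous (fun a : Fin n × Fin n → ℝ => newtonT j (Matrix.of fun i l => a (i,l)) i l) ∧
      Continuous (fun a : Fin n × Fin n → ℝ => newtonP j (Matrix.of fun i l => a (i,l)) i l) := by
    intro i l
    have hb : ∀ p q : Fin n, ContinuousOn (fun a : Fin n × Fin n → ℝ => (Matrix.of fun i l => a (i,l)) p q) univ := fun p q =>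
      (continuous_apply (p,q)).continuousOn
    exact ⟨continuousOn_univ.1 (newton_continuousOn hb j i l), continuousOn_univ.1 (newtonP_continuousOn hb j i l)⟩
  have hK : IsCompact (Set.pi univ (fun _ : Fin n × Fin n => Set.Icc (-M) M)) := isCompact_univ_pi fun _ => isCompact_Icc
  have h1 : ∀ il : Fin n × Fin n, ∃ C, ∀ a ∈ (Set.pi univ (fun _ : Fin n × Fin n => Set.Icc (-M) M)), 
      |newtonT j (Matrix.of fun i l => a (i,l)) il.1 il.2| ≤ C ∧ |newtonP j (Matrix.of fun i l => a (i,l)) il.1 il.2| ≤ C := by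
    intro il
    obtain ⟨C1, h1⟩ := hK.exists_bound_of_continuousOn (hcont il.1 il.2).1.continuousOn
    obtain ⟨C2, h2⟩ := hK.exists_bound_of_continuousOn (hcont il.1 il.2).2.continuousOn
    exact ⟨max C1 C2, fun a ha => ⟨(h1 a ha).trans (le_max_left _ _), (h2 a ha).trans (le_max_right _ _)⟩⟩
  choose C hC using h1
  refine ⟨∑ il, |C il|, fun A hA i l => ?_⟩
  have := hC (i,l) (fun p => A p.1 p.2) (fun p _ => abs_le.1 (hA p.1 p.2))
  have h2 : C (i,l) ≤ ∑ il, |C il| := (le_abs_self _).trans (Finset.single_le_sum (f := fun il => |C il|) (fun _ _ => abs_nonneg _) (Finset.mem_univ (i,l)))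
  exact ⟨this.1.trans h2, this.2.trans h2⟩

end WeakSec


section WeakSec2
variable {n : ℕ}

lemma newton_tendsto {Bm : ℕ → Matrix (Fin n) (Fin n) ℝ} {B : Matrix (Fin n) (Fin n) ℝ}
    (h : ∀ a b, Filter.Tendsto (fun m => Bm m a b) Filter.atTop (nhds (B a b))) (j : ℕ) (i l : Fin n) :
    Filter.Tendsto (fun m => newtonT j (Bm m) i l) Filter.atTop (nhds (newtonT j B i l)) ∧
    Filter.Tendsto (fun m => newtonP j (Bm m) i l) Filter.atTop (nhds (newtonP j B i l)) := by
  have hb : ∀ p q : Fin n, ContinuousOn (fun a : Fin n × Fin n → ℝ => (Matrix.of fun i l => a (i,l)) p q) univ := fun p q =>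
      (continuous_apply (p,q)).continuousOn
  have c1 := continuousOn_univ.1 (newton_continuousOn hb j i l)
  have c2 := continuousOn_univ.1 (newtonP_continuousOn hb j i l)
  have ht : Filter.Tendsto (fun m => fun p : Fin n × Fin n => Bm m p.1 p.2) Filter.atTop (nhds (fun p => B p.1 p.2)) :=
    tendsto_pi_nhds.2 fun p => h p.1 p.2
  exact ⟨(c1.tendsto _).comp ht, (c2.tendsto _).comp ht⟩

lemma weak_c2 {u g : (Fin n → ℝ) → ℝ} (hu : ContDiff ℝ 2 u) (huc : HasCompactSupport u) (hg : ContDiff ℝ 1 g)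
    (hgc : HasCompactSupport g)
    {X : Fin n → (Fin n → ℝ) → ℝ} (hX : ∀ l, ContDiff ℝ 1 (X l)) (hXc : ∀ l, HasCompactSupport (X l))
    {j : ℕ} (hj : j ≤ n) :
    ∫ x, ∑ i, ∑ l, newtonT j (augM u g x) i l * pd i (X l) x
      = ((n:ℝ) - j) * ∫ x, ∑ i, ∑ l, newtonP j (augM u g x) i l * pd i g x * X l x := by
  choose w hw hwu using fun m : ℕ => moll hu huc (ε := 1/((m:ℝ)+1)) (by positivity)
  have hcu : ∀ a b, Continuous (pd a (pd b u)) := fun a b => pd_continuous (pd_contDiff hu (by norm_num) b) a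
  have bu : ∃ M, ∀ x a b, |pd a (pd b u) x| ≤ M := by
    have h : ∀ ab : Fin n × Fin n, ∃ M, ∀ x, ‖pd ab.1 (pd ab.2 u) x‖ ≤ M := fun ab =>
      (pd_hasCompactSupport (pd_hasCompactSupport huc ab.2) ab.1).exists_bound_of_continuous (hcu _ _)
    choose C hC using h
    exact ⟨∑ ab, |C ab|, fun x a b => (hC (a,b) x).trans ((le_abs_self _).trans (Finset.single_le_sum (f := fun il => |C il|) (fun _ _ => abs_nonneg _) (Finset.mem_univ (a,b))))⟩
  obtain ⟨Mu, hMu⟩ := bu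
  obtain ⟨Mg, hMg⟩ := hgc.exists_bound_of_continuous hg.continuous
  have hent : ∀ m x a b, |augM (w m) g x a b| ≤ Mu + 1 + Mg := by
    intro m x a b
    rw [augM_apply]
    have h1 : |pd a (pd b (w m)) x| ≤ Mu + 1 := by
      have h2 := hwu m x a b
      have h3 : 1/((m:ℝ)+1) ≤ 1 := by rw [div_le_one (by positivity)]; linarith [(Nat.cast_nonneg m : (0:ℝ) ≤ m)]
      have h4 := hMu x a b
      have h5 := abs_sub_abs_le_abs_sub (pd a (pd b (w m)) x) (pd a (pd b u) x)
      linarith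
    have h2 : |g x * (if a = b then 1 else 0)| ≤ Mg := by
      have := hMg x
      rw [Real.norm_eq_abs] at this
      split_ifs
      · rwa [mul_one]
      · simp; exact (abs_nonneg _).trans this
    exact (abs_sub _ _).trans (add_le_add h1 h2)
  obtain ⟨C, hC⟩ := entry_bound (n := n) (Mu + 1 + Mg) j
  have hconv : ∀ x a b, Filter.Tendsto (fun m => augM (w m) g x a b) Filter.atTop (nhds (augM u g x a b)) := by
    intro x a b
    simp_rw [augM_apply]
    apply Filter.Tendsto.sub_const
    rw [tendsto_iff_dist_tendsto_zero]
    refine squeeze_zero (fun _ => dist_nonneg) (fun m => ?_) tendsto_one_div_add_atTop_nhds_zero_nat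
    rw [Real.dist_eq]; exact hwu m x a b
  have hBc : ∀ m a b, ContinuousOn (fun x => augM (w m) g x a b) univ := by
    intro m a b
    simp_rw [augM_apply]
    exact ((pd_continuous (pd_contDiff (hw m) (by norm_num) b) a).sub (hg.continuous.mul continuous_const)).continuousOn
  have L : Filter.Tendsto (fun m => ∫ x, ∑ i, ∑ l, newtonT j (augM (w m) g x) i l * pd i (X l) x) Filter.atTop
      (nhds (∫ x, ∑ i, ∑ l, newtonT j (augM u g x) i l * pd i (X l) x)) := by
    apply tendsto_integral_of_dominated_convergence (fun x => ∑ i, ∑ l, C * |pd i (X l) x|)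
    · intro m
      refine Continuous.aestronglyMeasurable ?_
      refine continuous_finset_sum _ fun i _ => continuous_finset_sum _ fun l _ => ?_
      exact (continuousOn_univ.1 (newton_continuousOn (hBc m) j i l)).mul (pd_continuous (hX l) i)
    · refine integrable_finset_sum _ fun i _ => integrable_finset_sum _ fun l _ => ?_
      exact (((pd_continuous (hX l) i).integrable_of_hasCompactSupport (pd_hasCompactSupport (hXc l) i)).abs).const_mul C
    · intro m
      refine Filter.Eventually.of_forall fun x => ?_
      rw [Real.norm_eq_abs]
      refine (Finset.abs_sum_le_sum_abs _ _).trans (Finset.sum_le_sum fun i _ => ?_)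
      refine (Finset.abs_sum_le_sum_abs _ _).trans (Finset.sum_le_sum fun l _ => ?_)
      rw [abs_mul]
      exact mul_le_mul_of_nonneg_right (hC _ (hent m x) i l).1 (abs_nonneg _)
    · refine Filter.Eventually.of_forall fun x => ?_
      refine tendsto_finset_sum _ fun i _ => tendsto_finset_sum _ fun l _ => ?_
      exact (newton_tendsto (hconv x) j i l).1.mul_const _
  have Rr : Filter.Tendsto (fun m => ((n:ℝ) - j) * ∫ x, ∑ i, ∑ l, newtonP j (augM (w m) g x) i l * pd i g x * X l x) Filter.atTop
      (nhds (((n:ℝ) - j) * ∫ x, ∑ i, ∑ l, newtonP j (augM u g x) i l * pd i g x * X l x)) := by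
    apply Filter.Tendsto.const_mul
    apply tendsto_integral_of_dominated_convergence (fun x => ∑ i, ∑ l, C * |pd i g x * X l x|)
    · intro m
      refine Continuous.aestronglyMeasurable ?_
      refine continuous_finset_sum _ fun i _ => continuous_finset_sum _ fun l _ => ?_
      exact ((continuousOn_univ.1 (newtonP_continuousOn (hBc m) j i l)).mul (pd_continuous hg i)).mul (hX l).continuous
    · refine integrable_finset_sum _ fun i _ => integrable_finset_sum _ fun l _ => ?_
      exact ((((pd_continuous hg i).mul (hX l).continuous).integrable_of_hasCompactSupport ((hXc l).mul_left)).abs).const_mul C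
    · intro m
      refine Filter.Eventually.of_forall fun x => ?_
      rw [Real.norm_eq_abs]
      refine (Finset.abs_sum_le_sum_abs _ _).trans (Finset.sum_le_sum fun i _ => ?_)
      refine (Finset.abs_sum_le_sum_abs _ _).trans (Finset.sum_le_sum fun l _ => ?_)
      rw [mul_assoc, abs_mul]
      exact mul_le_mul_of_nonneg_right (hC _ (hent m x) i l).2 (abs_nonneg _)
    · refine Filter.Eventually.of_forall fun x => ?_
      refine tendsto_finset_sum _ fun i _ => tendsto_finset_sum _ fun l _ => ?_
      exact ((newton_tendsto (hconv x) j i l).2.mul_const _).mul_const _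
  have e : (fun m => ∫ x, ∑ i, ∑ l, newtonT j (augM (w m) g x) i l * pd i (X l) x) = 
      fun m => ((n:ℝ) - j) * ∫ x, ∑ i, ∑ l, newtonP j (augM (w m) g x) i l * pd i g x * X l x :=
    funext fun m => weak_smooth (hw m) hg hX hXc hj
  rw [e] at L
  exact tendsto_nhds_unique L Rr

lemma cutoff_contDiff {E : Type*} [NormedAddCommGroup E] [NormedSpace ℝ E] {U : Set E} (hU : IsOpen U) {N : WithTop ℕ∞}
    {χ F : E → ℝ} (hχ : ContDiff ℝ N χ) (hs : tsupport χ ⊆ U) (hF : ContDiffOn ℝ N F U) :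
    ContDiff ℝ N (fun x => χ x * F x) := by
  rw [contDiff_iff_contDiffAt]
  intro x
  by_cases hx : x ∈ U
  · exact hχ.contDiffAt.mul (hF.contDiffAt (hU.mem_nhds hx))
  · have h0 : (fun x => χ x * F x) =ᶠ[nhds x] fun _ => 0 := by
      have : (tsupport χ)ᶜ ∈ nhds x := (isClosed_tsupport χ).isOpen_compl.mem_nhds (fun h => hx (hs h))
      filter_upwards [this] with y hy
      rw [image_eq_zero_of_notMem_tsupport hy, zero_mul]
    exact contDiffAt_const.congr_of_eventuallyEq h0

lemma weak_local {x₀ : Fin n → ℝ} {r r' : ℝ} (hr : 0 < r) (hr' : r < r') {u g : (Fin n → ℝ) → ℝ}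
    (hu : ContDiffOn ℝ 2 u (ball x₀ r')) (hg : ContDiffOn ℝ 1 g (ball x₀ r'))
    {X : Fin n → (Fin n → ℝ) → ℝ} (hX : ∀ l, ContDiff ℝ 1 (X l)) (hXc : ∀ l, tsupport (X l) ⊆ closedBall x₀ r)
    {j : ℕ} (hj : j ≤ n) :
    ∫ x in closedBall x₀ r, ∑ i, ∑ l, newtonT j (augM u g x) i l * pd i (X l) x
      = ((n:ℝ) - j) * ∫ x in closedBall x₀ r, ∑ i, ∑ l, newtonP j (augM u g x) i l * pd i g x * X l x := by
  let χ : ContDiffBump x₀ := ⟨(r + (r + r')/2)/2, (r + r')/2, by linarith, by linarith⟩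
  have hχs : tsupport χ ⊆ ball x₀ r' := by
    rw [χ.tsupport_eq]; exact closedBall_subset_ball (by change (r + r')/2 < r'; linarith)
  have h1 : ∀ x ∈ closedBall x₀ r, (χ : (Fin n → ℝ) → ℝ) =ᶠ[nhds x] fun _ => 1 := by
    intro x hx
    have : ball x₀ ((r + (r + r')/2)/2) ∈ nhds x := isOpen_ball.mem_nhds (closedBall_subset_ball (by linarith) hx)
    filter_upwards [this] with y hy
    exact χ.one_of_mem_closedBall (ball_subset_closedBall hy)
  have hXcs : ∀ l, HasCompactSupport (X l) := fun l =>
    (isCompact_closedBall x₀ r).of_isClosed_subset (isClosed_tsupport _) (hXc l)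
  have key := weak_c2 (cutoff_contDiff isOpen_ball χ.contDiff hχs hu) (χ.hasCompactSupport.mul_right)
    (cutoff_contDiff isOpen_ball χ.contDiff hχs hg) (χ.hasCompactSupport.mul_right) hX hXcs hj
  have hz : ∀ l x, x ∉ closedBall x₀ r → X l x = 0 := fun l x hx => image_eq_zero_of_notMem_tsupport fun h => hx (hXc l h)
  have hz' : ∀ i l x, x ∉ closedBall x₀ r → pd i (X l) x = 0 := fun i l x hx => by
    have : (X l) =ᶠ[nhds x] fun _ => 0 := by
      filter_upwards [isClosed_closedBall.isOpen_compl.mem_nhds hx] with y hy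
      exact hz l y hy
    rw [pd_congr this]; simp [pd]
  have hgx : ∀ x ∈ closedBall x₀ r, (fun x => χ x * g x) =ᶠ[nhds x] g := by
    intro x hx; filter_upwards [h1 x hx] with y hy; rw [hy, one_mul]
  have hux : ∀ x ∈ closedBall x₀ r, (fun x => χ x * u x) =ᶠ[nhds x] u := by
    intro x hx; filter_upwards [h1 x hx] with y hy; rw [hy, one_mul]
  have haug : ∀ x ∈ closedBall x₀ r, augM (fun x => χ x * u x) (fun x => χ x * g x) x = augM u g x := by
    intro x hx
    ext a b
    rw [augM_apply, augM_apply, pd_congr (pd_congr_ev (hux x hx) b) a, (hgx x hx).eq_of_nhds]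
  have E1 : ∫ x, ∑ i, ∑ l, newtonT j (augM (fun x => χ x * u x) (fun x => χ x * g x) x) i l * pd i (X l) x
      = ∫ x in closedBall x₀ r, ∑ i, ∑ l, newtonT j (augM u g x) i l * pd i (X l) x := by
    rw [← setIntegral_eq_integral_of_forall_compl_eq_zero (s := closedBall x₀ r)]
    · apply setIntegral_congr_fun measurableSet_closedBall
      intro x hx; simp only [haug x hx]
    · intro x hx; simp [hz' _ _ x hx]
  have E2 : ∫ x, ∑ i, ∑ l, newtonP j (augM (fun x => χ x * u x) (fun x => χ x * g x) x) i l * pd i (fun x => χ x * g x) x * X l x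
      = ∫ x in closedBall x₀ r, ∑ i, ∑ l, newtonP j (augM u g x) i l * pd i g x * X l x := by
    rw [← setIntegral_eq_integral_of_forall_compl_eq_zero (s := closedBall x₀ r)]
    · apply setIntegral_congr_fun measurableSet_closedBall
      intro x hx; simp only [haug x hx, pd_congr (hgx x hx)]
    · intro x hx; simp [hz _ x hx]
  rw [← E1, ← E2]; exact key

end WeakSec2


section MorreySec
variable {n : ℕ}

lemma memLp_compact {K : Set (Fin n → ℝ)} (hK : IsCompact K) {f : (Fin n → ℝ) → ℝ} (hf : ContinuousOn f K) (p : ENNReal) :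
    MemLp f p (volume.restrict K) := by
  obtain ⟨C, hC⟩ := hK.exists_bound_of_continuousOn hf
  haveI : IsFiniteMeasure (volume.restrict K) := ⟨by rw [Measure.restrict_apply_univ]; exact hK.measure_lt_top⟩
  exact MemLp.of_bound (hf.aestronglyMeasurable hK.measurableSet) C ((ae_restrict_mem hK.measurableSet).mono hC)

/-- volume of the reference cube -/
noncomputable def qvol (n : ℕ) (ρ : ℝ) : ℝ := (volume (closedBall (0 : Fin n → ℝ) ρ)).toReal

lemma qvol_pos {ρ : ℝ} (hρ : 0 < ρ) : 0 < qvol n ρ :=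
  ENNReal.toReal_pos (Metric.measure_closedBall_pos volume 0 hρ).ne' (isCompact_closedBall 0 ρ).measure_lt_top.ne

lemma morrey_scale {p ρ t : ℝ} (hp : 1 < p) (ht : 0 < t) (ht1 : t ≤ 1) {D : Set (Fin n → ℝ)} (hD : MeasurableSet D)
    {x : Fin n → ℝ} (hx : ∀ y ∈ closedBall (0 : Fin n → ℝ) ρ, x + y ∈ D) {h : (Fin n → ℝ) → ℝ} (hh : ContinuousOn h D)
    (hi : IntegrableOn (fun y => |h y| ^ p) D) :
    ∫ y in closedBall (0 : Fin n → ℝ) ρ, |h (x + t • y)| ≤ 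
      (qvol n ρ) ^ (1 - 1/p) * ((t ^ (-(n:ℝ)/p)) * (∫ y in D, |h y| ^ p) ^ (1/p)) := by
  have hp0 : 0 < p := by linarith
  set Q := closedBall (0 : Fin n → ℝ) ρ with hQ
  have hQc : IsCompact Q := isCompact_closedBall 0 ρ
  have hmem : ∀ y ∈ Q, x + t • y ∈ D := by
    intro y hy
    apply hx
    rw [mem_closedBall_zero_iff] at hy ⊢
    rw [norm_smul, Real.norm_eq_abs, abs_of_pos ht]
    nlinarith [norm_nonneg y]
  have hc : ContinuousOn (fun y => |h (x + t • y)|) Q :=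
    (hh.comp (by fun_prop) hmem).abs
  set q := p / (p - 1) with hq
  have hpq : p.HolderConjugate q := by
    rw [hq]; exact Real.HolderConjugate.conjExponent hp
  have H := integral_mul_le_Lp_mul_Lq_of_nonneg hpq (μ := volume.restrict Q) (f := fun y => |h (x + t • y)|) (g := fun _ => 1)
    (Filter.Eventually.of_forall fun _ => abs_nonneg _) (Filter.Eventually.of_forall fun _ => zero_le_one)
    (memLp_compact hQc hc _) (memLp_compact hQc continuousOn_const _)
  simp only [mul_one, Real.one_rpow] at H
  have e1 : ∫ (a : Fin n → ℝ) in Q, (1:ℝ) = qvol n ρ := by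
    rw [setIntegral_const, smul_eq_mul, mul_one]; rfl
  have e2 : 1 / q = 1 - 1/p := by
    rw [one_div, one_div, ← hpq.inv_add_inv_eq_one]; ring
  rw [e1, e2] at H
  have e3 : ∫ y in Q, |h (x + t • y)| ^ p ≤ t ^ (-(n:ℝ)) * ∫ y in D, |h y| ^ p := by
    set G : (Fin n → ℝ) → ℝ := D.indicator (fun y => |h y| ^ p) with hG
    have hG0 : ∀ y, 0 ≤ G y := fun y => by
      rw [hG]; apply indicator_nonneg; intro y _; positivity
    have hGi : Integrable G := (integrable_indicator_iff hD).2 hi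
    have i2 : Integrable (fun y => G (x + t • y)) := by
      have := (hGi.comp_add_left x)
      exact this.comp_smul ht.ne'
    calc ∫ y in Q, |h (x + t • y)| ^ p = ∫ y in Q, G (x + t • y) := by
          apply setIntegral_congr_fun hQc.measurableSet
          intro y hy
          simp only [hG]
          rw [indicator_of_mem (hmem y hy)]
      _ ≤ ∫ y, G (x + t • y) := setIntegral_le_integral i2 (Filter.Eventually.of_forall fun y => hG0 _)
      _ = t ^ (-(n:ℝ)) * ∫ y, G y := by
          rw [Measure.integral_comp_smul volume (fun y => G (x + y)) t, integral_add_left_eq_self G x, smul_eq_mul]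
          congr 1
          rw [Module.finrank_fin_fun, abs_of_pos (by positivity), Real.rpow_neg ht.le, Real.rpow_natCast]
      _ = _ := by rw [hG, integral_indicator hD]
  refine H.trans ?_
  rw [mul_comm]
  apply mul_le_mul_of_nonneg_left _ (Real.rpow_nonneg ENNReal.toReal_nonneg _)
  have h0 : 0 ≤ ∫ y in D, |h y| ^ p := integral_nonneg fun y => by positivity
  calc (∫ y in Q, |h (x + t • y)| ^ p) ^ (1/p) ≤ (t ^ (-(n:ℝ)) * ∫ y in D, |h y| ^ p) ^ (1/p) := by
        apply Real.rpow_le_rpow (integral_nonneg fun y => by positivity) e3 (by positivity)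
    _ = _ := by
        rw [Real.mul_rpow (by positivity) h0, ← Real.rpow_mul ht.le]
        congr 2; ring

lemma fderiv_eq_sum_pd (w : (Fin n → ℝ) → ℝ) (x y : Fin n → ℝ) : fderiv ℝ w x y = ∑ i, y i * pd i w x := by
  conv_lhs => rw [pi_eq_sum_univ' y]
  rw [map_sum]
  apply Finset.sum_congr rfl; intro i _
  rw [map_smul, smul_eq_mul]
  rfl

lemma morrey {p ρ N : ℝ} (hρ : 0 < ρ) (hp1 : 1 < p) (hp : (n:ℝ) < p) {U D : Set (Fin n → ℝ)} (hU : IsOpen U) (hDU : D ⊆ U) (hD : MeasurableSet D)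
    {x : Fin n → ℝ} (hx : ∀ y ∈ closedBall (0 : Fin n → ℝ) ρ, x + y ∈ D) {w : (Fin n → ℝ) → ℝ} (hw : ContDiffOn ℝ 1 w U)
    (hi : IntegrableOn (fun y => |w y| ^ p) D) (hN : ∫ y in D, |w y| ^ p ≤ N)
    (hi' : ∀ i, IntegrableOn (fun y => |pd i w y| ^ p) D) (hN' : ∀ i, ∫ y in D, |pd i w y| ^ p ≤ N) :
    |w x| ≤ (qvol n ρ)⁻¹ * ((qvol n ρ) ^ (1 - 1/p) * N ^ (1/p) * (1 + n * ρ / (1 - n/p))) := by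
  have hp0 : 0 < p := by linarith
  set V := qvol n ρ with hV
  have hVp : 0 < V := qvol_pos hρ
  set Q := closedBall (0 : Fin n → ℝ) ρ with hQ
  have hQc : IsCompact Q := isCompact_closedBall 0 ρ
  have hmem : ∀ t ∈ Icc (0:ℝ) 1, ∀ y ∈ Q, x + t • y ∈ D := by
    intro t ht y hy
    apply hx
    rw [mem_closedBall_zero_iff] at hy ⊢
    rw [norm_smul, Real.norm_eq_abs, abs_of_nonneg ht.1]
    nlinarith [norm_nonneg y, ht.1, ht.2]
  have hN0 : 0 ≤ N := le_trans (integral_nonneg fun y => by positivity) hN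
  set φ : ℝ → ℝ := fun t => ∫ y in Q, w (x + t • y) with hφ
  set θ : ℝ := 1 - n/p with hθ
  have hθ0 : 0 < θ := by rw [hθ, sub_pos, div_lt_one hp0]; exact hp
  set K : ℝ := V ^ (1 - 1/p) * N ^ (1/p) * (n * ρ) with hK
  have hwU : ContinuousOn w U := hw.continuousOn
  have hpdU : ∀ i, ContinuousOn (pd i w) U := fun i => (pd_contDiffOn (m := 0) hU hw (by norm_num) i).continuousOn
  have hKc : IsCompact (closedBall x ρ) := isCompact_closedBall x ρ
  have hKD : closedBall x ρ ⊆ D := by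
    intro z hz
    have := hx (z - x) (by rw [mem_closedBall_zero_iff, ← dist_eq_norm]; exact hz)
    simpa using this
  have hmemK : ∀ t ∈ Icc (0:ℝ) 1, ∀ y ∈ Q, x + t • y ∈ closedBall x ρ := by
    intro t ht y hy
    rw [mem_closedBall, dist_eq_norm, add_sub_cancel_left]
    rw [mem_closedBall_zero_iff] at hy 
    rw [norm_smul, Real.norm_eq_abs, abs_of_nonneg ht.1]
    nlinarith [norm_nonneg y, ht.1, ht.2]
  obtain ⟨C0, hC0⟩ := hKc.exists_bound_of_continuousOn (hwU.mono (hKD.trans hDU))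
  obtain ⟨C1, hC1⟩ := hKc.exists_bound_of_continuousOn ((hw.continuousOn_fderiv_of_isOpen hU (by norm_num)).mono (hKD.trans hDU))
  have hcomp : ∀ t ∈ Icc (0:ℝ) 1, ∀ {h : (Fin n → ℝ) → ℝ}, ContinuousOn h U → ContinuousOn (fun y => h (x + t • y)) Q := by
    intro t ht h hh
    exact hh.comp (by fun_prop) (fun y hy => hDU (hmem t ht y hy))
  have hφc : ContinuousOn φ (Icc 0 1) := by
    apply continuousOn_of_dominated (bound := fun _ => C0)
    · intro t ht; exact (hcomp t ht hwU).aestronglyMeasurable hQc.measurableSet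
    · intro t ht; exact (ae_restrict_mem hQc.measurableSet).mono fun y hy => hC0 _ (hmemK t ht y hy)
    · exact continuousOn_const.integrableOn_compact hQc
    · refine (ae_restrict_mem hQc.measurableSet).mono fun y hy => ?_
      exact hwU.comp (by fun_prop) (fun t ht => hDU (hmem t ht y hy))
  have hφd : ∀ t ∈ Ioo (0:ℝ) 1, HasDerivAt φ (∫ y in Q, fderiv ℝ w (x + t • y) y) t := by
    intro t ht
    refine (hasDerivAt_integral_of_dominated_loc_of_deriv_le (𝕜 := ℝ) (μ := volume.restrict Q) (F := fun t y => w (x + t • y)) (F' := fun t y => fderiv ℝ w (x + t • y) y) (x₀ := t) (bound := fun _ => C1 * ρ) (s := Ioo 0 1) (Ioo_mem_nhds ht.1 ht.2) ?_ ?_ ?_ ?_ ?_ ?_).2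
    · filter_upwards [Ioo_mem_nhds ht.1 ht.2] with s hs
      exact (hcomp s ⟨hs.1.le, hs.2.le⟩ hwU).aestronglyMeasurable hQc.measurableSet
    · exact (hcomp t ⟨ht.1.le, ht.2.le⟩ hwU).integrableOn_compact hQc
    · refine ContinuousOn.aestronglyMeasurable ?_ hQc.measurableSet
      simp_rw [fderiv_eq_sum_pd]
      exact continuousOn_finset_sum _ fun i _ => (continuous_apply i).continuousOn.mul (hcomp t ⟨ht.1.le, ht.2.le⟩ (hpdU i))
    · refine (ae_restrict_mem hQc.measurableSet).mono fun y hy s hs => ?_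
      refine (ContinuousLinearMap.le_opNorm _ _).trans ?_
      have h1 := hC1 _ (hmemK s ⟨hs.1.le, hs.2.le⟩ y hy)
      rw [mem_closedBall_zero_iff] at hy
      exact mul_le_mul h1 hy (norm_nonneg _) ((norm_nonneg _).trans h1)
    · exact continuousOn_const.integrableOn_compact hQc
    · refine (ae_restrict_mem hQc.measurableSet).mono fun y hy s hs => ?_
      have hd : HasFDerivAt w (fderiv ℝ w (x + s • y)) (x + s • y) :=
        (diffAt_of_on hU hw (hDU (hmem s ⟨hs.1.le, hs.2.le⟩ y hy))).hasFDerivAt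
      have hl : HasDerivAt (fun s : ℝ => x + s • y) y s := by
        simpa using ((hasDerivAt_id s).smul_const y).const_add x
      exact hd.comp_hasDerivAt s hl
  have hbd : ∀ t ∈ Ioo (0:ℝ) 1, |∫ y in Q, fderiv ℝ w (x + t • y) y| ≤ K * t ^ (θ - 1) := by
    intro t ht
    have htI : t ∈ Icc (0:ℝ) 1 := ⟨ht.1.le, ht.2.le⟩
    have hintg : ∀ i, IntegrableOn (fun y => ρ * |pd i w (x + t • y)|) Q := fun i =>
      (continuousOn_const.mul (hcomp t htI (hpdU i)).abs).integrableOn_compact hQc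
    calc |∫ y in Q, fderiv ℝ w (x + t • y) y| ≤ ∫ y in Q, ∑ i, ρ * |pd i w (x + t • y)| := by
          rw [← Real.norm_eq_abs]
          apply norm_integral_le_of_norm_le (integrable_finset_sum _ fun i _ => hintg i)
          refine (ae_restrict_mem hQc.measurableSet).mono fun y hy => ?_
          rw [fderiv_eq_sum_pd, Real.norm_eq_abs]
          refine (Finset.abs_sum_le_sum_abs _ _).trans (Finset.sum_le_sum fun i _ => ?_)
          rw [abs_mul]
          apply mul_le_mul_of_nonneg_right _ (abs_nonneg _)
          rw [mem_closedBall_zero_iff] at hy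
          exact (norm_le_pi_norm y i).trans hy
      _ = ∑ i, ρ * ∫ y in Q, |pd i w (x + t • y)| := by
          rw [integral_finset_sum _ fun i _ => hintg i]
          simp_rw [integral_const_mul]
      _ ≤ ∑ i : Fin n, ρ * (V ^ (1 - 1/p) * ((t ^ (-(n:ℝ)/p)) * N ^ (1/p))) := by
          refine Finset.sum_le_sum fun i _ => mul_le_mul_of_nonneg_left ?_ hρ.le
          refine (morrey_scale hp1 ht.1 ht.2.le hD hx ((hpdU i).mono hDU) (hi' i)).trans ?_
          apply mul_le_mul_of_nonneg_left _ (Real.rpow_nonneg hVp.le _)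
          apply mul_le_mul_of_nonneg_left _ (Real.rpow_nonneg ht.1.le _)
          exact Real.rpow_le_rpow (integral_nonneg fun y => by positivity) (hN' i) (by positivity)
      _ = K * t ^ (θ - 1) := by
          rw [Finset.sum_const, Finset.card_fin, nsmul_eq_mul, hK, hθ, show 1 - (n:ℝ)/p - 1 = -(n:ℝ)/p by ring]; ring
  have hθc : ContinuousOn (fun t : ℝ => K / θ * t ^ θ) (Icc 0 1) :=
    continuousOn_const.mul (continuousOn_id.rpow_const fun t _ => Or.inr hθ0.le)
  have hθd : ∀ t ∈ Ioo (0:ℝ) 1, HasDerivAt (fun t : ℝ => K / θ * t ^ θ) (K * t ^ (θ - 1)) t := by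
    intro t ht
    have := (Real.hasDerivAt_rpow_const (p := θ) (Or.inl ht.1.ne')).const_mul (K / θ)
    rw [← mul_assoc, div_mul_cancel₀ _ hθ0.ne'] at this
    exact this
  have m1 : AntitoneOn (fun t => φ t - K / θ * t ^ θ) (Icc 0 1) := by
    apply antitoneOn_of_deriv_nonpos (convex_Icc 0 1) (hφc.sub hθc)
    · rw [interior_Icc]; intro t ht
      exact ((hφd t ht).sub (hθd t ht)).differentiableAt.differentiableWithinAt
    · rw [interior_Icc]; intro t ht
      have h := ((hφd t ht).sub (hθd t ht)).deriv
      have h2 := (abs_le.1 (hbd t ht)).2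
      calc _ = _ := h
        _ ≤ 0 := by linarith
  have m2 : AntitoneOn (fun t => -φ t - K / θ * t ^ θ) (Icc 0 1) := by
    apply antitoneOn_of_deriv_nonpos (convex_Icc 0 1) (hφc.neg.sub hθc)
    · rw [interior_Icc]; intro t ht
      exact ((hφd t ht).neg.sub (hθd t ht)).differentiableAt.differentiableWithinAt
    · rw [interior_Icc]; intro t ht
      have h := ((hφd t ht).neg.sub (hθd t ht)).deriv
      have h2 := (abs_le.1 (hbd t ht)).1
      calc _ = _ := h
        _ ≤ 0 := by linarith
  have z01 : (0:ℝ) ∈ Icc (0:ℝ) 1 := ⟨le_rfl, zero_le_one⟩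
  have o01 : (1:ℝ) ∈ Icc (0:ℝ) 1 := ⟨zero_le_one, le_rfl⟩
  have a1 := m1 z01 o01 zero_le_one
  have a2 := m2 z01 o01 zero_le_one
  simp only [Real.one_rpow, Real.zero_rpow hθ0.ne', mul_zero, mul_one, sub_zero] at a1 a2
  have hφ0 : φ 0 = V * w x := by
    simp only [hφ, zero_smul, add_zero]
    rw [setIntegral_const, smul_eq_mul]; rfl
  have hφ1 : |φ 1| ≤ V ^ (1 - 1/p) * N ^ (1/p) := by
    have h1 : |φ 1| ≤ ∫ y in Q, |w (x + (1:ℝ) • y)| := abs_integral_le_integral_abs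
    have h2 := morrey_scale hp1 one_pos le_rfl hD hx (hwU.mono hDU) hi
    rw [Real.one_rpow, one_mul] at h2
    refine h1.trans (h2.trans ?_)
    apply mul_le_mul_of_nonneg_left _ (Real.rpow_nonneg hVp.le _)
    exact Real.rpow_le_rpow (integral_nonneg fun y => by positivity) hN (by positivity)
  have hfin : V * |w x| ≤ V ^ (1 - 1/p) * N ^ (1/p) + K / θ := by
    rw [← abs_of_pos hVp, ← abs_mul, abs_of_pos hVp, ← hφ0, abs_le]
    have := abs_le.1 hφ1
    constructor <;> linarith
  rw [inv_mul_eq_div, le_div_iff₀ hVp, mul_comm]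
  refine hfin.trans (le_of_eq ?_)
  rw [hK]; ring

end MorreySec

section
variable {n : ℕ}

set_option maxHeartbeats 1000000 in
lemma scalar_core {K m m' B q η v y L σs bξ D P G C1 Qa Taa Tee r1 r2 r3 r4 G2 : ℝ}
    (hK : 1 ≤ K) (hm : 0 ≤ m) (hm' : 0 ≤ m') (hB : 0 ≤ B) (hq : 1 ≤ q) (hη : 0 ≤ η) (hη1 : η ≤ 1)
    (hv : 1 ≤ v) (hy : 1 ≤ y)
    (hD : 0 ≤ D)
    (hL : m * σs + bξ - K * (y * v^3) ≤ L) (hG : G = C1 + σs - Qa) (hG2 : G2 = C1 - r1)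
    (hTaa : Taa ≤ K * (y * v)) (hTee : Tee ≤ K * (y * v))
    (hP : 0 ≤ η^2*D/4 + 2*η*v*P + 4*v^2*Tee)
    (hQ : 0 ≤ D/8 + m*v*Qa + 2*m^2*v^2*Taa)
    (hb : bξ^2 ≤ B * v * D)
    (h1 : |r1| ≤ K * y) (h2 : |r2| ≤ K * (y * v)) (h3 : |r3| ≤ K * y) (h4 : |r4| ≤ K * (y * v)) :
    q/2 * (η^2 * D) - (5*K + 2*m^2*K + 2*B + m*K + m*(K + 2*K + m'*K)) * q * (η^2*(y*v^4) + y*v^3)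
     ≤ η^2*v*L + q*η^2*D + 2*q*η*v*P - m*η^2*v*G
        + (m/(q+1)) * (η^2*v^2*r2 + 2*q*η*v^2*r3 + (q+1)*η^2*v*G2 - m'*η^2*v^2*r4) := by
  have hv0 : 0 < v := by linarith
  have hy0 : 0 < y := by linarith
  have hq0 : 0 < q := by linarith
  set Y := η^2*(y*v^4) + y*v^3 with hY
  have hη2 : 0 ≤ η^2 := sq_nonneg η
  have hη21 : η^2 ≤ 1 := pow_le_one₀ hη hη1
  have hyv3 : 0 ≤ y*v^3 := by positivity
  have hY1 : y*v^3 ≤ Y := by rw [hY]; linarith [mul_nonneg hη2 (show 0 ≤ y*v^4 by positivity)]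
  have hY2 : η^2*(y*v^4) ≤ Y := by rw [hY]; linarith
  have hY0 : 0 ≤ Y := hyv3.trans hY1
  have hvle : ∀ i j : ℕ, i ≤ j → v^i ≤ v^j := fun i j h => pow_le_pow_right₀ hv h
  -- term P
  have tP : -(q*η^2*D/4) - 4*K*q*Y ≤ 2*q*η*v*P := by
    have e1 : 4*v^2*Tee ≤ 4*K*(y*v^3) := by
      have := mul_le_mul_of_nonneg_left hTee (show 0 ≤ 4*v^2 by positivity)
      linarith [this, show 4*v^2*(K*(y*v)) = 4*K*(y*v^3) by ring]
    have e2 : 4*K*(y*v^3) ≤ 4*K*Y := mul_le_mul_of_nonneg_left hY1 (by linarith)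
    have e3 : 0 ≤ q * (η^2*D/4 + 2*η*v*P + 4*K*Y) := mul_nonneg hq0.le (by linarith)
    linarith [show q * (η^2*D/4 + 2*η*v*P + 4*K*Y) = q*η^2*D/4 + 2*q*η*v*P + 4*K*q*Y by ring]
  have tQ : -(η^2*D/8) - 2*m^2*K*Y ≤ m*η^2*v*Qa := by
    have e1 : 2*m^2*v^2*Taa ≤ 2*m^2*K*(y*v^3) := by
      have := mul_le_mul_of_nonneg_left hTaa (show 0 ≤ 2*m^2*v^2 by positivity)
      linarith [this, show 2*m^2*v^2*(K*(y*v)) = 2*m^2*K*(y*v^3) by ring]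
    have e2 : 2*m^2*K*(η^2*(y*v^3)) ≤ 2*m^2*K*Y := by
      apply mul_le_mul_of_nonneg_left _ (by positivity)
      exact (mul_le_of_le_one_left hyv3 hη21).trans hY1
    have e3 : 0 ≤ η^2 * (D/8 + m*v*Qa + 2*m^2*K*(y*v^3)) := mul_nonneg hη2 (by linarith)
    linarith [show η^2 * (D/8 + m*v*Qa + 2*m^2*K*(y*v^3)) = η^2*D/8 + m*η^2*v*Qa + 2*m^2*K*(η^2*(y*v^3)) by ring]
  have tb : -(η^2*D/8) - 2*B*Y ≤ η^2*v*bξ := by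
    have e0 : |v*bξ| ≤ D/8 + 2*B*v^3 := by
      apply abs_le_of_sq_le_sq _ (by positivity)
      have : (v*bξ)^2 ≤ v^2*(B*v*D) := by rw [mul_pow]; exact mul_le_mul_of_nonneg_left hb (by positivity)
      linarith [sq_nonneg (D/8 - 2*B*v^3), show (D/8 + 2*B*v^3)^2 = (D/8 - 2*B*v^3)^2 + v^2*(B*v*D) by ring]
    have e1 := (abs_le.1 e0).1
    have e2 : 2*B*(η^2*v^3) ≤ 2*B*Y := by
      apply mul_le_mul_of_nonneg_left _ (by positivity)
      have : v^3 ≤ y*v^3 := le_mul_of_one_le_left (by positivity) hy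
      exact (mul_le_of_le_one_left (by positivity) hη21).trans (this.trans hY1)
    have e3 : 0 ≤ η^2 * (D/8 + v*bξ + 2*B*v^3) := mul_nonneg hη2 (by linarith)
    linarith [show η^2 * (D/8 + v*bξ + 2*B*v^3) = η^2*D/8 + η^2*v*bξ + 2*B*(η^2*v^3) by ring]
  have tL : η^2*v*(m*σs) + η^2*v*bξ - K*Y ≤ η^2*v*L := by
    have := mul_le_mul_of_nonneg_left hL (show 0 ≤ η^2*v by positivity)
    have e2 : K*(η^2*(y*v^4)) ≤ K*Y := mul_le_mul_of_nonneg_left hY2 (by linarith)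
    linarith [show η^2*v*(m * σs + bξ - K * (y * v^3)) = η^2*v*(m*σs) + η^2*v*bξ - K*(η^2*(y*v^4)) by ring]
  have hvv : ∀ i : ℕ, i ≤ 3 → y * v^i ≤ Y := fun i hi =>
    (mul_le_mul_of_nonneg_left (hvle i 3 hi) hy0.le).trans hY1
  have t1 : -(m*K*Y) ≤ -(m*η^2*v*r1) := by
    have e1 : η^2*v*r1 ≤ K*Y := by
      have a1 := (le_abs_self r1).trans h1
      have a2 : η^2*v*r1 ≤ η^2*v*(K*y) := mul_le_mul_of_nonneg_left a1 (by positivity)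
      have a3 : η^2*v*(K*y) ≤ 1*(v*(K*y)) := by
        rw [mul_assoc]; exact mul_le_mul_of_nonneg_right hη21 (by positivity)
      have a4 := mul_le_mul_of_nonneg_left (hvv 1 (by norm_num)) (show 0 ≤ K by linarith)
      linarith [show 1*(v*(K*y)) = K*(y*v^1) by ring]
    have := mul_le_mul_of_nonneg_left e1 hm
    linarith
  have t2 : -(K*Y) ≤ η^2*v^2*r2 := by
    have a1 := (abs_le.1 h2).1
    have a2 : η^2*v^2*(-(K*(y*v))) ≤ η^2*v^2*r2 := mul_le_mul_of_nonneg_left a1 (by positivity)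
    have a3 : η^2*(K*(y*v^3)) ≤ 1*(K*(y*v^3)) := mul_le_mul_of_nonneg_right hη21 (by positivity)
    have a4 := mul_le_mul_of_nonneg_left hY1 (show 0 ≤ K by linarith)
    linarith [show η^2*v^2*(-(K*(y*v))) = -(η^2*(K*(y*v^3))) by ring]
  have t4 : -(m'*K*Y) ≤ -(m'*η^2*v^2*r4) := by
    have a1 := (abs_le.1 h4).2
    have a2 : η^2*v^2*r4 ≤ η^2*v^2*(K*(y*v)) := mul_le_mul_of_nonneg_left a1 (by positivity)
    have a3 : η^2*(K*(y*v^3)) ≤ 1*(K*(y*v^3)) := mul_le_mul_of_nonneg_right hη21 (by positivity)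
    have a4 := mul_le_mul_of_nonneg_left hY1 (show 0 ≤ K by linarith)
    have a5 : η^2*v^2*r4 ≤ K*Y := by linarith [show η^2*v^2*(K*(y*v)) = η^2*(K*(y*v^3)) by ring]
    have := mul_le_mul_of_nonneg_left a5 hm'
    linarith
  have t3 : -(K*Y) ≤ η*v^2*r3 := by
    have a1 := (abs_le.1 h3).1
    have a2 : η*v^2*(-(K*y)) ≤ η*v^2*r3 := mul_le_mul_of_nonneg_left a1 (by positivity)
    have a3 : η*(K*(y*v^2)) ≤ 1*(K*(y*v^2)) := mul_le_mul_of_nonneg_right hη1 (by positivity)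
    have a4 := mul_le_mul_of_nonneg_left (hvv 2 (by norm_num)) (show 0 ≤ K by linarith)
    linarith [show η*v^2*(-(K*y)) = -(η*(K*(y*v^2))) by ring]
  have hq1 : 0 < q + 1 := by linarith
  have hKY : 0 ≤ K*Y := by positivity
  have tS : -(m*(K+2*K+m'*K)*q*Y) + m*η^2*v*G2 ≤ (m/(q+1)) * (η^2*v^2*r2 + 2*q*η*v^2*r3 + (q+1)*η^2*v*G2 - m'*η^2*v^2*r4) := by
    have e1 : -((K+2*q*K+m'*K)*Y) + (q+1)*(η^2*v*G2) ≤ η^2*v^2*r2 + 2*q*η*v^2*r3 + (q+1)*η^2*v*G2 - m'*η^2*v^2*r4 := by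
      have := mul_le_mul_of_nonneg_left t3 (show 0 ≤ 2*q by linarith)
      linarith
    have e2 := mul_le_mul_of_nonneg_left e1 (show 0 ≤ m/(q+1) by positivity)
    refine le_trans ?_ e2
    have e3 : (m/(q+1)) * (-((K+2*q*K+m'*K)*Y) + (q+1)*(η^2*v*G2)) = -((m/(q+1))*((K+2*q*K+m'*K)*Y)) + m*η^2*v*G2 := by
      field_simp
    rw [e3]
    have e4 : m/(q+1) ≤ m := div_le_self hm (by linarith)
    have e5 : (K+2*q*K+m'*K)*Y ≤ (K+2*K+m'*K)*q*Y := by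
      apply mul_le_mul_of_nonneg_right _ hY0
      have b1 : K ≤ K*q := le_mul_of_one_le_right (by linarith) hq
      have b2 : m'*K ≤ m'*K*q := le_mul_of_one_le_right (by positivity) hq
      linarith
    have e6 : (m/(q+1))*((K+2*q*K+m'*K)*Y) ≤ m*((K+2*K+m'*K)*q*Y) :=
      mul_le_mul e4 e5 (by positivity) hm
    linarith
  rw [hG2] at tS
  have hqY : Y ≤ q*Y := le_mul_of_one_le_left hY0 hq
  have u1 := mul_le_mul_of_nonneg_left hqY (show 0 ≤ 2*m^2*K by positivity)
  have u2 := mul_le_mul_of_nonneg_left hqY (show 0 ≤ 2*B by positivity)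
  have u3 := mul_le_mul_of_nonneg_left hqY (show 0 ≤ K by positivity)
  have u4 := mul_le_mul_of_nonneg_left hqY (show 0 ≤ m*K by positivity)
  have u5 : η^2*D ≤ q*(η^2*D) := le_mul_of_one_le_left (mul_nonneg hη2 hD) hq
  rw [hG, hG2]
  linarith
end

section
variable {n : ℕ}

lemma dsum_bound {t s : Fin n → Fin n → ℝ} {α : ℝ}
    (h : ∀ i l, |t i l * s i l| ≤ α) : |∑ i, ∑ l, t i l * s i l| ≤ n^2 * α := by
  calc _ ≤ ∑ i : Fin n, ∑ l : Fin n, α := by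
        refine (Finset.abs_sum_le_sum_abs _ _).trans (Finset.sum_le_sum fun i _ => ?_)
        exact (Finset.abs_sum_le_sum_abs _ _).trans (Finset.sum_le_sum fun l _ => h i l)
    _ = n^2 * α := by simp; ring

lemma dsum_bound2 {t s : Fin n → Fin n → ℝ} {α β : ℝ} (hα : 0 ≤ α)
    (h : ∀ i l, |t i l| ≤ α) (h' : ∀ i l, |s i l| ≤ β) : |∑ i, ∑ l, t i l * s i l| ≤ n^2 * (α * β) :=
  dsum_bound fun i l => by
    rw [abs_mul]; exact mul_le_mul (h i l) (h' i l) (abs_nonneg _) hα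

lemma quad_sum (T : Matrix (Fin n) (Fin n) ℝ) (x z : Fin n → ℝ) :
    ∑ i, ∑ l, T i l * (x i * z l) = x ⬝ᵥ (T *ᵥ z) := by
  simp only [dotProduct, mulVec, Finset.mul_sum]
  exact Finset.sum_congr rfl fun i _ => Finset.sum_congr rfl fun l _ => by ring

lemma quad_symm {T : Matrix (Fin n) (Fin n) ℝ} (hT : Tᵀ = T) (x z : Fin n → ℝ) :
    x ⬝ᵥ (T *ᵥ z) = z ⬝ᵥ (T *ᵥ x) := by
  rw [dotProduct_mulVec, ← mulVec_transpose, hT, dotProduct_comm]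

lemma quad_expand {T : Matrix (Fin n) (Fin n) ℝ} (hT : Tᵀ = T) (x z : Fin n → ℝ) (s t : ℝ) :
    (s • x + t • z) ⬝ᵥ (T *ᵥ (s • x + t • z)) = s^2 * (x ⬝ᵥ (T *ᵥ x)) + 2*s*t*(x ⬝ᵥ (T *ᵥ z)) + t^2 * (z ⬝ᵥ (T *ᵥ z)) := by
  simp only [mulVec_add, mulVec_smul, add_dotProduct, dotProduct_add, smul_dotProduct, dotProduct_smul, smul_eq_mul]
  rw [quad_symm hT z x]; ring

lemma vec_core {K m m' q η v y σ : ℝ} {T T' T'' A Hv Dc : Matrix (Fin n) (Fin n) ℝ} {ξ e a b c ct g : Fin n → ℝ}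
    (hn : 1 ≤ n)
    (hK : 1 ≤ K) (hm : 0 ≤ m) (hm' : 0 ≤ m') (hq : 1 ≤ q) (hη : 0 ≤ η) (hη1 : η ≤ 1)
    (hv : 1 ≤ v) (hy : 1 ≤ y)
    (hTs : Tᵀ = T) (hT's : T'ᵀ = T') (hAs : Aᵀ = A) (hcomm : T' * A = A * T')
    (hT : T = σ • 1 - T' * A) (hg : g = c + A *ᵥ a)
    (bT : ∀ i l, |T i l| ≤ K * (y * v)) (bT' : ∀ i l, |T' i l| ≤ K * y) (bT'' : ∀ i l, |T'' i l| ≤ K * y)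
    (ba : ∀ i, |a i| ≤ K) (bb : ∀ i, |b i| ≤ K) (bct : ∀ i, |ct i| ≤ K) (be : ∀ i, |e i| ≤ K)
    (bg : ∀ i, |g i| ≤ K * v) (bDc : ∀ i l, |Dc i l| ≤ K * v)
    (bc : ∀ i l, |(c l - ct l) * ξ i| ≤ 1)
    (hlow : ∀ ζ : Fin n → ℝ, ∑ i, ζ i ^ 2 ≤ K * v * (ζ ⬝ᵥ (T *ᵥ ζ)))
    (hL : m * σ * (a ⬝ᵥ ξ) + b ⬝ᵥ ξ - K * (y * v^3) ≤ ∑ i, ∑ l, T i l * Hv i l) :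
    ∃ C, C = (5*(n^2*K^3) + 2*m^2*(n^2*K^3) + 2*(n*K^3) + m*(n^2*K^3) + m*((n^2*K^3) + 2*(n^2*K^3) + m'*(n^2*K^3))) ∧
    q/2 * (η^2 * (ξ ⬝ᵥ (T *ᵥ ξ))) - C * q * (η^2*(y*v^4) + y*v^3)
     ≤ η^2*v*(∑ i, ∑ l, T i l * Hv i l) + q*η^2*(∑ i, ∑ l, T i l * (ξ i * ξ l)) + 2*q*η*v*(∑ i, ∑ l, T i l * (e i * ξ l))
        - m*η^2*v*(∑ i, ∑ l, T' i l * (g i * ξ l))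
        + (m/(q+1)) * (η^2*v^2*(∑ i, ∑ l, T' i l * Dc i l) + 2*q*η*v^2*(∑ i, ∑ l, T' i l * (e i * ct l))
          + (q+1)*η^2*v*(∑ i, ∑ l, T' i l * (ξ i * ct l)) - m'*η^2*v^2*(∑ i, ∑ l, T'' i l * (g i * ct l))) := by
  refine ⟨_, rfl, ?_⟩
  have hK0 : 0 ≤ K := by linarith
  have hv0 : 0 < v := by linarith
  have hy0 : 0 < y := by linarith
  have hn1 : (1:ℝ) ≤ n := by exact_mod_cast hn
  have hKv : 0 < K * v := by positivity
  have hpsd : ∀ ζ : Fin n → ℝ, 0 ≤ ζ ⬝ᵥ (T *ᵥ ζ) := by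
    intro ζ
    have h1 : 0 ≤ ∑ i, ζ i ^ 2 := Finset.sum_nonneg fun i _ => sq_nonneg _
    by_contra hneg
    push Not at hneg
    have := mul_neg_of_pos_of_neg hKv hneg
    linarith [hlow ζ]
  have K1 : 1 ≤ n^2*K^3 := by
    have a1 : 1 ≤ K^3 := one_le_pow₀ hK
    have a2 : (1:ℝ) ≤ n^2 := one_le_pow₀ hn1
    nlinarith
  have KK2 : K^2 ≤ K^3 := pow_le_pow_right₀ hK (by norm_num)
  have KK1 : K ≤ K^3 := by simpa using pow_le_pow_right₀ hK (show 1 ≤ 3 by norm_num)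
  have hn2 : (0:ℝ) ≤ n^2 := by positivity
  simp only [quad_sum]
  have bTq : ∀ z : Fin n → ℝ, (∀ i, |z i| ≤ K) → z ⬝ᵥ (T *ᵥ z) ≤ n^2*K^3*(y*v) := by
    intro z hz
    rw [← quad_sum]
    refine (le_abs_self _).trans ((dsum_bound2 (β := K*K) (by positivity) bT fun i l => ?_).trans (le_of_eq (by ring)))
    rw [abs_mul]; exact mul_le_mul (hz i) (hz l) (abs_nonneg _) hK0
  refine scalar_core (σs := σ * (a ⬝ᵥ ξ)) (bξ := b ⬝ᵥ ξ) (C1 := c ⬝ᵥ (T' *ᵥ ξ)) (Qa := a ⬝ᵥ (T *ᵥ ξ))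
    (Taa := a ⬝ᵥ (T *ᵥ a)) (Tee := e ⬝ᵥ (T *ᵥ e)) (r1 := (c - ct) ⬝ᵥ (T' *ᵥ ξ)) K1 hm hm' (by positivity) hq hη hη1 hv hy
    (hpsd ξ) ?_ ?_ ?_ (bTq a ba) (bTq e be) ?_ ?_ ?_ ?_ ?_ ?_ ?_
  · refine le_trans ?_ hL
    have : K * (y*v^3) ≤ n^2*K^3*(y*v^3) := by
      apply mul_le_mul_of_nonneg_right _ (by positivity)
      nlinarith [one_le_pow₀ (n := 2) hn1]
    linarith
  · rw [hg, add_dotProduct, hT, sub_mulVec, dotProduct_sub, smul_mulVec, one_mulVec, dotProduct_smul, smul_eq_mul]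
    have : (A *ᵥ a) ⬝ᵥ (T' *ᵥ ξ) = a ⬝ᵥ ((T' * A) *ᵥ ξ) := by
      rw [hcomm, ← mulVec_mulVec, dotProduct_mulVec a A, ← mulVec_transpose, hAs]
    rw [this]; ring
  · rw [quad_symm hT's ξ ct, sub_dotProduct]; ring
  · have := hpsd ((η/2) • ξ + (2*v) • e)
    rw [quad_expand hTs, quad_symm hTs ξ e] at this
    linarith [show (η/2)^2 * (ξ ⬝ᵥ (T *ᵥ ξ)) + 2*(η/2)*(2*v)*(e ⬝ᵥ (T *ᵥ ξ)) + (2*v)^2 * (e ⬝ᵥ (T *ᵥ e)) = η^2 * (ξ ⬝ᵥ (T *ᵥ ξ))/4 + 2*η*v*(e ⬝ᵥ (T *ᵥ ξ)) + 4*v^2*(e ⬝ᵥ (T *ᵥ e)) by ring]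
  · have := hpsd ((1:ℝ) • ξ + (4*m*v) • a)
    rw [quad_expand hTs, quad_symm hTs ξ a] at this
    linarith [show (1:ℝ)^2 * (ξ ⬝ᵥ (T *ᵥ ξ)) + 2*1*(4*m*v)*(a ⬝ᵥ (T *ᵥ ξ)) + (4*m*v)^2 * (a ⬝ᵥ (T *ᵥ a)) = 8*((ξ ⬝ᵥ (T *ᵥ ξ))/8 + m*v*(a ⬝ᵥ (T *ᵥ ξ)) + 2*m^2*v^2*(a ⬝ᵥ (T *ᵥ a))) by ring]
  · have h1 : (b ⬝ᵥ ξ)^2 ≤ (∑ i, b i ^2) * ∑ i, ξ i^2 := Finset.sum_mul_sq_le_sq_mul_sq _ _ _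
    have h2 : ∑ i, b i ^2 ≤ n*K^2 := by
      calc _ ≤ ∑ i : Fin n, K^2 := Finset.sum_le_sum fun i _ => by
            rw [← sq_abs]; exact pow_le_pow_left₀ (abs_nonneg _) (bb i) 2
        _ = _ := by simp
    have h3 : (∑ i, b i ^2) * ∑ i, ξ i^2 ≤ (n*K^2) * (K * v * (ξ ⬝ᵥ (T *ᵥ ξ))) :=
      mul_le_mul h2 (hlow ξ) (Finset.sum_nonneg fun i _ => sq_nonneg _) (by positivity)
    linarith [show (n*K^2) * (K * v * (ξ ⬝ᵥ (T *ᵥ ξ))) = n*K^3*v*(ξ ⬝ᵥ (T *ᵥ ξ)) by ring]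
  · rw [quad_symm hT's, ← quad_sum]
    refine (dsum_bound2 (β := 1) (by positivity) bT' fun i l => by simpa [mul_comm] using bc i l).trans ?_
    rw [mul_one, ← mul_assoc]
    exact mul_le_mul_of_nonneg_right (mul_le_mul_of_nonneg_left KK1 hn2) hy0.le
  · refine (dsum_bound2 (by positivity) bT' bDc).trans ?_
    rw [show (n:ℝ)^2*(K*y*(K*v)) = n^2*K^2*(y*v) by ring]
    exact mul_le_mul_of_nonneg_right (mul_le_mul_of_nonneg_left KK2 hn2) (by positivity)
  · rw [← quad_sum]
    refine (dsum_bound2 (β := K*K) (by positivity) bT' fun i l => ?_).trans (le_of_eq (by ring))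
    rw [abs_mul]; exact mul_le_mul (be i) (bct l) (abs_nonneg _) hK0
  · rw [← quad_sum]
    refine (dsum_bound2 (β := K*v*K) (by positivity) bT'' fun i l => ?_).trans (le_of_eq (by ring))
    rw [abs_mul]; exact mul_le_mul (bg i) (bct l) (abs_nonneg _) hKv.le
end

section
variable {n : ℕ}

lemma pd_rpow {w : (Fin n → ℝ) → ℝ} {x : Fin n → ℝ} (hw : DifferentiableAt ℝ w x) {s : ℝ} (h : w x ≠ 0 ∨ 1 ≤ s) (i : Fin n) :
    pd i (fun z => w z ^ s) x = s * w x ^ (s-1) * pd i w x := by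
  unfold pd; rw [(hw.hasFDerivAt.rpow_const h).fderiv]; simp

/-- Pointwise hypotheses for the energy estimate. -/
structure CoreHyp (κ : ℕ) (K : ℝ) (S : Set (Fin n → ℝ)) (u g v η : (Fin n → ℝ) → ℝ)
    (a b c ct : Fin n → (Fin n → ℝ) → ℝ) : Prop where
  v1 : ∀ x ∈ S, 1 ≤ v x
  grad_g : ∀ x ∈ S, ∀ i, pd i g x = c i x + ∑ j, augM u g x i j * a j x
  bT : ∀ x ∈ S, ∀ i l, |newtonT (κ+1) (augM u g x) i l| ≤ K * (v x ^ κ * v x)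
  bT' : ∀ x ∈ S, ∀ i l, |newtonT κ (augM u g x) i l| ≤ K * v x ^ κ
  bT'' : ∀ x ∈ S, ∀ i l, |newtonP κ (augM u g x) i l| ≤ K * v x ^ κ
  ba : ∀ x ∈ S, ∀ i, |a i x| ≤ K
  bb : ∀ x ∈ S, ∀ i, |b i x| ≤ K
  bct : ∀ x ∈ S, ∀ i, |ct i x| ≤ K
  be : ∀ x ∈ S, ∀ i, |pd i η x| ≤ K
  bg : ∀ x ∈ S, ∀ i, |pd i g x| ≤ K * v x
  bDc : ∀ x ∈ S, ∀ i l, |pd i (ct l) x| ≤ K * v x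
  bc : ∀ x ∈ S, ∀ i l, |(c l x - ct l x) * pd i v x| ≤ 1
  low : ∀ x ∈ S, ∀ ζ : Fin n → ℝ, ∑ i, ζ i ^ 2 ≤ K * v x * (ζ ⬝ᵥ (newtonT (κ+1) (augM u g x) *ᵥ ζ))
  main : ∀ x ∈ S, ((n:ℝ) - (κ+1:ℕ)) * esymmMat (κ+1) (augM u g x) * (∑ i, a i x * pd i v x) + (∑ i, b i x * pd i v x)
      - K * (v x ^ κ * v x ^ 3) ≤ ∑ i, ∑ l, newtonT (κ+1) (augM u g x) i l * pd i (pd l v) x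

noncomputable def enC (n : ℕ) (K : ℝ) (m m' : ℝ) : ℝ :=
  (5*(n^2*K^3) + 2*m^2*(n^2*K^3) + 2*(n*K^3) + m*(n^2*K^3) + m*((n^2*K^3) + 2*(n^2*K^3) + m'*(n^2*K^3)))

lemma energy_pt {κ : ℕ} (hκ : κ + 2 ≤ n) {x₀ : Fin n → ℝ} {r r' K q : ℝ} (hr : 0 < r) (hr' : r < r') (hK : 1 ≤ K) (hq : 1 < q)
    {u g v η : (Fin n → ℝ) → ℝ} {a b c ct : Fin n → (Fin n → ℝ) → ℝ}
    (hu : ContDiffOn ℝ 2 u (ball x₀ r')) (hg : ContDiffOn ℝ 1 g (ball x₀ r')) (hv : ContDiffOn ℝ 2 v (ball x₀ r'))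
    (hct : ∀ l, ContDiffOn ℝ 1 (ct l) (ball x₀ r'))
    (hη : ContDiff ℝ 1 η) (hη0 : ∀ x, 0 ≤ η x) (hη1 : ∀ x, η x ≤ 1)
    (hvp : ∀ x ∈ ball x₀ r', 0 < v x)
    (H : CoreHyp κ K (closedBall x₀ r) u g v η a b c ct) {x : Fin n → ℝ} (hx : x ∈ closedBall x₀ r) :
    (η x ^ (2*q-2) * v x ^ (q-1)) * (q/2 * (η x ^2 * ((∑ i, pd i v x ^ 2) / (K * v x))) - enC n K ((n:ℝ) - (κ+1:ℕ)) ((n:ℝ) - κ) * q * (η x^2*(v x ^ κ*v x^4) + v x ^ κ*v x^3))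
     ≤ (∑ i, ∑ l, newtonT (κ+1) (augM u g x) i l * pd i (fun z => η z ^ (2*q) * (pd l v z * v z ^ q)) x)
       - ((n:ℝ) - (κ+1:ℕ)) * (∑ i, ∑ l, newtonP (κ+1) (augM u g x) i l * pd i g x * (η x ^ (2*q) * (pd l v x * v x ^ q)))
       + (((n:ℝ) - (κ+1:ℕ))/(q+1)) * ((∑ i, ∑ l, newtonT κ (augM u g x) i l * pd i (fun z => η z ^ (2*q) * (ct l z * v z ^ (q+1))) x)
          - ((n:ℝ) - κ) * (∑ i, ∑ l, newtonP κ (augM u g x) i l * pd i g x * (η x ^ (2*q) * (ct l x * v x ^ (q+1))))) := by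
  have hxU : x ∈ ball x₀ r' := closedBall_subset_ball hr' hx
  have hA := augM_symm_on isOpen_ball g hu hxU
  have hv1 := H.v1 x hx
  have hv0 : 0 < v x := by linarith
  have hm : 0 ≤ (n:ℝ) - (κ+1:ℕ) := by rw [sub_nonneg]; exact_mod_cast (by omega : κ+1 ≤ n)
  have hm' : 0 ≤ (n:ℝ) - κ := by rw [sub_nonneg]; exact_mod_cast (by omega : κ ≤ n)
  obtain ⟨C, hC, key⟩ := vec_core (n := n) (K := K) (m := (n:ℝ) - (κ+1:ℕ)) (m' := (n:ℝ) - κ) (q := q) (η := η x) (v := v x) (y := v x ^ κ)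
    (σ := esymmMat (κ+1) (augM u g x)) (T := newtonT (κ+1) (augM u g x)) (T' := newtonT κ (augM u g x)) (T'' := newtonP κ (augM u g x))
    (A := augM u g x) (Hv := Matrix.of fun i l => pd i (pd l v) x) (Dc := Matrix.of fun i l => pd i (ct l) x) (ξ := fun i => pd i v x) (e := fun i => pd i η x)
    (a := fun i => a i x) (b := fun i => b i x) (c := fun i => c i x) (ct := fun i => ct i x) (g := fun i => pd i g x)
    (by omega) hK hm hm' hq.le (hη0 x) (hη1 x) hv1 (one_le_pow₀ hv1) (newtonT_symm _ hA _).1 (newtonT_symm _ hA _).1 hA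
    (newtonT_symm _ hA _).2 rfl (funext fun i => H.grad_g x hx i) (H.bT x hx) (H.bT' x hx) (H.bT'' x hx) (H.ba x hx) (H.bb x hx)
    (H.bct x hx) (H.be x hx) (H.bg x hx) (H.bDc x hx) (H.bc x hx) (H.low x hx) (H.main x hx)
  have hCe : enC n K ((n:ℝ) - (κ+1:ℕ)) ((n:ℝ) - κ) = C := hC.symm
  rw [hCe]
  have hEW : 0 ≤ η x ^ (2*q-2) * v x ^ (q-1) := mul_nonneg (Real.rpow_nonneg (hη0 x) _) (Real.rpow_nonneg hv0.le _)
  have hlow : (∑ i, pd i v x ^ 2) / (K * v x) ≤ (fun i => pd i v x) ⬝ᵥ (newtonT (κ+1) (augM u g x) *ᵥ (fun i => pd i v x)) := by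
    rw [div_le_iff₀ (by positivity), mul_comm]; exact H.low x hx _
  have h1 : q/2 * (η x ^2 * ((∑ i, pd i v x ^ 2) / (K * v x))) ≤ q/2 * (η x ^2 * ((fun i => pd i v x) ⬝ᵥ (newtonT (κ+1) (augM u g x) *ᵥ (fun i => pd i v x)))) := by gcongr
  refine (mul_le_mul_of_nonneg_left ((sub_le_sub_right h1 _).trans key) hEW).trans (le_of_eq ?_)
  -- derivatives
  have e2 : η x ^ (2*q) = η x ^ (2*q-2) * η x ^ 2 := by
    rw [← Real.rpow_natCast, ← Real.rpow_add_of_nonneg (hη0 x) (by linarith) (by positivity)]; congr 1; push_cast; ring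
  have e1 : η x ^ (2*q-1) = η x ^ (2*q-2) * η x := by
    nth_rewrite 3 [← Real.rpow_one (η x)]
    rw [← Real.rpow_add_of_nonneg (hη0 x) (by linarith) (by positivity)]; congr 1; ring
  have w1 : v x ^ q = v x ^ (q-1) * v x := by
    nth_rewrite 3 [← Real.rpow_one (v x)]
    rw [← Real.rpow_add hv0]; congr 1; ring
  have w2 : v x ^ (q+1) = v x ^ (q-1) * v x^2 := by
    rw [← Real.rpow_natCast, ← Real.rpow_add hv0]; congr 1; push_cast; ring
  have hv1' : ContDiffOn ℝ 1 v (ball x₀ r') := hv.of_le (by norm_num)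
  have dη : DifferentiableAt ℝ η x := hη.differentiable (by norm_num) x
  have dv : DifferentiableAt ℝ v x := diffAt_of_on isOpen_ball hv1' hxU
  have dpv : ∀ l, DifferentiableAt ℝ (pd l v) x := fun l =>
    diffAt_of_on isOpen_ball (pd_contDiffOn (m := 1) isOpen_ball hv (by norm_num) l) hxU
  have dct : ∀ l, DifferentiableAt ℝ (ct l) x := fun l => diffAt_of_on isOpen_ball (hct l) hxU
  have dηq : DifferentiableAt ℝ (fun z => η z ^ (2*q)) x := (dη.hasFDerivAt.rpow_const (Or.inr (by linarith))).differentiableAt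
  have dvq : ∀ s : ℝ, DifferentiableAt ℝ (fun z => v z ^ s) x := fun s => (dv.hasFDerivAt.rpow_const (Or.inl hv0.ne')).differentiableAt
  have D1 : ∀ i l, pd i (fun z => η z ^ (2*q) * (pd l v z * v z ^ q)) x
      = (η x ^ (2*q-2) * v x ^ (q-1)) * (η x^2 * v x * pd i (pd l v) x + q * η x^2 * (pd i v x * pd l v x) + 2*q*η x * v x*(pd i η x * pd l v x)) := by
    intro i l
    rw [pd_mul dηq ((dpv l).fun_mul (dvq q)), pd_mul (dpv l) (dvq q), pd_rpow dη (Or.inr (by linarith)), pd_rpow dv (Or.inl hv0.ne'), e1, e2, w1]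
    ring
  have D2 : ∀ i l, pd i (fun z => η z ^ (2*q) * (ct l z * v z ^ (q+1))) x
      = (η x ^ (2*q-2) * v x ^ (q-1)) * (η x^2 * v x^2 * pd i (ct l) x + (q+1) * η x^2 * v x * (pd i v x * ct l x) + 2*q*η x * v x^2*(pd i η x * ct l x)) := by
    intro i l
    rw [pd_mul dηq ((dct l).fun_mul (dvq _)), pd_mul (dct l) (dvq _), pd_rpow dη (Or.inr (by linarith)), pd_rpow dv (Or.inl hv0.ne'), e1, e2, add_sub_cancel_right, w1, w2]
    ring
  simp only [D1, D2, e2, w1, w2]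
  have S1 : ∀ (T : Matrix (Fin n) (Fin n) ℝ) (α c1 c2 c3 : ℝ) (f1 f2 f3 : Fin n → Fin n → ℝ),
      ∑ i, ∑ l, T i l * (α * (c1 * f1 i l + c2 * f2 i l + c3 * f3 i l)) =
      α * (c1 * ∑ i, ∑ l, T i l * f1 i l + c2 * ∑ i, ∑ l, T i l * f2 i l + c3 * ∑ i, ∑ l, T i l * f3 i l) := by
    intro T α c1 c2 c3 f1 f2 f3
    simp only [Finset.mul_sum, ← Finset.sum_add_distrib]
    exact Finset.sum_congr rfl fun i _ => Finset.sum_congr rfl fun l _ => by ring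
  have S2 : ∀ (T : Matrix (Fin n) (Fin n) ℝ) (G h : Fin n → ℝ) (α β : ℝ),
      ∑ i, ∑ l, T i l * G i * (α * (h l * β)) = α * β * ∑ i, ∑ l, T i l * (G i * h l) := by
    intro T G h α β
    simp only [Finset.mul_sum]
    exact Finset.sum_congr rfl fun i _ => Finset.sum_congr rfl fun l _ => by ring
  rw [S1, S1, S2, S2]
  simp only [newtonP, Matrix.of_apply]
  ring
end

section
variable {n : ℕ}

lemma cts_dsum {S : Set (Fin n → ℝ)} {T : (Fin n → ℝ) → Fin n → Fin n → ℝ} {f : Fin n → Fin n → (Fin n → ℝ) → ℝ}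
    (hT : ∀ i l, ContinuousOn (fun x => T x i l) S) (hf : ∀ i l, ContinuousOn (f i l) S) :
    ContinuousOn (fun x => ∑ i, ∑ l, T x i l * f i l x) S :=
  continuousOn_finset_sum _ fun i _ => continuousOn_finset_sum _ fun l _ => (hT i l).mul (hf i l)

lemma rpow_tsupport {η : (Fin n → ℝ) → ℝ} {s : ℝ} (hs : s ≠ 0) : tsupport (fun x => η x ^ s) ⊆ tsupport η := by
  apply closure_mono
  intro x hx
  rw [Function.mem_support] at hx ⊢
  intro h
  exact hx (by rw [h, Real.zero_rpow hs])

lemma energy {κ : ℕ} (hκ : κ + 2 ≤ n) {x₀ : Fin n → ℝ} {r r' K q : ℝ} (hr : 0 < r) (hr' : r < r') (hK : 1 ≤ K) (hq : 1 < q)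
    {u g v η : (Fin n → ℝ) → ℝ} {a b c ct : Fin n → (Fin n → ℝ) → ℝ}
    (hu : ContDiffOn ℝ 2 u (ball x₀ r')) (hg : ContDiffOn ℝ 1 g (ball x₀ r')) (hv : ContDiffOn ℝ 2 v (ball x₀ r'))
    (hct : ∀ l, ContDiffOn ℝ 1 (ct l) (ball x₀ r'))
    (hη : ContDiff ℝ 1 η) (hη0 : ∀ x, 0 ≤ η x) (hη1 : ∀ x, η x ≤ 1) (hηs : tsupport η ⊆ closedBall x₀ r)
    (hvp : ∀ x ∈ ball x₀ r', 0 < v x)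
    (H : CoreHyp κ K (closedBall x₀ r) u g v η a b c ct) :
    ∫ x in closedBall x₀ r, (η x ^ (2*q-2) * v x ^ (q-1)) * (η x ^2 * ((∑ i, pd i v x ^ 2) / (K * v x)))
     ≤ 2 * enC n K ((n:ℝ) - (κ+1:ℕ)) ((n:ℝ) - κ) * ∫ x in closedBall x₀ r, (η x ^ (2*q-2) * v x ^ (q-1)) * (η x^2*(v x ^ κ*v x^4) + v x ^ κ*v x^3) := by
  set S := closedBall x₀ r with hS
  set U := ball x₀ r' with hUdef
  have hU : IsOpen U := isOpen_ball
  have hSU : S ⊆ U := closedBall_subset_ball hr'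
  have hSc : IsCompact S := isCompact_closedBall _ _
  have hv1 : ContDiffOn ℝ 1 v U := hv.of_le (by norm_num)
  have hpv : ∀ l, ContDiffOn ℝ 1 (pd l v) U := fun l => pd_contDiffOn (m := 1) hU hv (by norm_num) l
  have hvs : ∀ s : ℝ, ContDiffOn ℝ 1 (fun x => v x ^ s) U := fun s => hv1.rpow_const_of_ne fun x hx => (hvp x hx).ne'
  have hηq : ContDiff ℝ 1 (fun x => η x ^ (2*q)) := by
    have := ContDiff.rpow_const_of_le (m := 1) (p := 2*q) (f := η) (by exact_mod_cast hη) (by push_cast; linarith)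
    exact_mod_cast this
  have hsup : tsupport (fun x => η x ^ (2*q)) ⊆ S := (rpow_tsupport (by linarith)).trans hηs
  have hX : ∀ l, ContDiff ℝ 1 (fun z => η z ^ (2*q) * (pd l v z * v z ^ q)) := fun l =>
    cutoff_contDiff hU hηq (hsup.trans hSU) ((hpv l).mul (hvs q))
  have hY : ∀ l, ContDiff ℝ 1 (fun z => η z ^ (2*q) * (ct l z * v z ^ (q+1))) := fun l =>
    cutoff_contDiff hU hηq (hsup.trans hSU) ((hct l).mul (hvs (q+1)))
  have hXs : ∀ l, tsupport (fun z => η z ^ (2*q) * (pd l v z * v z ^ q)) ⊆ S := fun l =>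
    (tsupport_mul_subset_left).trans hsup
  have hYs : ∀ l, tsupport (fun z => η z ^ (2*q) * (ct l z * v z ^ (q+1))) ⊆ S := fun l =>
    (tsupport_mul_subset_left).trans hsup
  have I1 := weak_local hr hr' hu hg hX hXs (show κ+1 ≤ n by omega)
  have I2 := weak_local hr hr' hu hg hY hYs (show κ ≤ n by omega)
  have hAc : ∀ i l, ContinuousOn (fun x => augM u g x i l) S := by
    intro i l
    simp only [augM_apply]
    refine ContinuousOn.sub ?_ ?_
    · exact ((pd_contDiffOn (m := 0) hU (pd_contDiffOn (m := 1) hU hu (by norm_num) l) (by norm_num) i).continuousOn).mono hSU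
    · first
        | exact (hg.continuousOn.mono hSU).mul continuousOn_const
        | (split_ifs
           · exact hg.continuousOn.mono hSU
           · exact continuousOn_const)
  have hgc : ∀ i, ContinuousOn (pd i g) S := fun i => (pd_contDiffOn (m := 0) hU hg (by norm_num) i).continuousOn.mono hSU
  have c1 : ContinuousOn (fun x => ∑ i, ∑ l, newtonT (κ+1) (augM u g x) i l * pd i (fun z => η z ^ (2*q) * (pd l v z * v z ^ q)) x) S :=
    cts_dsum (newton_continuousOn hAc _) fun i l => (pd_continuous (hX l) i).continuousOn
  have c3 : ContinuousOn (fun x => ∑ i, ∑ l, newtonT κ (augM u g x) i l * pd i (fun z => η z ^ (2*q) * (ct l z * v z ^ (q+1))) x) S :=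
    cts_dsum (newton_continuousOn hAc _) fun i l => (pd_continuous (hY l) i).continuousOn
  have c2 : ContinuousOn (fun x => ∑ i, ∑ l, newtonP (κ+1) (augM u g x) i l * pd i g x * (η x ^ (2*q) * (pd l v x * v x ^ q))) S :=
    continuousOn_finset_sum _ fun i _ => continuousOn_finset_sum _ fun l _ =>
      ((newtonP_continuousOn hAc _ i l).mul (hgc i)).mul (hX l).continuous.continuousOn
  have c4 : ContinuousOn (fun x => ∑ i, ∑ l, newtonP κ (augM u g x) i l * pd i g x * (η x ^ (2*q) * (ct l x * v x ^ (q+1)))) S :=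
    continuousOn_finset_sum _ fun i _ => continuousOn_finset_sum _ fun l _ =>
      ((newtonP_continuousOn hAc _ i l).mul (hgc i)).mul (hY l).continuous.continuousOn
  have i1 := c1.integrableOn_compact (μ := volume) hSc
  have i2 := c2.integrableOn_compact (μ := volume) hSc
  have i3 := c3.integrableOn_compact (μ := volume) hSc
  have i4 := c4.integrableOn_compact (μ := volume) hSc
  have hvc : ContinuousOn v S := hv.continuousOn.mono hSU
  have hvne : ∀ x ∈ S, v x ≠ 0 := fun x hx => (hvp x (hSU hx)).ne'
  have hEW : ContinuousOn (fun x => η x ^ (2*q-2) * v x ^ (q-1)) S :=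
    ((hη.continuous.continuousOn).rpow_const fun x _ => Or.inr (by linarith)).mul (hvc.rpow_const fun x hx => Or.inl (hvne x hx))
  have cA : ContinuousOn (fun x => (η x ^ (2*q-2) * v x ^ (q-1)) * (η x ^2 * ((∑ i, pd i v x ^ 2) / (K * v x)))) S := by
    refine hEW.mul ((hη.continuous.continuousOn.pow 2).mul (ContinuousOn.div ?_ (continuousOn_const.mul hvc) fun x hx => mul_ne_zero (by linarith) (hvne x hx)))
    exact continuousOn_finset_sum _ fun i _ => ((hpv i).continuousOn.mono hSU).pow 2
  have cB : ContinuousOn (fun x => (η x ^ (2*q-2) * v x ^ (q-1)) * (η x^2*(v x ^ κ*v x^4) + v x ^ κ*v x^3)) S :=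
    hEW.mul (((hη.continuous.continuousOn.pow 2).mul ((hvc.pow _).mul (hvc.pow _))).add ((hvc.pow _).mul (hvc.pow _)))
  have iA := cA.integrableOn_compact (μ := volume) hSc
  have iB := cB.integrableOn_compact (μ := volume) hSc
  set m : ℝ := (n:ℝ) - (κ+1:ℕ) with hm
  set m' : ℝ := (n:ℝ) - κ with hm'
  have key := setIntegral_mono_on (μ := volume) (((iA.const_mul (q/2)).sub (iB.const_mul (enC n K m m' * q)))) ((i1.sub (i2.const_mul m)).add ((i3.sub (i4.const_mul m')).const_mul (m/(q+1)))) hSc.measurableSet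
    (fun x hx => by
      have := energy_pt hκ hr hr' hK hq hu hg hv hct hη hη0 hη1 hvp H hx
      simp only [Pi.add_apply, Pi.sub_apply]
      refine le_trans (le_of_eq ?_) this
      ring)
  simp only [Pi.add_apply, Pi.sub_apply] at key
  have key2 : q/2 * (∫ x in S, (η x ^ (2*q-2) * v x ^ (q-1)) * (η x ^2 * ((∑ i, pd i v x ^ 2) / (K * v x))))
     - enC n K m m' * q * (∫ x in S, (η x ^ (2*q-2) * v x ^ (q-1)) * (η x^2*(v x ^ κ*v x^4) + v x ^ κ*v x^3)) ≤ 0 := by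
    have l1 := integral_sub (μ := volume.restrict S) (iA.const_mul (q/2)) (iB.const_mul (enC n K m m' * q))
    have l2 := integral_add (μ := volume.restrict S) (i1.sub (i2.const_mul m)) ((i3.sub (i4.const_mul m')).const_mul (m/(q+1)))
    have l3 := integral_sub (μ := volume.restrict S) i1 (i2.const_mul m)
    have l4 := integral_sub (μ := volume.restrict S) i3 (i4.const_mul m')
    simp only [Pi.add_apply, Pi.sub_apply, integral_const_mul] at l1 l2 l3 l4 key
    rw [l1, l2, l3, l4, I1, I2] at key
    simp only [← hS, sub_self, mul_zero, add_zero] at key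
    exact key
  have hq0 : 0 < q := by linarith
  have : q * (∫ x in S, (η x ^ (2*q-2) * v x ^ (q-1)) * (η x ^2 * ((∑ i, pd i v x ^ 2) / (K * v x)))) ≤ q * (2 * enC n K m m' * ∫ x in S, (η x ^ (2*q-2) * v x ^ (q-1)) * (η x^2*(v x ^ κ*v x^4) + v x ^ κ*v x^3)) := by
    linarith
  exact le_of_mul_le_mul_left this hq0
end

section

lemma moser_factor {C q : ℝ} (hC : 1 ≤ C) (hq : 1 ≤ q) : (2*C*q^2) ^ (1/q) ≤ Real.exp ((Real.log (2*C) + 4) / Real.sqrt q) := by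
  have hq0 : 0 < q := by linarith
  have hC0 : 0 < 2*C := by linarith
  have hs : 1 ≤ Real.sqrt q := Real.one_le_sqrt.2 hq
  have hs0 : 0 < Real.sqrt q := by linarith
  rw [Real.rpow_def_of_pos (by positivity)]
  apply Real.exp_le_exp.2
  have h1 : Real.log (2*C*q^2) = Real.log (2*C) + 2 * Real.log q := by
    rw [Real.log_mul hC0.ne' (by positivity), Real.log_pow]; push_cast; ring
  have h2 : Real.log q ≤ 2 * Real.sqrt q := by
    have h := Real.log_le_sub_one_of_pos hs0
    have : Real.log q = 2 * Real.log (Real.sqrt q) := by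
      rw [Real.log_sqrt hq0.le]; ring
    rw [this]; linarith
  have h3 : 0 ≤ Real.log (2*C) := Real.log_nonneg (by linarith)
  have h4 : Real.log (2*C*q^2) ≤ (Real.log (2*C) + 4) * Real.sqrt q := by
    rw [h1]; nlinarith
  calc Real.log (2*C*q^2) * (1/q) ≤ (Real.log (2*C) + 4) * Real.sqrt q * (1/q) :=
        mul_le_mul_of_nonneg_right h4 (by positivity)
    _ = (Real.log (2*C) + 4) / Real.sqrt q := by
        nth_rewrite 2 [← Real.mul_self_sqrt hq0.le]
        field_simp

lemma moser_seq {χ s' q0 C J0 : ℝ} (hs : 1 < s') (hχ : s' < χ) (hq0 : 1 < q0) (hC : 1 ≤ C) :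
    ∃ N : ℝ, 1 ≤ N ∧ ∀ J : ℝ → ℝ, (∀ t, 0 ≤ J t) → J (q0*s') ≤ J0 →
      (∀ q, 1 < q → J (q*χ) ^ (1/χ) ≤ C * q^2 * (1 + J (q*s') ^ (1/s'))) →
      ∀ j : ℕ, J (q0*s'*(χ/s')^j) ≤ N ^ (q0*s'*(χ/s')^j) := by
  have hs0 : 0 < s' := by linarith
  have hχ0 : 0 < χ := by linarith
  set θ := χ/s' with hθ
  have hθ1 : 1 < θ := by rw [hθ, one_lt_div hs0]; exact hχ
  have hθ0 : 0 < θ := by linarith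
  set ρ := (Real.sqrt θ)⁻¹ with hρ
  have hsθ : 1 < Real.sqrt θ := by rw [Real.lt_sqrt (by norm_num)]; simpa using hθ1
  have hρ0 : 0 < ρ := by positivity
  have hρ1 : ρ < 1 := inv_lt_one_of_one_lt₀ hsθ
  set D := Real.log (2*C) + 4 with hD
  have hD0 : 0 ≤ D := by have := Real.log_nonneg (show 1 ≤ 2*C by linarith); positivity
  set L := D/(1-ρ) with hL
  have hL0 : 0 ≤ L := div_nonneg hD0 (by linarith)
  set N0 := max 1 ((max J0 0)^(1/(q0*s'))) with hN0
  have hN01 : 1 ≤ N0 := le_max_left _ _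
  have t0 : 0 < q0*s' := by positivity
  have hqj : ∀ j : ℕ, 1 < q0*θ^j := fun j => by
    have := one_le_pow₀ (n := j) hθ1.le
    nlinarith
  refine ⟨N0 * Real.exp L, ?_, ?_⟩
  · have := Real.one_le_exp hL0; nlinarith
  intro J hJ hJ0 hrec
  have claim : ∀ j : ℕ, J (q0*s'*θ^j) ≤ (N0 * Real.exp (L * (1-ρ^j))) ^ (q0*s'*θ^j) := by
    intro j
    induction j with
    | zero =>
      simp only [pow_zero, mul_one, sub_self, mul_zero, Real.exp_zero]
      calc J (q0*s') ≤ max J0 0 := hJ0.trans (le_max_left _ _)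
        _ = ((max J0 0)^(1/(q0*s'))) ^ (q0*s') := by
            rw [← Real.rpow_mul (le_max_right _ _), one_div_mul_cancel t0.ne', Real.rpow_one]
        _ ≤ N0 ^ (q0*s') := Real.rpow_le_rpow (Real.rpow_nonneg (le_max_right _ _) _) (le_max_right _ _) t0.le
    | succ j ih =>
      set q := q0*θ^j with hq
      have hq1 : 1 < q := hqj j
      have hqp : 0 < q := by linarith
      have e1 : q0*s'*θ^j = q*s' := by rw [hq]; ring
      have e2 : q0*s'*θ^(j+1) = q*χ := by rw [hq, pow_succ, hθ]; field_simp
      rw [e1] at ih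
      rw [e2]
      set P := N0 * Real.exp (L * (1-ρ^j)) with hP
      have hρj : ρ^j ≤ 1 := pow_le_one₀ hρ0.le hρ1.le
      have hP1 : 1 ≤ P := by
        have := Real.one_le_exp (mul_nonneg hL0 (sub_nonneg.2 hρj)); nlinarith
      have hP0 : 0 < P := by linarith
      have h1 : J (q*s') ^ (1/s') ≤ P ^ q := by
        calc J (q*s') ^ (1/s') ≤ (P ^ (q*s'))^(1/s') := Real.rpow_le_rpow (hJ _) ih (by positivity)
          _ = P ^ q := by rw [← Real.rpow_mul hP0.le]; congr 1; field_simp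
      have h2 : 1 ≤ P ^ q := Real.one_le_rpow hP1 hqp.le
      have h3 : J (q*χ) ^ (1/χ) ≤ 2*C*q^2 * P^q := by
        refine (hrec q hq1).trans ?_
        have : C*q^2 * (1 + J (q*s') ^ (1/s')) ≤ C*q^2 * (2*P^q) := mul_le_mul_of_nonneg_left (by linarith) (by positivity)
        linarith
      have h4 : J (q*χ) ≤ ((2*C*q^2)^(1/q) * P) ^ (q*χ) := by
        calc J (q*χ) = (J (q*χ) ^ (1/χ))^χ := by rw [← Real.rpow_mul (hJ _), one_div_mul_cancel hχ0.ne', Real.rpow_one]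
          _ ≤ (2*C*q^2 * P^q)^χ := Real.rpow_le_rpow (Real.rpow_nonneg (hJ _) _) h3 hχ0.le
          _ = ((2*C*q^2)^(1/q) * P) ^ (q*χ) := by
            have hh : ((2*C*q^2)^(1/q) * P) ^ q = 2*C*q^2 * P^q := by
              rw [Real.mul_rpow (by positivity) hP0.le, ← Real.rpow_mul (by positivity), one_div_mul_cancel hqp.ne', Real.rpow_one]
            rw [Real.rpow_mul (show 0 ≤ (2*C*q^2)^(1/q) * P by positivity), hh]
      refine h4.trans (Real.rpow_le_rpow (by positivity) ?_ (by positivity))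
      have h5 := moser_factor hC hq1.le
      have h6 : (Real.log (2*C) + 4) / Real.sqrt q ≤ D * ρ^j := by
        rw [div_eq_mul_inv]
        apply mul_le_mul_of_nonneg_left _ hD0
        rw [hρ, inv_pow]
        apply inv_anti₀ (by positivity)
        apply Real.le_sqrt_of_sq_le
        rw [← pow_mul, mul_comm j 2, pow_mul, Real.sq_sqrt hθ0.le, hq]
        exact le_mul_of_one_le_left (by positivity) hq0.le
      calc (2*C*q^2)^(1/q) * P ≤ Real.exp (D*ρ^j) * P := mul_le_mul_of_nonneg_right (h5.trans (Real.exp_le_exp.2 h6)) hP0.le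
        _ = N0 * Real.exp (L * (1-ρ^(j+1))) := by
          rw [hP, mul_left_comm, ← Real.exp_add]
          congr 2
          have : D = L*(1-ρ) := by rw [hL]; field_simp [show (1-ρ) ≠ 0 by linarith]
          rw [this]; ring
  intro j
  refine (claim j).trans (Real.rpow_le_rpow (by positivity) ?_ (by positivity))
  apply mul_le_mul_of_nonneg_left _ (by linarith)
  apply Real.exp_le_exp.2
  have : 0 ≤ L*ρ^j := by positivity
  linarith

lemma moser_sup {n : ℕ} {S : Set (Fin n → ℝ)} (hS : IsCompact S) {z : (Fin n → ℝ) → ℝ} (hz : ContinuousOn z S)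
    (hz0 : ∀ x ∈ S, 0 ≤ z x) {N : ℝ} (hN : 1 ≤ N) {t : ℕ → ℝ} (ht : Filter.Tendsto t Filter.atTop Filter.atTop) (htp : ∀ j, 0 < t j)
    (hJ : ∀ j, ∫ x in S, z x ^ t j ≤ N ^ t j) {x : Fin n → ℝ} (hx : x ∈ interior S) : z x ≤ 2*N := by
  by_contra hcon
  push Not at hcon
  have hxS := interior_subset hx
  have hev : ∀ᶠ y in nhds x, 2*N < z y ∧ y ∈ S := by
    have h1 : ContinuousAt z x := hz.continuousAt (mem_interior_iff_mem_nhds.1 hx)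
    exact (h1.eventually (lt_mem_nhds hcon)).and (mem_interior_iff_mem_nhds.1 hx)
  obtain ⟨ε, hε, hb⟩ := Metric.eventually_nhds_iff_ball.1 hev
  have hBS : ball x ε ⊆ S := fun y hy => (hb y hy).2
  have hvol : 0 < volume.real (ball x ε) := by
    rw [Measure.real, ENNReal.toReal_pos_iff]
    exact ⟨measure_ball_pos _ _ hε, measure_ball_lt_top⟩
  have hN0 : 0 < N := by linarith
  have key : ∀ j, volume.real (ball x ε) * (2:ℝ)^(t j) ≤ 1 := by
    intro j
    have hi : IntegrableOn (fun y => z y ^ t j) S := (hz.rpow_const fun y _ => Or.inr (htp j).le).integrableOn_compact hS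
    have h1 : ∫ y in ball x ε, (2*N)^(t j) ≤ ∫ y in ball x ε, z y ^ t j := by
      apply setIntegral_mono_on _ (hi.mono_set hBS) measurableSet_ball
      · intro y hy; exact Real.rpow_le_rpow (by positivity) (hb y hy).1.le (htp j).le
      · exact integrableOn_const measure_ball_lt_top.ne
    have h2 : ∫ y in ball x ε, z y ^ t j ≤ ∫ y in S, z y ^ t j :=
      setIntegral_mono_set hi ((ae_restrict_mem hS.measurableSet).mono fun y hy => Real.rpow_nonneg (hz0 y hy) _) hBS.eventuallyLE
    rw [setIntegral_const, smul_eq_mul, Real.mul_rpow (by norm_num) hN0.le] at h1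
    have h3 : volume.real (ball x ε) * (2:ℝ)^(t j) * N^(t j) ≤ 1 * N^(t j) := by
      rw [mul_assoc, one_mul]; exact (h1.trans h2).trans (hJ j)
    exact le_of_mul_le_mul_right h3 (Real.rpow_pos_of_pos hN0 _)
  have htend : Filter.Tendsto (fun j => (2:ℝ)^(t j)) Filter.atTop Filter.atTop :=
    (tendsto_rpow_atTop_of_base_gt_one 2 (by norm_num)).comp ht
  obtain ⟨j, hj⟩ := (htend.eventually (Filter.eventually_gt_atTop ((volume.real (ball x ε))⁻¹))).exists
  have h1 := key j
  have h2 : 1 < volume.real (ball x ε) * (2:ℝ)^(t j) := by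
    rwa [inv_lt_iff_one_lt_mul₀' hvol] at hj
  linarith
end

section
variable {n : ℕ}

lemma fderiv_norm_sq_le (w : (Fin n → ℝ) → ℝ) (x : Fin n → ℝ) : ‖fderiv ℝ w x‖^2 ≤ n * ∑ i, pd i w x ^ 2 := by
  have h1 : ‖fderiv ℝ w x‖ ≤ ∑ i, |pd i w x| := by
    apply ContinuousLinearMap.opNorm_le_bound _ (Finset.sum_nonneg fun i _ => abs_nonneg _)
    intro y
    rw [fderiv_eq_sum_pd, Finset.sum_mul, Real.norm_eq_abs]
    refine (Finset.abs_sum_le_sum_abs _ _).trans (Finset.sum_le_sum fun i _ => ?_)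
    rw [abs_mul, mul_comm]
    exact mul_le_mul_of_nonneg_left (norm_le_pi_norm y i) (abs_nonneg _)
  have h2 : (∑ i, |pd i w x|)^2 ≤ n * ∑ i, |pd i w x|^2 := by
    have := sq_sum_le_card_mul_sum_sq (s := Finset.univ) (f := fun i : Fin n => |pd i w x|)
    simpa using this
  simp only [sq_abs] at h2
  exact (pow_le_pow_left₀ (norm_nonneg _) h1 2).trans h2

lemma grad_int_le {w : (Fin n → ℝ) → ℝ} (hw : ContDiff ℝ 1 w) (hc : HasCompactSupport w) :
    ∫ x, ‖fderiv ℝ w x‖ ^ (2:ℝ) ≤ n * ∫ x, ∑ i, pd i w x ^ 2 := by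
  have hi : ∀ i, Integrable (fun x => pd i w x ^ 2) := by
    intro i
    apply Continuous.integrable_of_hasCompactSupport ((pd_continuous hw i).pow 2)
    have := (pd_hasCompactSupport hc i).mul_right (f' := pd i w)
    simp only [sq]
    exact this
  rw [← integral_const_mul]
  apply integral_mono_of_nonneg
  · exact Filter.Eventually.of_forall fun x => by positivity
  · apply Integrable.const_mul
    apply integrable_finset_sum
    intro i _
    exact hi i
  · refine Filter.Eventually.of_forall fun x => ?_
    have := fderiv_norm_sq_le w x
    simpa using this

lemma sobolev (hn : 3 ≤ n) : ∃ CS : ℝ, 0 ≤ CS ∧ ∀ w : (Fin n → ℝ) → ℝ, ContDiff ℝ 1 w → HasCompactSupport w →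
    (∫ x, |w x| ^ (2*((n:ℝ)/(n-2)))) ^ (1/((n:ℝ)/(n-2))) ≤ CS * ∫ x, ∑ i, pd i w x ^ 2 := by
  have hn3 : (3:ℝ) ≤ n := by exact_mod_cast hn
  set χ : ℝ := (n:ℝ)/(n-2) with hχ
  have hχ0 : 0 < χ := div_pos (by linarith) (by linarith)
  set p' : NNReal := ⟨2*χ, by positivity⟩ with hp'
  have hp'c : (p' : ℝ) = 2*χ := rfl
  set CS : NNReal := MeasureTheory.eLpNormLESNormFDerivOfEqInnerConst (volume : Measure (Fin n → ℝ)) 2 with hCS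
  refine ⟨CS^2 * n, by positivity, fun w hw hc => ?_⟩
  have gns := MeasureTheory.eLpNorm_le_eLpNorm_fderiv_of_eq_inner (volume : Measure (Fin n → ℝ)) hw hc (p := 2) (p' := p') (by norm_num)
    (by simp; omega) (by
      rw [hp'c, hχ]; simp
      field_simp)
  have m1 : MemLp w p' volume := hw.continuous.memLp_of_hasCompactSupport hc
  have m2 : MemLp (fderiv ℝ w) 2 volume := (hw.continuous_fderiv (by norm_num)).memLp_of_hasCompactSupport (hc.fderiv ℝ)
  rw [MemLp.eLpNorm_eq_integral_rpow_norm (by rw [Ne, ENNReal.coe_eq_zero]; intro h; have : (p':ℝ) = 0 := by rw [h]; rfl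
                                              linarith) ENNReal.coe_ne_top m1] at gns
  rw [show ((2:NNReal):ENNReal) = 2 by rfl, MemLp.eLpNorm_eq_integral_rpow_norm (by norm_num) (by norm_num) m2] at gns
  simp only [ENNReal.coe_toReal, hp'c, ENNReal.toReal_ofNat, Real.norm_eq_abs] at gns
  set I := ∫ x, |w x| ^ (2*χ) with hI
  have hI0 : 0 ≤ I := integral_nonneg fun x => by positivity
  set G := ∫ x, ‖fderiv ℝ w x‖ ^ (2:ℝ) with hG
  have hG0 : 0 ≤ G := integral_nonneg fun x => by positivity
  rw [← ENNReal.ofReal_coe_nnreal, ← ENNReal.ofReal_mul (by positivity)] at gns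
  have gns2 : I ^ (2*χ)⁻¹ ≤ CS * G ^ (2:ℝ)⁻¹ := (ENNReal.ofReal_le_ofReal_iff (by positivity)).1 gns
  have h1 : I ^ (1/χ) = (I ^ (2*χ)⁻¹)^2 := by
    rw [← Real.rpow_natCast, ← Real.rpow_mul hI0]; congr 1; push_cast; field_simp
  have h2 : (CS * G ^ (2:ℝ)⁻¹)^2 = CS^2 * G := by
    rw [mul_pow, ← Real.rpow_natCast (G ^ (2:ℝ)⁻¹), ← Real.rpow_mul hG0]; norm_num
  have h3 : G ≤ n * ∫ x, ∑ i, pd i w x ^ 2 := grad_int_le hw hc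
  rw [h1]
  calc (I ^ (2*χ)⁻¹)^2 ≤ (CS * G ^ (2:ℝ)⁻¹)^2 := pow_le_pow_left₀ (by positivity) gns2 2
    _ = CS^2 * G := h2
    _ ≤ CS^2 * (n * ∫ x, ∑ i, pd i w x ^ 2) := mul_le_mul_of_nonneg_left h3 (by positivity)
    _ = _ := by ring
end

section
variable {n : ℕ}

lemma sob_step (hn : 3 ≤ n) : ∃ CS : ℝ, 0 ≤ CS ∧ ∀ {κ : ℕ} (hκ : κ + 2 ≤ n) {x₀ : Fin n → ℝ} {r r' K q : ℝ} (hr : 0 < r) (hr' : r < r') (hK : 1 ≤ K) (hq : 1 < q)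
    {u g v η : (Fin n → ℝ) → ℝ} {a b c ct : Fin n → (Fin n → ℝ) → ℝ}
    (hu : ContDiffOn ℝ 2 u (ball x₀ r')) (hg : ContDiffOn ℝ 1 g (ball x₀ r')) (hv : ContDiffOn ℝ 2 v (ball x₀ r'))
    (hct : ∀ l, ContDiffOn ℝ 1 (ct l) (ball x₀ r'))
    (hη : ContDiff ℝ 1 η) (hη0 : ∀ x, 0 ≤ η x) (hη1 : ∀ x, η x ≤ 1) (hηs : tsupport η ⊆ closedBall x₀ r)
    (hvp : ∀ x ∈ ball x₀ r', 0 < v x)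
    (H : CoreHyp κ K (closedBall x₀ r) u g v η a b c ct),
    (∫ x in closedBall x₀ r, (η x ^ 2 * v x) ^ (q*((n:ℝ)/(n-2)))) ^ (1/((n:ℝ)/(n-2))) ≤
      CS * q^2 * (2*n*K^2 + K*enC n K ((n:ℝ) - (κ+1:ℕ)) ((n:ℝ) - κ)) *
       ∫ x in closedBall x₀ r, (η x ^ (2*q-2) * v x ^ (q-1)) * (η x^2*(v x ^ κ*v x^4) + v x ^ κ*v x^3) := by
  obtain ⟨CS, hCS, sob⟩ := sobolev hn
  refine ⟨CS, hCS, ?_⟩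
  intro κ hκ x₀ r r' K q hr hr' hK hq u g v η a b c ct hu hg hv hct hη hη0 hη1 hηs hvp H
  have en := energy hκ hr hr' hK hq hu hg hv hct hη hη0 hη1 hηs hvp H
  have hn3 : (3:ℝ) ≤ n := by exact_mod_cast hn
  set χ : ℝ := (n:ℝ)/(n-2) with hχ
  have hχ0 : 0 < χ := div_pos (by linarith) (by linarith)
  set S := closedBall x₀ r with hS
  set U := ball x₀ r' with hUdef
  have hU : IsOpen U := isOpen_ball
  have hSU : S ⊆ U := closedBall_subset_ball hr'
  have hSc : IsCompact S := isCompact_closedBall _ _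
  have hv1 : ContDiffOn ℝ 1 v U := hv.of_le (by norm_num)
  have hq0 : 0 < q := by linarith
  have hpv : ∀ l, ContDiffOn ℝ 1 (pd l v) U := fun l => pd_contDiffOn (m := 1) hU hv (by norm_num) l
  have hηq : ContDiff ℝ 1 (fun x => η x ^ q) := by
    have := ContDiff.rpow_const_of_le (m := 1) (p := q) (f := η) (by exact_mod_cast hη) (by push_cast; linarith)
    exact_mod_cast this
  have hsup : tsupport (fun x => η x ^ q) ⊆ S := (rpow_tsupport (by linarith)).trans hηs
  set w : (Fin n → ℝ) → ℝ := fun x => η x ^ q * v x ^ (q/2) with hwdef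
  have hw : ContDiff ℝ 1 w := cutoff_contDiff hU hηq (hsup.trans hSU) (hv1.rpow_const_of_ne fun x hx => (hvp x hx).ne')
  have hws : tsupport w ⊆ S := tsupport_mul_subset_left.trans hsup
  have hwc : HasCompactSupport w := HasCompactSupport.of_support_subset_isCompact hSc ((subset_tsupport w).trans hws)
  have sb := sob w hw hwc
  have hw0 : ∀ x, x ∉ S → w x = 0 := fun x hx => image_eq_zero_of_notMem_tsupport fun h => hx (hws h)
  have hpw0 : ∀ x, x ∉ S → ∀ i, pd i w x = 0 := by
    intro x hx i
    have : w =ᶠ[nhds x] fun _ => 0 := notMem_tsupport_iff_eventuallyEq.1 fun h => hx (hws h)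
    rw [pd_congr this]; simp [pd]
  have e1 : ∫ x in S, (η x ^ 2 * v x) ^ (q*χ) = ∫ x, |w x| ^ (2*χ) := by
    refine Eq.trans ?_ (setIntegral_eq_integral_of_forall_compl_eq_zero (μ := volume) (s := S) (f := fun x => |w x| ^ (2*χ)) (fun x hx => by
      change |w x| ^ (2*χ) = 0
      rw [hw0 x hx, abs_zero, Real.zero_rpow (by positivity)]))
    apply setIntegral_congr_fun hSc.measurableSet
    intro x hx
    have hvx := hvp x (hSU hx)
    change (η x ^ 2 * v x) ^ (q*χ) = |η x ^ q * v x ^ (q/2)| ^ (2*χ)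
    rw [abs_of_nonneg (mul_nonneg (Real.rpow_nonneg (hη0 x) _) (Real.rpow_nonneg hvx.le _)),
      Real.mul_rpow (by positivity) hvx.le, Real.mul_rpow (Real.rpow_nonneg (hη0 x) _) (Real.rpow_nonneg hvx.le _),
      ← Real.rpow_mul (hη0 x), ← Real.rpow_mul hvx.le, ← Real.rpow_natCast, ← Real.rpow_mul (hη0 x)]
    push_cast
    congr 2 <;> ring
  have e2 : ∫ x, ∑ i, pd i w x ^ 2 = ∫ x in S, ∑ i, pd i w x ^ 2 := by
    rw [← setIntegral_eq_integral_of_forall_compl_eq_zero (s := S)]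
    intro x hx
    apply Finset.sum_eq_zero
    intro i _
    rw [hpw0 x hx]; norm_num
  rw [← e1, e2] at sb
  refine sb.trans ?_
  have hvc : ContinuousOn v S := hv.continuousOn.mono hSU
  have hvne : ∀ x ∈ S, v x ≠ 0 := fun x hx => (hvp x (hSU hx)).ne'
  have hEW : ContinuousOn (fun x => η x ^ (2*q-2) * v x ^ (q-1)) S :=
    ((hη.continuous.continuousOn).rpow_const fun x _ => Or.inr (by linarith)).mul (hvc.rpow_const fun x hx => Or.inl (hvne x hx))
  have cA : ContinuousOn (fun x => (η x ^ (2*q-2) * v x ^ (q-1)) * (η x ^2 * ((∑ i, pd i v x ^ 2) / (K * v x)))) S := by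
    refine hEW.mul ((hη.continuous.continuousOn.pow 2).mul (ContinuousOn.div ?_ (continuousOn_const.mul hvc) fun x hx => mul_ne_zero (by linarith) (hvne x hx)))
    exact continuousOn_finset_sum _ fun i _ => ((hpv i).continuousOn.mono hSU).pow 2
  have cB : ContinuousOn (fun x => (η x ^ (2*q-2) * v x ^ (q-1)) * (η x^2*(v x ^ κ*v x^4) + v x ^ κ*v x^3)) S :=
    hEW.mul (((hη.continuous.continuousOn.pow 2).mul ((hvc.pow _).mul (hvc.pow _))).add ((hvc.pow _).mul (hvc.pow _)))
  have iA := cA.integrableOn_compact (μ := volume) hSc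
  have iB := cB.integrableOn_compact (μ := volume) hSc
  have cW : ContinuousOn (fun x => ∑ i, pd i w x ^ 2) S :=
    continuousOn_finset_sum _ fun i _ => ((pd_continuous hw i).continuousOn).pow 2
  have iW := cW.integrableOn_compact (μ := volume) hSc
  have key := setIntegral_mono_on (μ := volume) iW ((iB.const_mul (2*n*q^2*K^2)).add (iA.const_mul (q^2*K/2))) hSc.measurableSet (by
    intro x hx
    have hxU := hSU hx
    have hv1x := H.v1 x hx
    have hvx := hvp x hxU
    have dη : DifferentiableAt ℝ η x := hη.differentiable (by norm_num) x
    have dv : DifferentiableAt ℝ v x := diffAt_of_on hU hv1 hxU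
    have dηq : DifferentiableAt ℝ (fun z => η z ^ q) x := hηq.differentiable (by norm_num) x
    have dvq : DifferentiableAt ℝ (fun z => v z ^ (q/2)) x := (dv.hasFDerivAt.rpow_const (Or.inl hvx.ne')).differentiableAt
    set E := η x ^ (2*q-2) with hE
    set W := v x ^ (q-1) with hW
    have hE0 : 0 ≤ E := Real.rpow_nonneg (hη0 x) _
    have hW0 : 0 ≤ W := Real.rpow_nonneg hvx.le _
    have f1 : (η x ^ (q-1))^2 = E := by
      rw [← Real.rpow_natCast, ← Real.rpow_mul (hη0 x), hE]; congr 1; push_cast; ring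
    have f2 : η x ^ q = η x ^ (q-1) * η x := by
      nth_rewrite 3 [← Real.rpow_one (η x)]
      rw [← Real.rpow_add_of_nonneg (hη0 x) (by linarith) (by positivity)]; congr 1; ring
    have f3 : (v x ^ (q/2))^2 = W * v x := by
      nth_rewrite 2 [← Real.rpow_one (v x)]
      rw [hW, ← Real.rpow_natCast, ← Real.rpow_mul hvx.le, ← Real.rpow_add hvx]; congr 1; push_cast; ring
    have f4 : v x ^ (q/2-1) = v x ^ (q/2) / v x := by rw [Real.rpow_sub_one hvx.ne']
    have hY : v x ≤ η x^2*(v x ^ κ*v x^4) + v x ^ κ*v x^3 := by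
      have g1 : v x ≤ v x ^ (κ+3) := le_self_pow₀ hv1x (by omega)
      have g2 : 0 ≤ η x^2*(v x ^ κ*v x^4) := by positivity
      rw [pow_add] at g1; linarith
    have hi : ∀ i, pd i w x ^ 2 ≤ 2*q^2*K^2*(E*W*v x) + q^2/2*(E*W*(η x^2*(pd i v x^2/v x))) := by
      intro i
      have hpd : pd i w x = q * (η x ^ (q-1) * v x ^ (q/2)) * pd i η x + (q/2) * (η x ^ (q-1) * v x ^ (q/2)) * (η x * (pd i v x / v x)) := by
        rw [hwdef, pd_mul dηq dvq, pd_rpow dη (Or.inr hq.le), pd_rpow dv (Or.inl hvx.ne'), f2, f4]; ring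
      set P := η x ^ (q-1) * v x ^ (q/2) with hP
      have hP2 : P^2 = E*(W*v x) := by rw [hP, mul_pow, f1, f3]
      rw [hpd]
      have s1 : (q*P*pd i η x + q/2*P*(η x*(pd i v x/v x)))^2 ≤ 2*(q*P*pd i η x)^2 + 2*(q/2*P*(η x*(pd i v x/v x)))^2 := by
        nlinarith [sq_nonneg (q*P*pd i η x - q/2*P*(η x*(pd i v x/v x)))]
      have s2 : 2*(q*P*pd i η x)^2 ≤ 2*q^2*K^2*(E*W*v x) := by
        have : pd i η x^2 ≤ K^2 := by rw [← sq_abs]; exact pow_le_pow_left₀ (abs_nonneg _) (H.be x hx i) 2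
        calc 2*(q*P*pd i η x)^2 = 2*q^2*(E*(W*v x))*pd i η x^2 := by rw [← hP2]; ring
          _ ≤ 2*q^2*(E*(W*v x))*K^2 := mul_le_mul_of_nonneg_left this (by positivity)
          _ = _ := by ring
      have s3 : 2*(q/2*P*(η x*(pd i v x/v x)))^2 = q^2/2*(E*W*(η x^2*(pd i v x^2/v x))) := by
        calc _ = q^2/2*P^2*(η x^2*(pd i v x/v x)^2) := by ring
          _ = _ := by rw [hP2]; field_simp
      linarith
    calc ∑ i, pd i w x ^ 2 ≤ ∑ i, (2*q^2*K^2*(E*W*v x) + q^2/2*(E*W*(η x^2*(pd i v x^2/v x)))) := Finset.sum_le_sum fun i _ => hi i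
      _ = 2*n*q^2*K^2*(E*W*v x) + q^2*K/2*(E*W*(η x^2*((∑ i, pd i v x^2)/(K*v x)))) := by
        rw [Finset.sum_add_distrib, Finset.sum_const, Finset.card_fin, nsmul_eq_mul, ← Finset.mul_sum, ← Finset.mul_sum, ← Finset.mul_sum, ← Finset.sum_div]
        have hK0 : K ≠ 0 := by linarith
        field_simp
      _ ≤ _ := by
        simp only [Pi.add_apply]
        have : E*W*v x ≤ E*W*(η x^2*(v x ^ κ*v x^4) + v x ^ κ*v x^3) := mul_le_mul_of_nonneg_left hY (by positivity)
        have := mul_le_mul_of_nonneg_left this (show 0 ≤ 2*n*q^2*K^2 by positivity)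
        linarith)
  have l2 := integral_add (μ := volume.restrict S) (iB.const_mul (2*n*q^2*K^2)) (iA.const_mul (q^2*K/2))
  simp only [Pi.add_apply, integral_const_mul] at l2 key
  rw [l2] at key
  set IB := ∫ x in S, (η x ^ (2*q-2) * v x ^ (q-1)) * (η x^2*(v x ^ κ*v x^4) + v x ^ κ*v x^3) with hIB
  have en2 := mul_le_mul_of_nonneg_left en (show 0 ≤ q^2*K/2 by positivity)
  calc CS * ∫ x in S, ∑ i, pd i w x ^ 2 ≤ CS * (q^2 * (2*n*K^2 + K*enC n K ((n:ℝ) - (κ+1:ℕ)) ((n:ℝ) - κ)) * IB) := by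
        apply mul_le_mul_of_nonneg_left _ hCS
        refine (key.trans (add_le_add_right en2 _)).trans (le_of_eq ?_)
        ring
    _ = _ := by ring
end

section
variable {n : ℕ}

lemma moser_full (hn : 3 ≤ n) {κ : ℕ} (hκ : κ + 2 ≤ n) {p K Vb r r' : ℝ} (hp : ((κ:ℝ)+3)*n/2 < p) (hK : 1 ≤ K) (hVb : 1 ≤ Vb)
    (hr : 0 < r) (hr' : r < r') (x₀ : Fin n → ℝ) : ∃ C : ℝ, ∀ 
    {u g v η : (Fin n → ℝ) → ℝ} {a b c ct : Fin n → (Fin n → ℝ) → ℝ}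
    (hu : ContDiffOn ℝ 2 u (ball x₀ r')) (hg : ContDiffOn ℝ 1 g (ball x₀ r')) (hv : ContDiffOn ℝ 2 v (ball x₀ r'))
    (hct : ∀ l, ContDiffOn ℝ 1 (ct l) (ball x₀ r'))
    (hη : ContDiff ℝ 1 η) (hη0 : ∀ x, 0 ≤ η x) (hη1 : ∀ x, η x ≤ 1) (hηs : tsupport η ⊆ closedBall x₀ r)
    (hvp : ∀ x ∈ ball x₀ r', 0 < v x)
    (H : CoreHyp κ K (closedBall x₀ r) u g v η a b c ct)
    (hV : ∫ x in closedBall x₀ r, v x ^ p ≤ Vb), ∀ x ∈ ball x₀ r, η x ^ 2 * v x ≤ C := by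
  have hn3 : (3:ℝ) ≤ n := by exact_mod_cast hn
  have hκ0 : (0:ℝ) ≤ κ := Nat.cast_nonneg κ
  obtain ⟨CS, hCS, step⟩ := sob_step hn
  set χ : ℝ := (n:ℝ)/(n-2) with hχ
  have hχ0 : 0 < χ := div_pos (by linarith) (by linarith)
  set s : ℝ := p/(κ+3) with hs
  have hsn : (n:ℝ)/2 < s := by rw [hs, lt_div_iff₀ (by linarith)]; linarith
  have hs1 : 1 < s := by linarith
  set s' : ℝ := s/(s-1) with hs'
  have hs'1 : 1 < s' := by rw [hs', one_lt_div (by linarith)]; linarith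
  have hs'χ : s' < χ := by rw [hs', hχ, div_lt_div_iff₀ (by linarith) (by linarith)]; nlinarith
  have hp3 : 1 < p - (κ+3) := by nlinarith
  have hp0 : 0 < p := by linarith
  have hconj : s'.HolderConjugate s := by
    rw [Real.holderConjugate_iff]
    refine ⟨hs'1, ?_⟩
    rw [hs']; field_simp; ring
  have hqs : (p - (κ+3))*s' = p := by
    have h1 : s - 1 ≠ 0 := by linarith
    have h2 : p = s*(κ+3) := by rw [hs]; field_simp
    rw [hs', h2]; field_simp
  set A := 2*n*K^2 + K*enC n K ((n:ℝ) - (κ+1:ℕ)) ((n:ℝ) - κ) with hA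
  set Cit := max 1 (CS * |A| * (2*Vb)) with hCit
  obtain ⟨N, hN1, hN⟩ := moser_seq (χ := χ) (s' := s') (q0 := p - (κ+3)) (C := Cit) (J0 := Vb) hs'1 hs'χ hp3 (le_max_left _ _)
  refine ⟨2*N, ?_⟩
  intro u g v η a b c ct hu hg hv hct hη hη0 hη1 hηs hvp H hV x hx
  set S := closedBall x₀ r with hS
  have hSU : S ⊆ ball x₀ r' := closedBall_subset_ball hr'
  have hSc : IsCompact S := isCompact_closedBall _ _
  have hvc : ContinuousOn v S := hv.continuousOn.mono hSU
  have hηc : ContinuousOn η S := hη.continuous.continuousOn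
  set z : (Fin n → ℝ) → ℝ := fun x => η x ^ 2 * v x with hz
  have hzc : ContinuousOn z S := (hηc.pow 2).mul hvc
  have hz0 : ∀ x ∈ S, 0 ≤ z x := fun x hx => mul_nonneg (sq_nonneg _) (hvp x (hSU hx)).le
  have hzv : ∀ x ∈ S, z x ≤ v x := fun x hx => by
    have := (hvp x (hSU hx)).le
    have h2 : η x ^ 2 ≤ 1 := pow_le_one₀ (hη0 x) (hη1 x)
    exact mul_le_of_le_one_left this h2
  have hzrc : ∀ t : ℝ, 0 ≤ t → ContinuousOn (fun x => z x ^ t) S := fun t ht => hzc.rpow_const fun x _ => Or.inr ht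
  have hvrc : ∀ t : ℝ, 0 ≤ t → ContinuousOn (fun x => v x ^ t) S := fun t ht => hvc.rpow_const fun x _ => Or.inr ht
  have ivp := (hvrc p hp0.le).integrableOn_compact (μ := volume) hSc
  have ht : Filter.Tendsto (fun j : ℕ => (p - (κ+3))*s'*(χ/s')^j) Filter.atTop Filter.atTop := by
    rw [hqs]
    exact (tendsto_pow_atTop_atTop_of_one_lt ((one_lt_div (by linarith)).2 hs'χ)).const_mul_atTop hp0
  refine moser_sup hSc hzc hz0 hN1 ht (fun j => ?_) ?_ (ball_subset_interior_closedBall hx)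
  · rw [hqs]; exact mul_pos hp0 (pow_pos (div_pos hχ0 (by linarith)) _)
  refine hN (fun t => ∫ x in S, z x ^ t) ?_ ?_ ?_
  · intro t; exact setIntegral_nonneg hSc.measurableSet fun x hx => Real.rpow_nonneg (hz0 x hx) _
  · change ∫ x in S, z x ^ ((p - (κ+3))*s') ≤ Vb
    rw [hqs]
    refine le_trans ?_ hV
    exact setIntegral_mono_on ((hzrc p hp0.le).integrableOn_compact hSc) ivp hSc.measurableSet
      fun x hx => Real.rpow_le_rpow (hz0 x hx) (hzv x hx) hp0.le
  · intro q hq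
    change (∫ x in S, z x ^ (q*χ)) ^ (1/χ) ≤ Cit * q^2 * (1 + (∫ x in S, z x ^ (q*s'))^(1/s'))
    set J := (∫ x in S, z x ^ (q*s'))^(1/s') with hJ
    have hJ0 : 0 ≤ J := Real.rpow_nonneg (setIntegral_nonneg hSc.measurableSet fun x hx => Real.rpow_nonneg (hz0 x hx) _) _
    have st := step hκ hr hr' hK hq hu hg hv hct hη hη0 hη1 hηs hvp H
    refine st.trans ?_
    -- bound the integral
    have hol := integral_mul_le_Lp_mul_Lq_of_nonneg (μ := volume.restrict S) hconj (f := fun x => z x ^ q) (g := fun x => v x ^ ((κ:ℝ)+3))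
      (by filter_upwards [ae_restrict_mem hSc.measurableSet] with x hx using Real.rpow_nonneg (hz0 x hx) _)
      (by filter_upwards [ae_restrict_mem hSc.measurableSet] with x hx using Real.rpow_nonneg (hvp x (hSU hx)).le _)
      (memLp_compact hSc (hzrc q (by linarith)) _) (memLp_compact hSc (hvrc _ (by linarith)) _)
    have r1 : ∫ x in S, (z x ^ q)^s' = ∫ x in S, z x ^ (q*s') :=
      setIntegral_congr_fun hSc.measurableSet fun x hx => by rw [← Real.rpow_mul (hz0 x hx)]
    have r2 : ∫ x in S, (v x ^ ((κ:ℝ)+3))^s = ∫ x in S, v x ^ p :=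
      setIntegral_congr_fun hSc.measurableSet fun x hx => by
        rw [← Real.rpow_mul (hvp x (hSU hx)).le, hs]; congr 1; field_simp
    rw [r1, r2, ← hJ] at hol
    have hVs : (∫ x in S, v x ^ p)^(1/s) ≤ Vb := by
      calc (∫ x in S, v x ^ p)^(1/s) ≤ Vb^(1/s) := Real.rpow_le_rpow (setIntegral_nonneg hSc.measurableSet fun x hx => Real.rpow_nonneg (hvp x (hSU hx)).le _) hV (by positivity)
        _ ≤ Vb^(1:ℝ) := Real.rpow_le_rpow_of_exponent_le hVb (by rw [div_le_one (by linarith)]; exact hs1.le)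
        _ = Vb := Real.rpow_one _
    have i1 := ((hzrc q (by linarith)).mul (hvrc ((κ:ℝ)+3) (by linarith))).integrableOn_compact (μ := volume) hSc
    have iv := (hvrc ((κ:ℝ)+3) (by linarith)).integrableOn_compact (μ := volume) hSc
    have hVk : ∫ x in S, v x ^ ((κ:ℝ)+3) ≤ Vb := by
      refine le_trans ?_ hV
      exact setIntegral_mono_on iv ivp hSc.measurableSet fun x hx => Real.rpow_le_rpow_of_exponent_le (H.v1 x hx) (by linarith)
    have hEW : ContinuousOn (fun x => η x ^ (2*q-2) * v x ^ (q-1)) S :=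
      (hηc.rpow_const fun x _ => Or.inr (by linarith)).mul (hvrc _ (by linarith))
    have cB : ContinuousOn (fun x => (η x ^ (2*q-2) * v x ^ (q-1)) * (η x^2*(v x ^ κ*v x^4) + v x ^ κ*v x^3)) S :=
      hEW.mul (((hηc.pow 2).mul ((hvc.pow _).mul (hvc.pow _))).add ((hvc.pow _).mul (hvc.pow _)))
    have key := setIntegral_mono_on (μ := volume) (cB.integrableOn_compact hSc) (iv.add (i1.const_mul 2)) hSc.measurableSet (by
      intro x hx
      have hv1 := H.v1 x hx
      have hvx := hvp x (hSU hx)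
      have hzx := hz0 x hx
      have e1 : η x ^ (2*q-2) * v x ^ (q-1) = z x ^ (q-1) := by
        change _ = (η x ^ 2 * v x) ^ (q-1)
        rw [Real.mul_rpow (by positivity) hvx.le, ← Real.rpow_natCast, ← Real.rpow_mul (hη0 x)]
        congr 2; push_cast; ring
      have e2 : v x ^ ((κ:ℝ)+3) = v x ^ κ * v x ^ 3 := by
        rw [Real.rpow_add hvx, Real.rpow_natCast]; norm_cast
      have e3 : z x ^ q = z x ^ (q-1) * z x := by
        nth_rewrite 3 [← Real.rpow_one (z x)]
        rw [← Real.rpow_add_of_nonneg hzx (by linarith) (by positivity)]; congr 1; ring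
      have e4 : z x ^ (q-1) ≤ 1 + z x ^ q := by
        have hzq : 0 ≤ z x ^ q := Real.rpow_nonneg hzx _
        rcases le_total (z x) 1 with h | h
        · have := Real.rpow_le_one hzx h (show 0 ≤ q-1 by linarith); linarith
        · have := Real.rpow_le_rpow_of_exponent_le h (show q-1 ≤ q by linarith); linarith
      simp only [Pi.add_apply, Pi.mul_apply]
      rw [e1, e2]
      have hV3 : 0 ≤ v x ^ κ * v x ^ 3 := by positivity
      have := mul_le_mul_of_nonneg_right e4 hV3
      calc z x ^ (q-1) * (η x^2*(v x ^ κ*v x^4) + v x ^ κ*v x^3) = z x ^ (q-1) * z x * (v x ^ κ*v x^3) + z x ^ (q-1) * (v x ^ κ*v x^3) := by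
            rw [hz]; ring
        _ ≤ _ := by rw [← e3]; linarith)
    have l2 := integral_add (μ := volume.restrict S) iv (i1.const_mul 2)
    simp only [Pi.add_apply, Pi.mul_apply, integral_const_mul] at l2 key
    rw [l2] at key
    set IB := ∫ x in S, (η x ^ (2*q-2) * v x ^ (q-1)) * (η x^2*(v x ^ κ*v x^4) + v x ^ κ*v x^3) with hIB
    have h3 : IB ≤ 2*Vb*(1+J) := by
      have := mul_le_mul_of_nonneg_left hVs hJ0
      nlinarith
    have hIB0 : 0 ≤ IB := setIntegral_nonneg hSc.measurableSet fun x hx => by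
      have hvx := hvp x (hSU hx)
      have := hη0 x
      positivity
    calc CS * q^2 * A * IB ≤ CS * q^2 * |A| * IB := by gcongr; exact le_abs_self A
      _ ≤ CS * q^2 * |A| * (2*Vb*(1+J)) := by gcongr
      _ = (CS * |A| * (2*Vb)) * q^2 * (1+J) := by ring
      _ ≤ Cit * q^2 * (1+J) := by gcongr; exact le_max_right _ _
end

section
variable {E : Type*} [NormedAddCommGroup E] [NormedSpace ℝ E] [FiniteDimensional ℝ E]

lemma c11_pack {Φ : E → ℝ} {O S : Set E} (hO : IsOpen O) (hΦ : C11On Φ O) (hS : IsCompact S) (hSc : Convex ℝ S) (hSO : S ⊆ O) :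
    ∃ L : ℝ, 1 ≤ L ∧ (∀ y ∈ S, |Φ y| ≤ L) ∧ (∀ y ∈ S, ‖fderiv ℝ Φ y‖ ≤ L) ∧
      (∀ y ∈ S, ∀ y' ∈ S, ‖fderiv ℝ Φ y' - fderiv ℝ Φ y‖ ≤ L * ‖y' - y‖) ∧
      (∀ y ∈ S, ∀ y' ∈ S, |Φ y' - Φ y| ≤ L * ‖y' - y‖) ∧
      (∀ y ∈ S, ∀ y' ∈ S, |Φ y' - Φ y - fderiv ℝ Φ y (y' - y)| ≤ L * ‖y' - y‖^2) := by
  obtain ⟨h1, h2⟩ := hΦ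
  have hll : LocallyLipschitzOn O (fderivWithin ℝ Φ O) := fun x hx => by
    obtain ⟨K, t, ht, hL⟩ := h2 x hx
    exact ⟨K, t, ht, hL⟩
  have hdc : ContinuousOn (fderiv ℝ Φ) S := (h1.continuousOn_fderiv_of_isOpen hO (by norm_num)).mono hSO
  obtain ⟨L1, hL1⟩ := LocallyLipschitzOn.exists_lipschitzOnWith_of_compact hS (hll.mono hSO)
  obtain ⟨L2, hL2⟩ := hS.exists_bound_of_continuousOn (h1.continuousOn.mono hSO)
  obtain ⟨L3, hL3⟩ := hS.exists_bound_of_continuousOn hdc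
  have hlip : ∀ y ∈ S, ∀ y' ∈ S, ‖fderiv ℝ Φ y' - fderiv ℝ Φ y‖ ≤ L1 * ‖y' - y‖ := by
    intro y hy y' hy'
    have := hL1.dist_le_mul y' hy' y hy
    rw [fderivWithin_of_isOpen hO (hSO hy), fderivWithin_of_isOpen hO (hSO hy'), dist_eq_norm, dist_eq_norm] at this
    exact this
  have hdiff : ∀ y ∈ S, DifferentiableAt ℝ Φ y := fun y hy => (h1.contDiffAt (hO.mem_nhds (hSO hy))).differentiableAt (by norm_num)
  set L : ℝ := max (max 1 (L1:ℝ)) (max L2 L3) with hL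
  have b1 : 1 ≤ L := (le_max_left _ _).trans (le_max_left _ _)
  have b2 : (L1:ℝ) ≤ L := (le_max_right _ _).trans (le_max_left _ _)
  have b3 : L2 ≤ L := (le_max_left _ _).trans (le_max_right _ _)
  have b4 : L3 ≤ L := (le_max_right _ _).trans (le_max_right _ _)
  refine ⟨L, b1, fun y hy => (hL2 y hy).trans b3, fun y hy => (hL3 y hy).trans b4, fun y hy y' hy' => (hlip y hy y' hy').trans (by gcongr), ?_, ?_⟩
  · intro y hy y' hy'
    have := hSc.norm_image_sub_le_of_norm_fderiv_le hdiff (fun z hz => (hL3 z hz).trans b4) hy hy'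
    exact this
  · intro y hy y' hy'
    have hseg : segment ℝ y y' ⊆ S := hSc.segment_subset hy hy'
    have := Convex.norm_image_sub_le_of_norm_fderiv_le' (f := Φ) (s := segment ℝ y y') (φ := fderiv ℝ Φ y) (C := L * ‖y' - y‖) (fun z hz => hdiff z (hseg hz))
      (fun z hz => by
        refine (hlip y hy z (hseg hz)).trans ?_
        have h3 : ‖z - y‖ ≤ ‖y' - y‖ := by
          have := norm_sub_le_of_mem_segment hz
          simpa using this
        gcongr) (convex_segment _ _) (left_mem_segment _ _ _) (right_mem_segment _ _ _)
    rw [Real.norm_eq_abs] at this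
    refine this.trans (le_of_eq (by ring))

lemma smooth_lip {N₀ : E → ℝ} {S : Set E} {L : NNReal} (hN : LipschitzOnWith L N₀ S) {δ : ℝ} (hδ : 0 < δ) :
    ∃ N : E → ℝ, ContDiff ℝ 1 N ∧ (∀ y, ‖fderiv ℝ N y‖ ≤ L) ∧ ∀ y ∈ S, |N y - N₀ y| ≤ δ := by
  obtain ⟨f, hf, hfe⟩ := hN.extend_real
  borelize E
  set μ : Measure E := Measure.addHaar
  set ε : ℝ := δ / (L+1) with hε
  have hL0 : (0:ℝ) ≤ L := L.2
  have hε0 : 0 < ε := div_pos hδ (by linarith)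
  let φ : ContDiffBump (0:E) := ⟨ε/2, ε, half_pos hε0, half_lt_self hε0⟩
  have hfc : Continuous f := hf.continuous
  have hli : LocallyIntegrable f μ := hfc.locallyIntegrable
  set N := (convolution (φ.normed μ) f (ContinuousLinearMap.lsmul ℝ ℝ) μ) with hNdef
  have hconv : ∀ x, Integrable (fun t => φ.normed μ t * f (x - t)) μ := fun x => 
    ((φ.contDiff_normed (n := 0)).continuous.mul (hfc.comp (continuous_const.sub continuous_id))).integrable_of_hasCompactSupport
      (φ.hasCompactSupport_normed.mul_right)
  have hNl : LipschitzWith L N := by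
    apply LipschitzWith.of_dist_le_mul
    intro x y
    have e : N x - N y = ∫ t, φ.normed μ t * (f (x-t) - f (y-t)) ∂μ := by
      simp only [hNdef, convolution_def, ContinuousLinearMap.lsmul_apply, smul_eq_mul, mul_sub]
      rw [integral_sub (hconv x) (hconv y)]
    rw [Real.dist_eq, e]
    calc |∫ t, φ.normed μ t * (f (x-t) - f (y-t)) ∂μ| ≤ ∫ t, φ.normed μ t * (L * dist x y) ∂μ := by
          rw [← Real.norm_eq_abs]
          refine norm_integral_le_of_norm_le ((φ.integrable_normed (μ := μ)).mul_const _) (Filter.Eventually.of_forall fun t => ?_)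
          rw [norm_mul, Real.norm_of_nonneg (φ.nonneg_normed t)]
          refine mul_le_mul_of_nonneg_left ?_ (φ.nonneg_normed t)
          have := hf.dist_le_mul (x-t) (y-t)
          rwa [dist_sub_right] at this
      _ = L * dist x y := by rw [integral_mul_const, φ.integral_normed, one_mul]
  refine ⟨N, ?_, ?_, ?_⟩
  · exact_mod_cast φ.hasCompactSupport_normed.contDiff_convolution_left (n := 1) _ φ.contDiff_normed hli
  · intro y; exact norm_fderiv_le_of_lipschitz ℝ hNl
  · intro y hy
    have := φ.dist_normed_convolution_le (μ := μ) (g := f) (x₀ := y) (ε := δ) hfc.aestronglyMeasurable (fun z hz => by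
      refine (hf.dist_le_mul z y).trans ?_
      have hz' : dist z y ≤ ε := (mem_ball.1 hz).le
      calc (L:ℝ) * dist z y ≤ (L+1) * ε := by gcongr; linarith
        _ = δ := by rw [hε]; field_simp)
    rw [Real.dist_eq] at this
    rw [hfe hy]
    exact this
end

section
variable {n : ℕ}

/-- the 1-jet -/
noncomputable def jet (u : (Fin n → ℝ) → ℝ) (x : Fin n → ℝ) : (Fin n → ℝ) × ℝ × (Fin n → ℝ) := (x, u x, grad u x)

lemma grad_contDiffOn {U : Set (Fin n → ℝ)} (hU : IsOpen U) {u : (Fin n → ℝ) → ℝ} (hu : ContDiffOn ℝ 2 u U) :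
    ContDiffOn ℝ 1 (grad u) U :=
  contDiffOn_pi.2 fun i => pd_contDiffOn (m := 1) hU hu (by norm_num) i

lemma jet_contDiffOn {U : Set (Fin n → ℝ)} (hU : IsOpen U) {u : (Fin n → ℝ) → ℝ} (hu : ContDiffOn ℝ 2 u U) :
    ContDiffOn ℝ 1 (jet u) U :=
  contDiffOn_id.prodMk ((hu.of_le (by norm_num)).prodMk (grad_contDiffOn hU hu))

lemma pd_comp_jet {U : Set (Fin n → ℝ)} (hU : IsOpen U) {u : (Fin n → ℝ) → ℝ} (hu : ContDiffOn ℝ 2 u U)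
    {N : ((Fin n → ℝ) × ℝ × (Fin n → ℝ)) → ℝ} {x : Fin n → ℝ} (hx : x ∈ U) (hN : DifferentiableAt ℝ N (jet u x)) (i : Fin n) :
    pd i (fun z => N (jet u z)) x = fderiv ℝ N (jet u x) (Pi.single i 1, pd i u x, fun j => pd i (pd j u) x) := by
  have du : DifferentiableAt ℝ u x := diffAt_of_on hU (hu.of_le (by norm_num)) hx
  have dg : ∀ j, DifferentiableAt ℝ (pd j u) x := fun j => diffAt_of_on hU (pd_contDiffOn (m := 1) hU hu (by norm_num) j) hx
  have hg : HasFDerivAt (grad u) (ContinuousLinearMap.pi fun j => fderiv ℝ (pd j u) x) x :=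
    hasFDerivAt_pi.2 fun j => (dg j).hasFDerivAt
  have hj : HasFDerivAt (jet u) ((ContinuousLinearMap.id ℝ (Fin n → ℝ)).prod ((fderiv ℝ u x).prod (ContinuousLinearMap.pi fun j => fderiv ℝ (pd j u) x))) x :=
    (hasFDerivAt_id x).prodMk (du.hasFDerivAt.prodMk hg)
  have := hN.hasFDerivAt.comp x hj
  change fderiv ℝ (N ∘ jet u) x (Pi.single i 1) = _
  rw [this.fderiv]
  rfl

lemma norm_trip {a : Fin n → ℝ} {t : ℝ} {w : Fin n → ℝ} {B : ℝ} (h0 : 0 ≤ B) (ha : ∀ j, |a j| ≤ B) (ht : |t| ≤ B) (hw : ∀ j, |w j| ≤ B) :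
    ‖((a, t, w) : (Fin n → ℝ) × ℝ × (Fin n → ℝ))‖ ≤ B := by
  rw [Prod.norm_mk, Prod.norm_mk]
  exact max_le ((pi_norm_le_iff_of_nonneg h0).2 ha) (max_le ht ((pi_norm_le_iff_of_nonneg h0).2 hw))

lemma clm_trip (φ : ((Fin n → ℝ) × ℝ × (Fin n → ℝ)) →L[ℝ] ℝ) (a : Fin n → ℝ) (t : ℝ) (w : Fin n → ℝ) :
    φ (a, t, w) = φ (a, t, 0) + ∑ j, w j * φ (0, 0, Pi.single j 1) := by
  have h1 : ((a, t, w) : (Fin n → ℝ) × ℝ × (Fin n → ℝ)) = (a, t, 0) + ∑ j, w j • ((0 : Fin n → ℝ), (0:ℝ), (Pi.single j 1 : Fin n → ℝ)) := by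
    refine Prod.ext ?_ (Prod.ext ?_ ?_)
    · simp [Prod.fst_sum]
    · simp [Prod.fst_sum, Prod.snd_sum]
    · simp only [Prod.snd_add, Prod.snd_sum, Prod.smul_snd, zero_add]
      funext i
      simp [Finset.sum_apply, Pi.single_apply]
  rw [h1, map_add, map_sum]
  simp only [map_smul, smul_eq_mul]

lemma abs_single_le (i j : Fin n) : |(Pi.single i 1 : Fin n → ℝ) j| ≤ 1 := by
  by_cases h : j = i
  · subst h; simp
  · simp [h]

lemma norm_single_one (i : Fin n) : ‖(Pi.single i 1 : Fin n → ℝ)‖ ≤ 1 :=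
  (pi_norm_le_iff_of_nonneg zero_le_one).2 fun j => abs_single_le i j

/-- difference quotient lemmas -/
lemma shift_contDiffOn {U Ω : Set (Fin n → ℝ)} {w : (Fin n → ℝ) → ℝ} {N : WithTop ℕ∞} (hw : ContDiffOn ℝ N w Ω) (e : Fin n → ℝ)
    (hs : ∀ x ∈ U, x + e ∈ Ω) : ContDiffOn ℝ N (fun x => w (x + e)) U :=
  hw.comp (contDiff_id.add contDiff_const).contDiffOn hs

lemma ddq_contDiffOn {U Ω : Set (Fin n → ℝ)} {w : (Fin n → ℝ) → ℝ} {N : WithTop ℕ∞} (hw : ContDiffOn ℝ N w Ω) {l : Fin n} {h : ℝ}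
    (hs : U ⊆ Ω) (hp : ∀ x ∈ U, x + h • (Pi.single l 1 : Fin n → ℝ) ∈ Ω) (hm : ∀ x ∈ U, x - h • (Pi.single l 1 : Fin n → ℝ) ∈ Ω) :
    ContDiffOn ℝ N (ddq l h w) U := by
  unfold ddq
  refine ContDiffOn.div_const ?_ _
  refine ((shift_contDiffOn hw _ hp).sub (contDiffOn_const.mul (hw.mono hs))).add ?_
  simp only [sub_eq_add_neg] at hm ⊢
  exact shift_contDiffOn hw _ hm

lemma pd_ddq {Ω : Set (Fin n → ℝ)} (hΩ : IsOpen Ω) {w : (Fin n → ℝ) → ℝ} (hw : ContDiffOn ℝ 1 w Ω) {l : Fin n} {h : ℝ} {x : Fin n → ℝ}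
    (hx : x ∈ Ω) (hp : x + h • (Pi.single l 1 : Fin n → ℝ) ∈ Ω) (hm : x - h • (Pi.single l 1 : Fin n → ℝ) ∈ Ω) (i : Fin n) :
    pd i (ddq l h w) x = ddq l h (pd i w) x := by
  have d0 := diffAt_of_on hΩ hw hx
  have d1 := diffAt_of_on hΩ hw hp
  have d2 := diffAt_of_on hΩ hw hm
  set e := h • (Pi.single l 1 : Fin n → ℝ) with he
  have f1 : HasFDerivAt (fun z => w (z + e)) (fderiv ℝ w (x+e)) x := by
    have := d1.hasFDerivAt
    exact (hasFDerivAt_comp_add_right e).2 this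
  have f2 : HasFDerivAt (fun z => w (z - e)) (fderiv ℝ w (x-e)) x := by
    exact (hasFDerivAt_comp_sub e).2 d2.hasFDerivAt
  have := ((f1.sub (d0.hasFDerivAt.const_mul 2)).add f2).mul_const ((h^2)⁻¹)
  have e1 : ddq l h w = fun z => (w (z + e) - 2 * w z + w (z - e)) * (h^2)⁻¹ := by
    funext z; unfold ddq; rw [div_eq_mul_inv]
  unfold pd
  rw [e1]
  have h2 := this.fderiv
  simp only [Pi.add_apply, Pi.sub_apply] at h2
  erw [h2]
  simp [ddq, ← he]
  ring
end

section
variable {n : ℕ}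

lemma abs_pd_le_norm (w : (Fin n → ℝ) → ℝ) (x : Fin n → ℝ) (i : Fin n) : |pd i w x| ≤ ‖fderiv ℝ w x‖ := by
  have := (fderiv ℝ w x).le_opNorm (Pi.single i 1)
  have h1 := norm_single_one i
  calc |pd i w x| ≤ ‖fderiv ℝ w x‖ * ‖(Pi.single i 1 : Fin n → ℝ)‖ := this
    _ ≤ ‖fderiv ℝ w x‖ * 1 := by gcongr
    _ = _ := mul_one _

lemma clm_smul_single (φ : (Fin n → ℝ) →L[ℝ] ℝ) (t : ℝ) (l : Fin n) : φ (t • (Pi.single l 1 : Fin n → ℝ)) = t * φ (Pi.single l 1) := by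
  rw [map_smul, smul_eq_mul]

lemma mem_cb {x : Fin n → ℝ} {t h : ℝ} (ht : |t| ≤ h) (l : Fin n) : x + t • (Pi.single l 1 : Fin n → ℝ) ∈ closedBall x h := by
  rw [mem_closedBall, dist_eq_norm, add_sub_cancel_left, norm_smul, Real.norm_eq_abs]
  have := norm_single_one l
  calc |t| * ‖(Pi.single l 1 : Fin n → ℝ)‖ ≤ |t| * 1 := by gcongr
    _ ≤ h := by linarith

/-- along a segment -/
lemma seg_est {w : (Fin n → ℝ) → ℝ} {x : Fin n → ℝ} {h ε : ℝ} (hd : ∀ z ∈ closedBall x h, DifferentiableAt ℝ w z)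
    (hε : ∀ z ∈ closedBall x h, ‖fderiv ℝ w z - fderiv ℝ w x‖ ≤ ε) {s t : ℝ} (hs : |s| ≤ h) (ht : |t| ≤ h) (l : Fin n) :
    |w (x + t • (Pi.single l 1 : Fin n → ℝ)) - w (x + s • (Pi.single l 1 : Fin n → ℝ)) - (t - s) * pd l w x| ≤ ε * |t - s| := by
  have := Convex.norm_image_sub_le_of_norm_fderiv_le' (φ := fderiv ℝ w x) hd hε (convex_closedBall x h) (mem_cb hs l) (mem_cb ht l)
  have e : x + t • (Pi.single l 1 : Fin n → ℝ) - (x + s • (Pi.single l 1 : Fin n → ℝ)) = (t - s) • (Pi.single l 1 : Fin n → ℝ) := by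
    rw [sub_smul]; abel
  rw [e, clm_smul_single, norm_smul, Real.norm_eq_abs, Real.norm_eq_abs] at this
  have hε0 : 0 ≤ ε := (norm_nonneg _).trans (hε x (mem_closedBall_self ((abs_nonneg _).trans hs)))
  refine this.trans ?_
  have := norm_single_one l
  calc ε * (|t - s| * ‖(Pi.single l 1 : Fin n → ℝ)‖) ≤ ε * (|t-s| * 1) := by gcongr
    _ = _ := by ring

lemma ddq_est {u : (Fin n → ℝ) → ℝ} {x : Fin n → ℝ} {h ε : ℝ} (hh : 0 < h) {l : Fin n} (hu : ∀ z ∈ closedBall x h, DifferentiableAt ℝ u z)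
    (hd : ∀ z ∈ closedBall x h, DifferentiableAt ℝ (pd l u) z)
    (hε : ∀ z ∈ closedBall x h, ‖fderiv ℝ (pd l u) z - fderiv ℝ (pd l u) x‖ ≤ ε) :
    |ddq l h u x - pd l (pd l u) x| ≤ 2*ε := by
  set e : Fin n → ℝ := Pi.single l 1 with he
  set D := pd l (pd l u) x with hD
  -- ψ t = u(x+te)+u(x-te) - t^2 D
  have hline : ∀ t, |t| ≤ h → HasDerivAt (fun s : ℝ => u (x + s • e)) (pd l u (x + t • e)) t := by
    intro t ht
    have h1 := (hu _ (mem_cb ht l)).hasFDerivAt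
    have h2 : HasDerivAt (fun s : ℝ => x + s • e) e t := by
      have := ((hasDerivAt_id t).smul_const e).const_add x
      simpa using this
    exact h1.comp_hasDerivAt t h2
  have hψ : ∀ t ∈ Icc (0:ℝ) h, HasDerivWithinAt (fun s : ℝ => u (x + s • e) + u (x + (-s) • e) - s^2 * D)
      (pd l u (x + t • e) - pd l u (x + (-t) • e) - 2*t*D) (Icc 0 h) t := by
    intro t ht
    have ha : |t| ≤ h := by rw [abs_of_nonneg ht.1]; exact ht.2
    have h1 := hline t ha
    have h2 := (hline (-t) (by rwa [abs_neg])).scomp t (hasDerivAt_neg t)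
    have h3 := ((hasDerivAt_pow 2 t).mul_const D)
    have := ((h1.add h2).sub h3).hasDerivWithinAt (s := Icc 0 h)
    refine this.congr_deriv ?_
    simp; ring
  have key := (convex_Icc (0:ℝ) h).norm_image_sub_le_of_norm_hasDerivWithin_le (C := 2*ε*h) hψ (fun t ht => by
    have ha : |t| ≤ h := by rw [abs_of_nonneg ht.1]; exact ht.2
    have := seg_est hd hε (s := -t) (t := t) (by rwa [abs_neg]) ha l
    have hε0 : 0 ≤ ε := (norm_nonneg _).trans (hε x (mem_closedBall_self hh.le))
    rw [Real.norm_eq_abs]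
    have e2 : t - -t = 2*t := by ring
    rw [e2] at this
    refine this.trans ?_
    rw [abs_of_nonneg (by linarith [ht.1])]
    nlinarith [ht.2]) (left_mem_Icc.2 hh.le) (right_mem_Icc.2 hh.le)
  simp only [neg_zero, zero_smul, add_zero, Real.norm_eq_abs, sub_zero, abs_of_pos hh] at key
  have e3 : ddq l h u x - D = (u (x + h • e) + u (x + -h • e) - h ^ 2 * D - (u x + u x - 0 ^ 2 * D))/h^2 := by
    unfold ddq
    rw [neg_smul, ← sub_eq_add_neg, ← he]
    field_simp; ring
  rw [e3, abs_div, abs_of_pos (by positivity : 0 < h^2), div_le_iff₀ (by positivity)]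
  refine key.trans (le_of_eq (by ring))

/-- uniform smallness -/
lemma unif_small {Ω B : Set (Fin n → ℝ)} (hΩ : IsOpen Ω) (hB : IsCompact B) (hBΩ : B ⊆ Ω) {u : (Fin n → ℝ) → ℝ} (hu : ContDiffOn ℝ 2 u Ω) {ε : ℝ} (hε : 0 < ε) :
    ∃ δ > 0, ∀ l : Fin n, ∀ x ∈ B, ∀ z ∈ B, dist z x < δ → ‖fderiv ℝ (pd l u) z - fderiv ℝ (pd l u) x‖ ≤ ε := by
  have h1 : ∀ l : Fin n, ∃ δ > 0, ∀ x ∈ B, ∀ z ∈ B, dist z x < δ → ‖fderiv ℝ (pd l u) z - fderiv ℝ (pd l u) x‖ ≤ ε := by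
    intro l
    have hc : ContinuousOn (fderiv ℝ (pd l u)) B :=
      ((pd_contDiffOn (m := 1) hΩ hu (by norm_num) l).continuousOn_fderiv_of_isOpen hΩ (by norm_num)).mono hBΩ
    obtain ⟨δ, hδ, h⟩ := Metric.uniformContinuousOn_iff.1 (hB.uniformContinuousOn_of_continuous hc) ε hε
    refine ⟨δ, hδ, fun x hx z hz hd => ?_⟩
    have := h z hz x hx hd
    rw [dist_eq_norm] at this
    exact this.le
  choose δ hδ h using h1
  have hne : (insert (1:ℝ) (Finset.univ.image δ)).Nonempty := Finset.insert_nonempty _ _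
  refine ⟨(insert (1:ℝ) (Finset.univ.image δ)).min' hne, ?_, fun l x hx z hz hd => h l x hx z hz (hd.trans_le ?_)⟩
  · rw [gt_iff_lt, Finset.lt_min'_iff]
    intro y hy
    simp only [Finset.mem_insert, Finset.mem_image, Finset.mem_univ, true_and] at hy
    rcases hy with rfl | ⟨l, rfl⟩
    · norm_num
    · exact hδ l
  · exact Finset.min'_le _ _ (by simp)
end

section
variable {n : ℕ}

/-- Gårding for second differences of the augmented matrix, at one point and one direction. -/
lemma garding_dq {κ : ℕ} (hκ : κ + 2 ≤ n) {u g F : (Fin n → ℝ) → ℝ} {Ω : Set (Fin n → ℝ)} (hΩ : IsOpen Ω) (hu : ContDiffOn ℝ 2 u Ω)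
    (hF : ∀ x ∈ Ω, 0 < F x)
    (he : ∀ x ∈ Ω, esymmMat (κ+2) (augM u g x) = F x ^ (κ+2) ∧ GammaPlus (κ+2) (augM u g x))
    {h : ℝ} (hh : 0 < h) {l : Fin n} {x : Fin n → ℝ} (hx : x ∈ Ω) (hp : x + h • (Pi.single l 1 : Fin n → ℝ) ∈ Ω) (hm : x - h • (Pi.single l 1 : Fin n → ℝ) ∈ Ω) :
    ((κ:ℝ)+2) * F x ^ (κ+1) * ddq l h F x + ((n:ℝ) - (κ+1:ℕ)) * esymmMat (κ+1) (augM u g x) * ddq l h g x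
      ≤ ∑ i, ∑ j, newtonT (κ+1) (augM u g x) i j * ddq l h (pd i (pd j u)) x := by
  set T := newtonT (κ+1) (augM u g x) with hT
  set xp := x + h • (Pi.single l 1 : Fin n → ℝ) with hxp
  set xm := x - h • (Pi.single l 1 : Fin n → ℝ) with hxm
  have s0 := augM_symm_on hΩ g hu hx
  have sp := augM_symm_on hΩ g hu hp
  have sm := augM_symm_on hΩ g hu hm
  have g1 := mat_garding (k := κ+1) (by omega) s0 sp (he x hx).2 (he _ hp).2 (hF x hx) (hF _ hp) (he x hx).1 (he _ hp).1
  have g2 := mat_garding (k := κ+1) (by omega) s0 sm (he x hx).2 (he _ hm).2 (hF x hx) (hF _ hm) (he x hx).1 (he _ hm).1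
  have g0 := trace_newton_mul _ s0 (j := κ+1) (by omega)
  rw [(he x hx).1] at g0
  have gt := trace_newton _ s0 (j := κ+1) (by omega)
  rw [← hT] at g1 g2 g0 gt
  have tr : ∀ z ∈ Ω, (T * augM u g z).trace = (∑ i, ∑ j, T i j * pd i (pd j u) z) - g z * T.trace := by
    intro z hz
    simp only [Matrix.trace, Matrix.diag, Matrix.mul_apply, augM_apply]
    rw [Finset.mul_sum, ← Finset.sum_sub_distrib]
    refine Finset.sum_congr rfl fun i _ => ?_
    simp only [mul_sub, Finset.sum_sub_distrib]
    congr 1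
    · refine Finset.sum_congr rfl fun j _ => ?_
      rw [pd_comm hΩ hu hz]
    · simp; ring
  have e1 : ∑ i, ∑ j, T i j * ddq l h (pd i (pd j u)) x = ((∑ i, ∑ j, T i j * pd i (pd j u) xp) - 2 * (∑ i, ∑ j, T i j * pd i (pd j u) x) + (∑ i, ∑ j, T i j * pd i (pd j u) xm))/h^2 := by
    rw [Finset.mul_sum, ← Finset.sum_sub_distrib, ← Finset.sum_add_distrib, Finset.sum_div]
    refine Finset.sum_congr rfl fun i _ => ?_
    rw [Finset.mul_sum, ← Finset.sum_sub_distrib, ← Finset.sum_add_distrib, Finset.sum_div]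
    refine Finset.sum_congr rfl fun j _ => ?_
    unfold ddq; ring
  have t0 := tr x hx
  have tp := tr xp hp
  have tm := tr xm hm
  rw [e1, le_div_iff₀ (by positivity)]
  have d1 : ddq l h F x * h^2 = F xp - 2 * F x + F xm := by unfold ddq; rw [← hxp, ← hxm]; field_simp
  have d2 : ddq l h g x * h^2 = g xp - 2 * g x + g xm := by unfold ddq; rw [← hxp, ← hxm]; field_simp
  have p1 : F x ^ (κ+2) = F x ^ (κ+1) * F x := by ring
  calc _ = ((κ:ℝ)+2) * F x ^ (κ+1) * (ddq l h F x * h^2) + ((n:ℝ) - (κ+1:ℕ)) * esymmMat (κ+1) (augM u g x) * (ddq l h g x * h^2) := by ring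
    _ ≤ _ := by
      rw [d1, d2, ← gt]
      push_cast at g1 g2 g0
      have q1 : (∑ i, ∑ j, T i j * pd i (pd j u) xp) = (T * augM u g xp).trace + g xp * T.trace := by linarith
      have q2 : (∑ i, ∑ j, T i j * pd i (pd j u) xm) = (T * augM u g xm).trace + g xm * T.trace := by linarith
      have q3 : (∑ i, ∑ j, T i j * pd i (pd j u) x) = ((κ:ℝ)+1+1) * F x ^ (κ+2) + g x * T.trace := by linarith
      rw [q1, q2, q3, p1]
      linarith

/-- Taylor for second differences along the jet. -/
lemma taylor_dq {Φ : ((Fin n → ℝ) × ℝ × (Fin n → ℝ)) → ℝ} {𝒦 : Set ((Fin n → ℝ) × ℝ × (Fin n → ℝ))} {L W : ℝ} (hL : 0 ≤ L)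
    (hT : ∀ y ∈ 𝒦, ∀ y' ∈ 𝒦, |Φ y' - Φ y - fderiv ℝ Φ y (y' - y)| ≤ L * ‖y' - y‖^2)
    {u : (Fin n → ℝ) → ℝ} {x : Fin n → ℝ} {h : ℝ} (hh : 0 < h) {l : Fin n} (hx : jet u x ∈ 𝒦)
    (hp : jet u (x + h • (Pi.single l 1 : Fin n → ℝ)) ∈ 𝒦) (hm : jet u (x - h • (Pi.single l 1 : Fin n → ℝ)) ∈ 𝒦)
    (bp : ‖jet u (x + h • (Pi.single l 1 : Fin n → ℝ)) - jet u x‖ ≤ h * W) (bm : ‖jet u (x - h • (Pi.single l 1 : Fin n → ℝ)) - jet u x‖ ≤ h * W) :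
    ddq l h u x * fderiv ℝ Φ (jet u x) (0, 1, 0) + (∑ j, ddq l h (pd j u) x * fderiv ℝ Φ (jet u x) (0, 0, Pi.single j 1)) - 2*L*W^2
      ≤ ddq l h (fun z => Φ (jet u z)) x := by
  set yp := jet u (x + h • (Pi.single l 1 : Fin n → ℝ)) with hyp
  set ym := jet u (x - h • (Pi.single l 1 : Fin n → ℝ)) with hym
  set y := jet u x with hy
  set D := fderiv ℝ Φ y with hD
  have t1 := (abs_le.1 (hT y hx yp hp)).1
  have t2 := (abs_le.1 (hT y hx ym hm)).1
  have b1 : ‖yp - y‖^2 ≤ (h*W)^2 := pow_le_pow_left₀ (norm_nonneg _) bp 2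
  have b2 : ‖ym - y‖^2 ≤ (h*W)^2 := pow_le_pow_left₀ (norm_nonneg _) bm 2
  have b1' := mul_le_mul_of_nonneg_left b1 hL
  have b2' := mul_le_mul_of_nonneg_left b2 hL
  have e0 : (yp - y) + (ym - y) = h^2 • ((0, ddq l h u x, fun j => ddq l h (pd j u) x) : (Fin n → ℝ) × ℝ × (Fin n → ℝ)) := by
    refine Prod.ext ?_ (Prod.ext ?_ ?_)
    · simp [hyp, hym, hy, jet]
    · simp [hyp, hym, hy, jet, ddq]; field_simp; ring
    · funext j; simp [hyp, hym, hy, jet, ddq, grad]; field_simp; ring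
  have e1 : D (yp - y) + D (ym - y) = h^2 * (ddq l h u x * D (0,1,0) + (∑ j, ddq l h (pd j u) x * D (0, 0, Pi.single j 1))) := by
    rw [← map_add, e0, map_smul, smul_eq_mul, clm_trip]
    congr 2
    have : ((0, ddq l h u x, 0) : (Fin n → ℝ) × ℝ × (Fin n → ℝ)) = ddq l h u x • (0, 1, 0) := by simp
    rw [this, map_smul, smul_eq_mul]
  have e2 : ddq l h (fun z => Φ (jet u z)) x = ((Φ yp - Φ y) + (Φ ym - Φ y))/h^2 := by
    change (Φ yp - 2 * Φ y + Φ ym)/h^2 = _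
    congr 1; ring
  rw [e2, le_div_iff₀ (by positivity)]
  have : (ddq l h u x * D (0, 1, 0) + (∑ j, ddq l h (pd j u) x * D (0, 0, Pi.single j 1)) - 2*L*W^2) * h^2 = D (yp - y) + D (ym - y) - 2*(L*(h*W)^2) := by rw [e1]; ring
  rw [this]
  linarith
end

section
variable {n : ℕ}

structure Pack {E : Type*} [NormedAddCommGroup E] [NormedSpace ℝ E] (Φ : E → ℝ) (S : Set E) (L : ℝ) : Prop where
  b0 : ∀ y ∈ S, |Φ y| ≤ L
  b1 : ∀ y ∈ S, ‖fderiv ℝ Φ y‖ ≤ L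
  l1 : ∀ y ∈ S, ∀ y' ∈ S, ‖fderiv ℝ Φ y' - fderiv ℝ Φ y‖ ≤ L * ‖y' - y‖
  l0 : ∀ y ∈ S, ∀ y' ∈ S, |Φ y' - Φ y| ≤ L * ‖y' - y‖
  t2 : ∀ y ∈ S, ∀ y' ∈ S, |Φ y' - Φ y - fderiv ℝ Φ y (y' - y)| ≤ L * ‖y' - y‖^2

structure Sol (κ : ℕ) (Ω B : Set (Fin n → ℝ)) (𝒦 : Set ((Fin n → ℝ) × ℝ × (Fin n → ℝ)))
    (f H : ((Fin n → ℝ) × ℝ × (Fin n → ℝ)) → ℝ) (L m K1 : ℝ) (u : (Fin n → ℝ) → ℝ) : Prop where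
  hn : 3 ≤ n
  hκ : κ + 2 ≤ n
  hΩ : IsOpen Ω
  hB : IsCompact B
  hBΩ : B ⊆ Ω
  hL : 1 ≤ L
  hm : 0 < m
  hK1 : 0 ≤ K1
  pf : Pack f 𝒦 L
  pH : Pack H 𝒦 L
  df : ∀ x ∈ Ω, DifferentiableAt ℝ f (jet u x)
  cH : ContDiffOn ℝ 1 (fun z => H (jet u z)) Ω
  dH : ∀ x ∈ Ω, DifferentiableAt ℝ H (jet u x)
  fm : ∀ y ∈ 𝒦, m ≤ f y
  fp : ∀ x ∈ Ω, 0 < f (jet u x)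
  hu : ContDiffOn ℝ 2 u Ω
  he : ∀ x ∈ Ω, esymmMat (κ+2) (augM u (fun z => H (jet u z)) x) = f (jet u x) ^ (κ+2) ∧ GammaPlus (κ+2) (augM u (fun z => H (jet u z)) x)
  jm : ∀ x ∈ B, jet u x ∈ 𝒦
  bu : ∀ x ∈ B, ∀ i, |pd i u x| ≤ K1

/-- the smoothed Laplacian -/
noncomputable def vf (u : (Fin n → ℝ) → ℝ) (L h : ℝ) (x : Fin n → ℝ) : ℝ := (∑ l, ddq l h u x) + ((n+1)*L+3)

lemma norm_fderiv_le_sum (w : (Fin n → ℝ) → ℝ) (x : Fin n → ℝ) {C : ℝ} (hC : 0 ≤ C) (h : ∀ i, |pd i w x| ≤ C) : ‖fderiv ℝ w x‖ ≤ n * C := by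
  refine ContinuousLinearMap.opNorm_le_bound _ (by positivity) fun y => ?_
  rw [fderiv_eq_sum_pd, Real.norm_eq_abs]
  calc |∑ i, y i * pd i w x| ≤ ∑ i, |y i * pd i w x| := Finset.abs_sum_le_sum_abs _ _
    _ ≤ ∑ i : Fin n, ‖y‖ * C := Finset.sum_le_sum fun i _ => by
        rw [abs_mul]; exact mul_le_mul (norm_le_pi_norm y i) (h i) (abs_nonneg _) (norm_nonneg _)
    _ = n * C * ‖y‖ := by rw [Finset.sum_const, Finset.card_fin, nsmul_eq_mul]; ring

namespace Sol
variable {κ : ℕ} {Ω B : Set (Fin n → ℝ)} {𝒦 : Set ((Fin n → ℝ) × ℝ × (Fin n → ℝ))}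
    {f H : ((Fin n → ℝ) × ℝ × (Fin n → ℝ)) → ℝ} {L m K1 : ℝ} {u : (Fin n → ℝ) → ℝ}

lemma base (S : Sol κ Ω B 𝒦 f H L m K1 u) {x : Fin n → ℝ} (hx : x ∈ B) :
    0 < (augM u (fun z => H (jet u z)) x).trace ∧ (augM u (fun z => H (jet u z)) x).trace ≤ lapl u x + n*L ∧
    ∀ i j, |pd i (pd j u) x| ≤ lapl u x + (n+1)*L := by
  have hxΩ := S.hBΩ hx
  have sy := augM_symm_on S.hΩ (fun z => H (jet u z)) S.hu hxΩ
  have gm := (S.he x hxΩ).2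
  have hn := S.hn
  have hg := abs_le.1 (S.pH.b0 _ (S.jm x hx))
  have tr : (augM u (fun z => H (jet u z)) x).trace = lapl u x - n * H (jet u x) := by
    simp [Matrix.trace, Matrix.diag, augM_apply, lapl]
  have t1 : (augM u (fun z => H (jet u z)) x).trace ≤ lapl u x + n*L := by
    rw [tr]
    have : (n:ℝ) * (-L) ≤ n * H (jet u x) := mul_le_mul_of_nonneg_left hg.1 (by positivity)
    linarith
  refine ⟨?_, t1, ?_⟩
  · have := gm 1 le_rfl (by omega)
    rwa [esymm_one (by omega)] at this
  · intro i j
    have e := mat_entry_le S.hκ (by omega) sy gm i j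
    rw [augM_apply] at e
    have h2 : |H (jet u x) * (if i = j then 1 else 0)| ≤ L := by
      split_ifs
      · rw [mul_one]; exact abs_le.2 hg
      · rw [mul_zero, abs_zero]; linarith [S.hL]
    have h3 : |pd i (pd j u) x| ≤ |pd i (pd j u) x - H (jet u x) * (if i = j then 1 else 0)| + |H (jet u x) * (if i = j then 1 else 0)| := by
      have := abs_add_le (pd i (pd j u) x - H (jet u x) * (if i = j then 1 else 0)) (H (jet u x) * (if i = j then 1 else 0))
      rwa [sub_add_cancel] at this
    have : ((n:ℝ)+1)*L = n*L + L := by ring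
    linarith

/-- for small h the smoothed Laplacian is comparable and jets vary slowly -/
lemma small (S : Sol κ Ω B 𝒦 f H L m K1 u) : ∃ h0 > 0, ∀ h, 0 < h → h < h0 → ∀ x, closedBall x h ⊆ B →
    |vf u L h x - (lapl u x + ((n+1)*L+3))| ≤ 1 ∧
    (∀ t, |t| = h → ∀ l, ‖jet u (x + t • (Pi.single l 1 : Fin n → ℝ)) - jet u x‖ ≤ h * ((n*K1+1) * vf u L h x)) := by
  have hn := S.hn
  have hn0 : (0:ℝ) < n := by exact_mod_cast (by omega : 0 < n)
  have hn1 : (1:ℝ) ≤ n := by exact_mod_cast (by omega : 1 ≤ n)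
  obtain ⟨δ, hδ, hu⟩ := unif_small S.hΩ S.hB S.hBΩ S.hu (ε := 1/(2*n)) (by positivity)
  refine ⟨δ, hδ, fun h hh hhδ x hxB => ?_⟩
  have hx : x ∈ B := hxB (mem_closedBall_self hh.le)
  have hB := S.base hx
  have du : ∀ z ∈ closedBall x h, DifferentiableAt ℝ u z := fun z hz => diffAt_of_on S.hΩ (S.hu.of_le (by norm_num)) (S.hBΩ (hxB hz))
  have dp : ∀ l, ∀ z ∈ closedBall x h, DifferentiableAt ℝ (pd l u) z := fun l z hz =>
    diffAt_of_on S.hΩ (pd_contDiffOn (m := 1) S.hΩ S.hu (by norm_num) l) (S.hBΩ (hxB hz))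
  have he : ∀ l, ∀ z ∈ closedBall x h, ‖fderiv ℝ (pd l u) z - fderiv ℝ (pd l u) x‖ ≤ 1/(2*n) := fun l z hz =>
    hu l x hx z (hxB hz) ((mem_closedBall.1 hz).trans_lt hhδ)
  have hv : |vf u L h x - (lapl u x + ((n+1)*L+3))| ≤ 1 := by
    have : vf u L h x - (lapl u x + ((n+1)*L+3)) = ∑ l, (ddq l h u x - pd l (pd l u) x) := by
      rw [Finset.sum_sub_distrib]; unfold vf lapl; ring
    rw [this]
    calc |∑ l, (ddq l h u x - pd l (pd l u) x)| ≤ ∑ l, |ddq l h u x - pd l (pd l u) x| := Finset.abs_sum_le_sum_abs _ _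
      _ ≤ ∑ l : Fin n, 2*(1/(2*(n:ℝ))) := Finset.sum_le_sum fun l _ => ddq_est hh du (dp l) (he l)
      _ = 1 := by rw [Finset.sum_const, Finset.card_fin, nsmul_eq_mul]; field_simp
  refine ⟨hv, ?_⟩
  intro t ht l
  have hv1 := (abs_le.1 hv).1
  have hLn : 0 ≤ ((n:ℝ)+1)*L := by have := S.hL; positivity
  have hv3 : 2 ≤ vf u L h x := by
    have := hB.2.2 l l
    have := (abs_nonneg _).trans this
    linarith
  have hK1 := S.hK1
  set v := vf u L h x with hvd
  have hb0 : 0 ≤ (n*K1+1)*v := by positivity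
  have hvb : v ≤ (n*K1+1)*v := by nlinarith [mul_nonneg hn0.le hK1]
  have htl : x + t • (Pi.single l 1 : Fin n → ℝ) ∈ closedBall x h := mem_cb ht.le l
  have e1 : jet u (x + t • (Pi.single l 1 : Fin n → ℝ)) - jet u x = (t • (Pi.single l 1 : Fin n → ℝ), u (x + t • (Pi.single l 1 : Fin n → ℝ)) - u x,
      fun j => pd j u (x + t • (Pi.single l 1 : Fin n → ℝ)) - pd j u x) := by
    refine Prod.ext ?_ (Prod.ext ?_ ?_)
    · simp [jet]
    · simp [jet]
    · funext j; simp [jet, grad]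
  rw [e1]
  refine norm_trip (by positivity) ?_ ?_ ?_
  · intro j
    rw [Pi.smul_apply, smul_eq_mul, abs_mul, ht]
    have := abs_single_le l j
    exact mul_le_mul_of_nonneg_left (by linarith) hh.le
  · have := (convex_closedBall x h).norm_image_sub_le_of_norm_fderiv_le (C := n*K1) du (fun z hz => norm_fderiv_le_sum u z hK1 (S.bu z (hxB hz))) (mem_closedBall_self hh.le) htl
    rw [Real.norm_eq_abs] at this
    have h4 : ‖x + t • (Pi.single l 1 : Fin n → ℝ) - x‖ ≤ h := by rw [← dist_eq_norm]; exact htl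
    calc _ ≤ n*K1 * ‖x + t • (Pi.single l 1 : Fin n → ℝ) - x‖ := this
      _ ≤ n*K1*h := by gcongr
      _ = h * (n*K1*1) := by ring
      _ ≤ h * ((n*K1+1)*v) := by
        have : 0 ≤ n*K1 := by positivity
        apply mul_le_mul_of_nonneg_left _ hh.le
        nlinarith
  · intro j
    have := seg_est (dp j) (he j) (s := 0) (t := t) (by simpa using hh.le) ht.le l
    rw [zero_smul, add_zero, sub_zero, ht] at this
    have hb := hB.2.2 l j
    have h5 : |t * pd l (pd j u) x| ≤ h * (v - 2) := by
      rw [abs_mul, ht]; apply mul_le_mul_of_nonneg_left _ hh.le; linarith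
    have h6 : 1/(2*(n:ℝ)) ≤ 1 := by rw [div_le_one (by positivity)]; linarith
    have h7 := abs_add_le (pd j u (x + t • (Pi.single l 1 : Fin n → ℝ)) - pd j u x - t * pd l (pd j u) x) (t * pd l (pd j u) x)
    rw [sub_add_cancel] at h7
    have h8 : 1/(2*(n:ℝ))*h ≤ 1*h := by gcongr
    calc _ ≤ 1*h + h*(v-2) := by linarith
      _ ≤ h * v := by nlinarith
      _ ≤ _ := by gcongr
end Sol
end

section
variable {n : ℕ}

lemma sub_as_add (x : Fin n → ℝ) (h : ℝ) (l : Fin n) : x - h • (Pi.single l 1 : Fin n → ℝ) = x + (-h) • (Pi.single l 1 : Fin n → ℝ) := by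
  rw [neg_smul, sub_eq_add_neg]

namespace Sol
variable {κ : ℕ} {Ω B U : Set (Fin n → ℝ)} {𝒦 : Set ((Fin n → ℝ) × ℝ × (Fin n → ℝ))}
    {f H : ((Fin n → ℝ) × ℝ × (Fin n → ℝ)) → ℝ} {L m K1 h : ℝ} {u : (Fin n → ℝ) → ℝ}

lemma pB (hh : 0 < h) (hUB : ∀ z ∈ U, closedBall z h ⊆ B) {x : Fin n → ℝ} (hx : x ∈ U) (l : Fin n) :
   x ∈ B ∧ x + h • (Pi.single l 1 : Fin n → ℝ) ∈ B ∧ x - h • (Pi.single l 1 : Fin n → ℝ) ∈ B := by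
  refine ⟨hUB x hx (mem_closedBall_self hh.le), hUB x hx (mem_cb (by rw [abs_of_pos hh]) l), ?_⟩
  rw [sub_as_add]; exact hUB x hx (mem_cb (by rw [abs_neg, abs_of_pos hh]) l)

lemma vf_cd (S : Sol κ Ω B 𝒦 f H L m K1 u) (hh : 0 < h) (hUB : ∀ z ∈ U, closedBall z h ⊆ B) : ContDiffOn ℝ 2 (vf u L h) U := by
  unfold vf
  refine ContDiffOn.add (ContDiffOn.sum fun l _ => ddq_contDiffOn S.hu ?_ ?_ ?_) contDiffOn_const
  · exact fun x hx => S.hBΩ (pB hh hUB hx l).1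
  · exact fun x hx => S.hBΩ (pB hh hUB hx l).2.1
  · exact fun x hx => S.hBΩ (pB hh hUB hx l).2.2

lemma pd_vf (S : Sol κ Ω B 𝒦 f H L m K1 u) (hU : IsOpen U) (hh : 0 < h) (hUB : ∀ z ∈ U, closedBall z h ⊆ B) {x : Fin n → ℝ} (hx : x ∈ U) (j : Fin n) :
    pd j (vf u L h) x = ∑ l, ddq l h (pd j u) x := by
  have hu1 : ContDiffOn ℝ 1 u Ω := S.hu.of_le (by norm_num)
  have hd : ∀ l : Fin n, DifferentiableAt ℝ (ddq l h u) x := fun l => diffAt_of_on hU (ddq_contDiffOn hu1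
    (fun x hx => S.hBΩ (pB hh hUB hx l).1) (fun x hx => S.hBΩ (pB hh hUB hx l).2.1) (fun x hx => S.hBΩ (pB hh hUB hx l).2.2)) hx
  unfold vf
  rw [pd_add (DifferentiableAt.fun_sum fun l _ => hd l) (differentiableAt_const _), pd_sum fun l _ => hd l]
  have : pd j (fun _ : Fin n → ℝ => ((n:ℝ)+1)*L+3) x = 0 := by simp [pd]
  rw [this, add_zero]
  exact Finset.sum_congr rfl fun l _ => pd_ddq S.hΩ hu1 (S.hBΩ (pB hh hUB hx l).1) (S.hBΩ (pB hh hUB hx l).2.1) (S.hBΩ (pB hh hUB hx l).2.2) j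

lemma pd_pd_vf (S : Sol κ Ω B 𝒦 f H L m K1 u) (hU : IsOpen U) (hh : 0 < h) (hUB : ∀ z ∈ U, closedBall z h ⊆ B) {x : Fin n → ℝ} (hx : x ∈ U) (i j : Fin n) :
    pd i (pd j (vf u L h)) x = ∑ l, ddq l h (pd i (pd j u)) x := by
  have hp1 : ContDiffOn ℝ 1 (pd j u) Ω := pd_contDiffOn (m := 1) S.hΩ S.hu (by norm_num) j
  have hev : pd j (vf u L h) =ᶠ[nhds x] fun z => ∑ l, ddq l h (pd j u) z := by
    filter_upwards [hU.mem_nhds hx] with z hz using S.pd_vf hU hh hUB hz j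
  rw [pd_congr hev]
  have hd : ∀ l : Fin n, DifferentiableAt ℝ (ddq l h (pd j u)) x := fun l => diffAt_of_on hU (ddq_contDiffOn hp1
    (fun x hx => S.hBΩ (pB hh hUB hx l).1) (fun x hx => S.hBΩ (pB hh hUB hx l).2.1) (fun x hx => S.hBΩ (pB hh hUB hx l).2.2)) hx
  rw [pd_sum fun l _ => hd l]
  exact Finset.sum_congr rfl fun l _ => pd_ddq S.hΩ hp1 (S.hBΩ (pB hh hUB hx l).1) (S.hBΩ (pB hh hUB hx l).2.1) (S.hBΩ (pB hh hUB hx l).2.2) i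

lemma taylor_sum (S : Sol κ Ω B 𝒦 f H L m K1 u) (hU : IsOpen U) (hh : 0 < h) (hUB : ∀ z ∈ U, closedBall z h ⊆ B)
    {Φ : ((Fin n → ℝ) × ℝ × (Fin n → ℝ)) → ℝ} (pΦ : Pack Φ 𝒦 L)
    {x : Fin n → ℝ} (hx : x ∈ U) (hv1 : 1 ≤ vf u L h x)
    (hsm : ∀ t, |t| = h → ∀ l, ‖jet u (x + t • (Pi.single l 1 : Fin n → ℝ)) - jet u x‖ ≤ h * ((n*K1+1) * vf u L h x)) :
    (∑ j, fderiv ℝ Φ (jet u x) (0, 0, Pi.single j 1) * pd j (vf u L h) x) - ((1+((n+1)*L+3))*L + 2*n*L*(n*K1+1)^2) * vf u L h x ^ 2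
      ≤ ∑ l, ddq l h (fun z => Φ (jet u z)) x := by
  have hL := S.hL
  have hxB : ∀ l, _ := fun l => pB hh hUB hx l
  have hn := S.hn
  have hxb : x ∈ B := (hxB ⟨0, by omega⟩).1
  set v := vf u L h x with hv
  set D := fderiv ℝ Φ (jet u x) with hD
  have tl : ∀ l, _ := fun l : Fin n => taylor_dq (W := (n*K1+1)*v) (by linarith) pΦ.t2 hh (S.jm x hxb) (S.jm _ (hxB l).2.1) (S.jm _ (hxB l).2.2)
    (hsm h (abs_of_pos hh) l) (by rw [sub_as_add]; exact hsm (-h) (by rw [abs_neg, abs_of_pos hh]) l)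
  refine le_trans ?_ (Finset.sum_le_sum fun l _ => tl l)
  rw [Finset.sum_sub_distrib, Finset.sum_add_distrib, Finset.sum_const, Finset.card_fin, nsmul_eq_mul, ← Finset.sum_mul, Finset.sum_comm]
  have e1 : ∑ j, ∑ l, ddq l h (pd j u) x * D (0,0,Pi.single j 1) = ∑ j, D (0, 0, Pi.single j 1) * pd j (vf u L h) x := by
    refine Finset.sum_congr rfl fun j _ => ?_
    rw [← Finset.sum_mul, S.pd_vf hU hh hUB hx j, mul_comm]
  have e2 : ∑ l, ddq l h u x = v - ((n+1)*L+3) := by rw [hv, vf]; ring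
  rw [e1, e2]
  have hD1 : |D (0,1,0)| ≤ L := by
    have h1 := D.le_opNorm (0,1,0)
    have h2 : ‖((0,1,0) : (Fin n → ℝ) × ℝ × (Fin n → ℝ))‖ ≤ 1 := norm_trip zero_le_one (by simp) (by simp) (by simp)
    calc |D (0,1,0)| ≤ ‖D‖ * ‖((0,1,0) : (Fin n → ℝ) × ℝ × (Fin n → ℝ))‖ := h1
      _ ≤ L * 1 := mul_le_mul (pΦ.b1 _ (S.jm x hxb)) h2 (norm_nonneg _) (by linarith)
      _ = L := mul_one L
  have hc0 : 0 ≤ ((n:ℝ)+1)*L+3 := by positivity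
  have e3 : -((v + ((n+1)*L+3))*L) ≤ (v - ((n+1)*L+3)) * D (0,1,0) := by
    have : |(v - ((n+1)*L+3)) * D (0,1,0)| ≤ (v + ((n+1)*L+3))*L := by
      rw [abs_mul]
      refine mul_le_mul ?_ hD1 (abs_nonneg _) (by linarith)
      rw [abs_le]; constructor <;> linarith
    exact (abs_le.1 this).1
  have e4 : (v + ((n+1)*L+3))*L ≤ (1 + ((n+1)*L+3))*L*v^2 := by
    have hv2 : v ≤ v^2 := by nlinarith
    have hv3 : ((n+1)*L+3) ≤ ((n+1)*L+3) * v^2 := by nlinarith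
    have : v + ((n+1)*L+3) ≤ (1 + ((n+1)*L+3))*v^2 := by linarith
    calc _ ≤ (1 + ((n+1)*L+3))*v^2 * L := by gcongr
      _ = _ := by ring
  have e5 : (n:ℝ) * (2*L*((n*K1+1)*v)^2) = 2*n*L*(n*K1+1)^2*v^2 := by ring
  rw [e5]
  linarith

lemma main_ineq (S : Sol κ Ω B 𝒦 f H L m K1 u) (hU : IsOpen U) (hh : 0 < h) (hUB : ∀ z ∈ U, closedBall z h ⊆ B)
    {x : Fin n → ℝ} (hx : x ∈ U) (hv : |vf u L h x - (lapl u x + ((n+1)*L+3))| ≤ 1)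
    (hsm : ∀ t, |t| = h → ∀ l, ‖jet u (x + t • (Pi.single l 1 : Fin n → ℝ)) - jet u x‖ ≤ h * ((n*K1+1) * vf u L h x)) :
    ((n:ℝ) - (κ+1:ℕ)) * esymmMat (κ+1) (augM u (fun z => H (jet u z)) x) * (∑ i, fderiv ℝ H (jet u x) (0, 0, Pi.single i 1) * pd i (vf u L h) x)
      + (∑ i, ((κ:ℝ)+2) * f (jet u x) ^ (κ+1) * fderiv ℝ f (jet u x) (0, 0, Pi.single i 1) * pd i (vf u L h) x)
      - ((((κ:ℝ)+2)*L^(κ+1) + n) * ((1+((n+1)*L+3))*L + 2*n*L*(n*K1+1)^2)) * (vf u L h x ^ κ * vf u L h x ^ 3)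
      ≤ ∑ i, ∑ l, newtonT (κ+1) (augM u (fun z => H (jet u z)) x) i l * pd i (pd l (vf u L h)) x := by
  have hn := S.hn
  have hκ := S.hκ
  have hL := S.hL
  have hxB : ∀ l, _ := fun l => pB hh hUB hx l
  have hxb : x ∈ B := (hxB ⟨0, by omega⟩).1
  have hxΩ := S.hBΩ hxb
  obtain ⟨b1, b2, b3⟩ := S.base hxb
  have hv' := (abs_le.1 hv).1
  have hv1 : 1 ≤ vf u L h x := by linarith
  have htv : (augM u (fun z => H (jet u z)) x).trace ≤ vf u L h x := by
    have : ((n:ℝ)+1)*L = n*L + L := by ring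
    linarith
  set v := vf u L h x with hvd
  set F := f (jet u x) with hF
  have hF0 : 0 < F := S.fp x hxΩ
  have hFL : F ≤ L := (abs_le.1 (S.pf.b0 _ (S.jm x hxb))).2
  set E := ((1+((n+1)*L+3))*L + 2*n*L*(n*K1+1)^2) with hE
  have hE0 : 0 ≤ E := by have := S.hK1; positivity
  have sy := augM_symm_on S.hΩ (fun z => H (jet u z)) S.hu hxΩ
  obtain ⟨σ0, σ1⟩ := mat_esymm_le S.hκ sy (S.he x hxΩ).2 (by omega) (j := κ+1) (by omega)
  set σ := esymmMat (κ+1) (augM u (fun z => H (jet u z)) x) with hσ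
  have hσv : σ ≤ v^(κ+1) := σ1.trans (pow_le_pow_left₀ b1.le htv _)
  have ga : ∀ l, _ := fun l : Fin n => garding_dq S.hκ (F := fun z => f (jet u z)) (g := fun z => H (jet u z)) S.hΩ S.hu S.fp S.he hh hxΩ (S.hBΩ (hxB l).2.1) (S.hBΩ (hxB l).2.2)
  have gs := Finset.sum_le_sum (s := Finset.univ) fun l _ => ga l
  rw [Finset.sum_add_distrib, ← Finset.mul_sum, ← Finset.mul_sum] at gs
  have e1 : ∑ l, ∑ i, ∑ j, newtonT (κ+1) (augM u (fun z => H (jet u z)) x) i j * ddq l h (pd i (pd j u)) x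
     = ∑ i, ∑ j, newtonT (κ+1) (augM u (fun z => H (jet u z)) x) i j * pd i (pd j (vf u L h)) x := by
    rw [Finset.sum_comm]
    refine Finset.sum_congr rfl fun i _ => ?_
    rw [Finset.sum_comm]
    refine Finset.sum_congr rfl fun j _ => ?_
    rw [← Finset.mul_sum, S.pd_pd_vf hU hh hUB hx]
  rw [e1] at gs
  refine le_trans ?_ gs
  have t1 := S.taylor_sum hU hh hUB S.pf hx hv1 hsm
  have t2 := S.taylor_sum hU hh hUB S.pH hx hv1 hsm
  rw [← hvd, ← hE] at t1 t2
  have hmm : 0 ≤ (n:ℝ) - (κ+1:ℕ) := by rw [sub_nonneg]; exact_mod_cast (by omega : κ+1 ≤ n)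
  have c1 : 0 ≤ ((κ:ℝ)+2) * F^(κ+1) := by positivity
  have c2 : 0 ≤ ((n:ℝ) - (κ+1:ℕ)) * σ := mul_nonneg hmm σ0.le
  have t1' := mul_le_mul_of_nonneg_left t1 c1
  have t2' := mul_le_mul_of_nonneg_left t2 c2
  have e2 : ∑ i, ((κ:ℝ)+2) * F ^ (κ+1) * fderiv ℝ f (jet u x) (0, 0, Pi.single i 1) * pd i (vf u L h) x
     = ((κ:ℝ)+2) * F ^ (κ+1) * ∑ i, fderiv ℝ f (jet u x) (0, 0, Pi.single i 1) * pd i (vf u L h) x := by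
    rw [Finset.mul_sum]; exact Finset.sum_congr rfl fun i _ => by ring
  rw [e2]
  have w1 : v^2 ≤ v^κ*v^3 := by
    rw [← pow_add]; exact pow_le_pow_right₀ hv1 (by omega)
  have w2 : ((κ:ℝ)+2) * F^(κ+1) * (E*v^2) ≤ ((κ:ℝ)+2)*L^(κ+1)*E*(v^κ*v^3) := by
    calc _ ≤ ((κ:ℝ)+2) * L^(κ+1) * (E*(v^κ*v^3)) := by gcongr
      _ = _ := by ring
  have w3 : ((n:ℝ) - (κ+1:ℕ)) * σ * (E*v^2) ≤ n*E*(v^κ*v^3) := by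
    calc _ ≤ (n:ℝ) * v^(κ+1) * (E*v^2) := by
          gcongr
          rw [sub_le_self_iff]; positivity
      _ = _ := by ring
  change _ ≤ ((κ:ℝ)+2) * F^(κ+1) * _ + _
  rw [mul_sub] at t1' t2'
  linarith
end Sol
end

section
variable {n : ℕ}

/-- lower order coefficient in the gradient of `H[u]` -/
noncomputable def cfun (H : ((Fin n → ℝ) × ℝ × (Fin n → ℝ)) → ℝ) (i : Fin n) (y : (Fin n → ℝ) × ℝ × (Fin n → ℝ)) : ℝ :=
  fderiv ℝ H y (Pi.single i 1, y.2.2 i, 0) + H y * fderiv ℝ H y (0, 0, Pi.single i 1)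

lemma clm_bd {φ : ((Fin n → ℝ) × ℝ × (Fin n → ℝ)) →L[ℝ] ℝ} {A : ℝ} {w : (Fin n → ℝ) × ℝ × (Fin n → ℝ)} {D : ℝ}
    (h : ‖φ‖ ≤ A) (hw : ‖w‖ ≤ D) : |φ w| ≤ A * D :=
  (φ.le_opNorm w).trans (mul_le_mul h hw (norm_nonneg _) ((norm_nonneg _).trans h))

lemma trip1 (i : Fin n) {t K1 : ℝ} (hK : 0 ≤ K1) (ht : |t| ≤ K1) : ‖((Pi.single i 1, t, 0) : (Fin n → ℝ) × ℝ × (Fin n → ℝ))‖ ≤ 1 + K1 :=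
  norm_trip (by linarith) (fun j => (abs_single_le i j).trans (by linarith)) (by linarith) (fun j => by simp; linarith)

lemma trip2 (i : Fin n) : ‖((0, 0, Pi.single i 1) : (Fin n → ℝ) × ℝ × (Fin n → ℝ))‖ ≤ 1 :=
  norm_trip zero_le_one (fun j => by simp) (by simp) (fun j => abs_single_le i j)

lemma cfun_bd {H : ((Fin n → ℝ) × ℝ × (Fin n → ℝ)) → ℝ} {𝒦 : Set ((Fin n → ℝ) × ℝ × (Fin n → ℝ))} {L K1 : ℝ} (hL : 1 ≤ L) (hK : 0 ≤ K1)
    (P : Pack H 𝒦 L) (h𝒦 : ∀ y ∈ 𝒦, ∀ i, |y.2.2 i| ≤ K1) (i : Fin n) {y : (Fin n → ℝ) × ℝ × (Fin n → ℝ)} (hy : y ∈ 𝒦) :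
    |cfun H i y| ≤ L*(1+K1) + L^2 := by
  unfold cfun
  refine (abs_add_le _ _).trans (add_le_add (clm_bd (P.b1 y hy) (trip1 i hK (h𝒦 y hy i))) ?_)
  rw [abs_mul]
  have h2 := clm_bd (P.b1 y hy) (trip2 i)
  calc _ ≤ L * (L*1) := mul_le_mul (P.b0 y hy) h2 (abs_nonneg _) (by linarith)
    _ = L^2 := by ring

lemma cfun_lip {H : ((Fin n → ℝ) × ℝ × (Fin n → ℝ)) → ℝ} {𝒦 : Set ((Fin n → ℝ) × ℝ × (Fin n → ℝ))} {L K1 : ℝ} (hL : 1 ≤ L) (hK : 0 ≤ K1)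
    (P : Pack H 𝒦 L) (h𝒦 : ∀ y ∈ 𝒦, ∀ i, |y.2.2 i| ≤ K1) (i : Fin n) :
    LipschitzOnWith (Real.toNNReal (L*(1+K1) + L + 2*L^2)) (cfun H i) 𝒦 := by
  refine LipschitzOnWith.of_dist_le_mul fun y' hy' y hy => ?_
  rw [Real.coe_toNNReal _ (by positivity), Real.dist_eq, dist_eq_norm]
  have h1 := clm_bd (P.l1 y hy y' hy') (trip1 i hK (h𝒦 y' hy' i))
  have h3 := clm_bd (P.l1 y hy y' hy') (trip2 i)
  have hd : |y'.2.2 i - y.2.2 i| ≤ ‖y' - y‖ := 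
    (norm_le_pi_norm (y' - y).2.2 i).trans ((norm_snd_le _).trans (norm_snd_le _))
  have h2 : |fderiv ℝ H y (0, y'.2.2 i - y.2.2 i, 0)| ≤ L * ‖y' - y‖ :=
    clm_bd (P.b1 y hy) (norm_trip (norm_nonneg _) (fun j => by simp) hd (fun j => by simp))
  have h4 := clm_bd (P.b1 y hy) (trip2 i)
  have h5 := P.l0 y hy y' hy'
  have h6 := P.b0 y' hy'
  have e : cfun H i y' - cfun H i y = (fderiv ℝ H y' - fderiv ℝ H y) (Pi.single i 1, y'.2.2 i, 0) + fderiv ℝ H y (0, y'.2.2 i - y.2.2 i, 0)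
      + H y' * (fderiv ℝ H y' - fderiv ℝ H y) (0, 0, Pi.single i 1) + (H y' - H y) * fderiv ℝ H y (0, 0, Pi.single i 1) := by
    have : ((0 : Fin n → ℝ), y'.2.2 i - y.2.2 i, (0 : Fin n → ℝ)) = (Pi.single i 1, y'.2.2 i, 0) - (Pi.single i 1, y.2.2 i, 0) := by
      simp
    rw [this, map_sub]
    simp only [cfun, ContinuousLinearMap.sub_apply]
    ring
  rw [e]
  have t3 : |H y' * (fderiv ℝ H y' - fderiv ℝ H y) (0, 0, Pi.single i 1)| ≤ L * (L * ‖y' - y‖ * 1) := by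
    rw [abs_mul]; exact mul_le_mul h6 h3 (abs_nonneg _) (by linarith)
  have t4 : |(H y' - H y) * fderiv ℝ H y (0, 0, Pi.single i 1)| ≤ (L * ‖y' - y‖) * (L*1) := by
    rw [abs_mul]; exact mul_le_mul h5 h4 (abs_nonneg _) (by positivity)
  refine (abs_add_le _ _).trans ?_
  refine (add_le_add ((abs_add_le _ _).trans (add_le_add (abs_add_le _ _) le_rfl)) le_rfl).trans ?_
  nlinarith

namespace Sol
variable {κ : ℕ} {Ω B U : Set (Fin n → ℝ)} {𝒦 : Set ((Fin n → ℝ) × ℝ × (Fin n → ℝ))}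
    {f H : ((Fin n → ℝ) × ℝ × (Fin n → ℝ)) → ℝ} {L m K1 h : ℝ} {u : (Fin n → ℝ) → ℝ}

lemma facts (S : Sol κ Ω B 𝒦 f H L m K1 u) {x : Fin n → ℝ} (hx : x ∈ B) {v : ℝ} (hv : |v - (lapl u x + ((n+1)*L+3))| ≤ 1) :
    2 ≤ v ∧ (augM u (fun z => H (jet u z)) x).trace ≤ v ∧ (∀ i j, |pd i (pd j u) x| ≤ v) ∧ v ≤ lapl u x + ((n+1)*L+4) := by
  obtain ⟨t0, t1, t2⟩ := S.base hx
  have := abs_le.1 hv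
  have hL := S.hL
  have e : ((n:ℝ)+1)*L = n*L + L := by ring
  refine ⟨by linarith, by linarith, fun i j => (t2 i j).trans (by linarith), by linarith⟩

lemma core (S : Sol κ Ω B 𝒦 f H L m K1 u) (h𝒦 : ∀ y ∈ 𝒦, ∀ i, |y.2.2 i| ≤ K1) (hU : IsOpen U) (hh : 0 < h) (hUB : ∀ z ∈ U, closedBall z h ⊆ B)
    {Q : Set (Fin n → ℝ)} (hQ : IsCompact Q) (hQU : Q ⊆ U) {η : (Fin n → ℝ) → ℝ} {K : ℝ}
    (hs : ∀ x ∈ U, |vf u L h x - (lapl u x + ((n+1)*L+3))| ≤ 1 ∧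
    (∀ t, |t| = h → ∀ l, ‖jet u (x + t • (Pi.single l 1 : Fin n → ℝ)) - jet u x‖ ≤ h * ((n*K1+1) * vf u L h x)))
    (k1 : ((n:ℝ)+1)^(κ+1) ≤ K) (k3 : ((κ:ℝ)+2)*L^(κ+1)*L ≤ K) (k4 : L*(1+K1)+L^2+1 ≤ K)
    (k5 : ∀ x, ∀ i, |pd i η x| ≤ K) (k6 : (L*(1+K1)+L+2*L^2)*(1+K1) ≤ K) (k7 : (m^(κ+2))⁻¹ ≤ K)
    (k8 : ((((κ:ℝ)+2)*L^(κ+1) + n) * ((1+((n+1)*L+3))*L + 2*n*L*(n*K1+1)^2)) ≤ K) :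
    ∃ ct : Fin n → (Fin n → ℝ) → ℝ, (∀ l, ContDiffOn ℝ 1 (ct l) U) ∧
      CoreHyp κ K Q u (fun z => H (jet u z)) (vf u L h) η (fun i x => fderiv ℝ H (jet u x) (0, 0, Pi.single i 1))
        (fun i x => ((κ:ℝ)+2) * f (jet u x) ^ (κ+1) * fderiv ℝ f (jet u x) (0, 0, Pi.single i 1))
        (fun i x => cfun H i (jet u x)) ct := by
  have hn := S.hn
  have hκ := S.hκ
  have hL := S.hL
  have hK1 := S.hK1
  have hvcd := S.vf_cd hh hUB
  have hUB' : U ⊆ B := fun x hx => hUB x hx (mem_closedBall_self hh.le)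
  have hUΩ : U ⊆ Ω := hUB'.trans S.hBΩ
  -- bound for the gradient of v
  have hbd : ∃ D : ℝ, 0 < D ∧ ∀ x ∈ Q, ∀ i, |pd i (vf u L h) x| ≤ D := by
    have : ∀ i, ∃ D, ∀ x ∈ Q, ‖pd i (vf u L h) x‖ ≤ D := fun i =>
      hQ.exists_bound_of_continuousOn ((pd_contDiffOn (m := 1) hU hvcd (by norm_num) i).continuousOn.mono hQU)
    choose D hD using this
    refine ⟨1 + ∑ i, |D i|, by positivity, fun x hx i => ?_⟩
    have h1 := hD i x hx
    have h2 : |D i| ≤ ∑ i, |D i| := Finset.single_le_sum (f := fun i => |D i|) (fun j _ => abs_nonneg _) (Finset.mem_univ i)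
    rw [Real.norm_eq_abs] at h1
    linarith [le_abs_self (D i)]
  obtain ⟨D, hD0, hD⟩ := hbd
  have hδ : 0 < min 1 (1/D) := lt_min one_pos (by positivity)
  choose N hN1 hN2 hN3 using fun i => smooth_lip (cfun_lip hL hK1 S.pH h𝒦 i) hδ
  refine ⟨fun l x => N l (jet u x), fun l => (hN1 l).comp_contDiffOn (jet_contDiffOn hU (S.hu.mono hUΩ)), ?_⟩
  have hQB : Q ⊆ B := hQU.trans hUB'
  have F := fun x (hx : x ∈ Q) => S.facts (hQB hx) (hs x (hQU hx)).1
  have J := fun x (hx : x ∈ Q) => S.jm x (hQB hx)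
  have hK0 : 1 ≤ K := by nlinarith
  have sy := fun x (hx : x ∈ Q) => augM_symm_on S.hΩ (fun z => H (jet u z)) S.hu (hUΩ (hQU hx))
  have gm := fun x (hx : x ∈ Q) => (S.he x (hUΩ (hQU hx)))
  have NT : ∀ x ∈ Q, ∀ j ≤ κ+1, ∀ i l, |newtonT j (augM u (fun z => H (jet u z)) x) i l| ≤ K * vf u L h x ^ j := by
    intro x hx j hj i l
    obtain ⟨f1, f2, f3, f4⟩ := F x hx
    refine (mat_newton_le hκ (by omega) (sy x hx) (gm x hx).2 j (by omega) i l).trans ?_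
    have t0 := (S.base (hQB hx)).1
    refine mul_le_mul ((pow_le_pow_right₀ (by linarith [(Nat.cast_nonneg n : (0:ℝ) ≤ n)]) hj).trans k1) (pow_le_pow_left₀ t0.le f2 j) (by positivity) (by linarith)
  have jb : ∀ x ∈ Q, ∀ i, ‖((Pi.single i 1, pd i u x, fun j => pd i (pd j u) x) : (Fin n → ℝ) × ℝ × (Fin n → ℝ))‖ ≤ (1+K1) * vf u L h x := by
    intro x hx i
    obtain ⟨f1, f2, f3, f4⟩ := F x hx
    refine norm_trip (by nlinarith) (fun j => (abs_single_le i j).trans (by nlinarith)) ((S.bu x (hQB hx) i).trans (by nlinarith)) (fun j => (f3 i j).trans (by nlinarith))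
  constructor
  · intro x hx; linarith [(F x hx).1]
  · intro x hx i
    rw [pd_comp_jet S.hΩ S.hu (hUΩ (hQU hx)) (S.dH x (hUΩ (hQU hx))), clm_trip, cfun, add_assoc]
    congr 1
    rw [show (H (jet u x) * fderiv ℝ H (jet u x) (0, 0, Pi.single i 1)) = ∑ j, H (jet u x) * (if i = j then 1 else 0) * fderiv ℝ H (jet u x) (0, 0, Pi.single j 1) by simp,
      ← Finset.sum_add_distrib]
    refine Finset.sum_congr rfl fun j _ => ?_
    rw [augM_apply]; ring
  · intro x hx i l
    have := NT x hx (κ+1) le_rfl i l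
    rwa [pow_succ] at this
  · intro x hx i l
    exact NT x hx κ (by omega) i l
  · intro x hx i l
    obtain ⟨f1, f2, f3, f4⟩ := F x hx
    cases κ with
    | zero => simp [newtonP]; linarith
    | succ j =>
      refine (NT x hx j (by omega) i l).trans ?_
      exact mul_le_mul_of_nonneg_left (pow_le_pow_right₀ (by linarith) (by omega)) (by linarith)
  · intro x hx i
    refine (clm_bd (S.pH.b1 _ (J x hx)) (trip2 i)).trans ?_
    nlinarith
  · intro x hx i
    have h1 := clm_bd (S.pf.b1 _ (J x hx)) (trip2 i)
    refine le_trans ?_ k3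
    rw [abs_mul, abs_mul, abs_pow, abs_of_nonneg (by positivity : (0:ℝ) ≤ (κ:ℝ)+2)]
    rw [mul_one] at h1
    have h0 := S.pf.b0 _ (J x hx)
    gcongr
  · intro x hx i
    have h1 := hN3 i _ (J x hx)
    have h2 := cfun_bd hL hK1 S.pH h𝒦 i (J x hx)
    have h3 := abs_add_le (N i (jet u x) - cfun H i (jet u x)) (cfun H i (jet u x))
    rw [sub_add_cancel] at h3
    have := min_le_left 1 (1/D)
    show |N i (jet u x)| ≤ K
    linarith
  · intro x hx i; exact k5 x i
  · intro x hx i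
    obtain ⟨f1, f2, f3, f4⟩ := F x hx
    rw [pd_comp_jet S.hΩ S.hu (hUΩ (hQU hx)) (S.dH x (hUΩ (hQU hx)))]
    refine (clm_bd (S.pH.b1 _ (J x hx)) (jb x hx i)).trans ?_
    rw [← mul_assoc]
    exact mul_le_mul_of_nonneg_right (by nlinarith) (by linarith)
  · intro x hx i l
    obtain ⟨f1, f2, f3, f4⟩ := F x hx
    show |pd i (fun x => N l (jet u x)) x| ≤ _
    rw [pd_comp_jet S.hΩ S.hu (hUΩ (hQU hx)) ((hN1 l).differentiable (by norm_num) _)]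
    have h1 := hN2 l (jet u x)
    rw [Real.coe_toNNReal _ (by positivity)] at h1
    refine (clm_bd h1 (jb x hx i)).trans ?_
    rw [← mul_assoc]
    exact mul_le_mul_of_nonneg_right k6 (by linarith)
  · intro x hx i l
    have h1 := hN3 l _ (J x hx)
    rw [abs_mul, abs_sub_comm]
    calc _ ≤ (1/D) * D := mul_le_mul (h1.trans (min_le_right _ _)) (hD x hx i) (abs_nonneg _) (by positivity)
      _ = 1 := by field_simp
  · intro x hx ζ
    obtain ⟨f1, f2, f3, f4⟩ := F x hx
    have h1 := mat_lower hκ (sy x hx) (gm x hx).2 ζ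
    rw [(gm x hx).1] at h1
    have t0 := (S.base (hQB hx)).1
    have hm := S.hm
    have h2 : m^(κ+2) ≤ f (jet u x)^(κ+2) := pow_le_pow_left₀ hm.le (S.fm _ (J x hx)) _
    have h3 : (0:ℝ) ≤ ∑ i, ζ i^2 := Finset.sum_nonneg fun i _ => sq_nonneg _
    have hmp : 0 < m^(κ+2) := by positivity
    have h4 : m^(κ+2) * ∑ i, ζ i^2 ≤ (augM u (fun z => H (jet u z)) x).trace * (ζ ⬝ᵥ (newtonT (κ+1) (augM u (fun z => H (jet u z)) x) *ᵥ ζ)) :=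
      (mul_le_mul_of_nonneg_right h2 h3).trans h1
    have h5 : 0 ≤ ζ ⬝ᵥ (newtonT (κ+1) (augM u (fun z => H (jet u z)) x) *ᵥ ζ) := by
      by_contra hc
      push Not at hc
      have := mul_neg_of_pos_of_neg t0 hc
      have := mul_nonneg hmp.le h3
      linarith
    have h6 := h4.trans (mul_le_mul_of_nonneg_right f2 h5)
    calc ∑ i, ζ i^2 = (m^(κ+2))⁻¹ * (m^(κ+2) * ∑ i, ζ i^2) := by field_simp
      _ ≤ (m^(κ+2))⁻¹ * (vf u L h x * (ζ ⬝ᵥ (newtonT (κ+1) (augM u (fun z => H (jet u z)) x) *ᵥ ζ))) := mul_le_mul_of_nonneg_left h6 (by positivity)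
      _ ≤ K * (vf u L h x * (ζ ⬝ᵥ (newtonT (κ+1) (augM u (fun z => H (jet u z)) x) *ᵥ ζ))) := mul_le_mul_of_nonneg_right k7 (mul_nonneg (by linarith) h5)
      _ = _ := by ring
  · intro x hx
    obtain ⟨f1, f2, f3, f4⟩ := F x hx
    have h1 := S.main_ineq hU hh hUB (hQU hx) (hs x (hQU hx)).1 (hs x (hQU hx)).2
    have h2 : (0:ℝ) ≤ vf u L h x ^ κ * vf u L h x ^ 3 := by
      have : 0 ≤ vf u L h x := by linarith
      positivity
    have h3 := mul_le_mul_of_nonneg_right k8 h2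
    refine le_trans ?_ h1
    show _ + _ - _ ≤ _
    linarith
end Sol
end

section
variable {n : ℕ}

lemma matNorm_nonneg (A : Matrix (Fin n) (Fin n) ℝ) : 0 ≤ matNorm A := norm_nonneg _

lemma matNorm_cont : Continuous (matNorm : Matrix (Fin n) (Fin n) ℝ → ℝ) := by
  have : Continuous ((LinearMap.toContinuousLinearMap (𝕜 := ℝ) (E := EuclideanSpace ℝ (Fin n)) (F' := EuclideanSpace ℝ (Fin n))).toLinearMap ∘ₗ (Matrix.toEuclideanLin (𝕜 := ℝ) (m := Fin n) (n := Fin n)).toLinearMap) :=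
    LinearMap.continuous_of_finiteDimensional _
  exact continuous_norm.comp this

lemma entry_le_matNorm (A : Matrix (Fin n) (Fin n) ℝ) (i j : Fin n) : |A i j| ≤ matNorm A := by
  have h := (LinearMap.toContinuousLinearMap (Matrix.toEuclideanLin A)).le_opNorm (EuclideanSpace.single j (1:ℝ))
  rw [EuclideanSpace.norm_single, norm_one, mul_one] at h
  refine le_trans ?_ h
  have h2 := PiLp.norm_apply_le (p := 2) ((LinearMap.toContinuousLinearMap (Matrix.toEuclideanLin A)) (EuclideanSpace.single j (1:ℝ))) i
  refine le_trans (le_of_eq ?_) h2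
  rw [Real.norm_eq_abs]
  congr 1
  simp [Matrix.toLpLin_apply, Matrix.mulVec_single]

lemma matNorm_le (A : Matrix (Fin n) (Fin n) ℝ) {C : ℝ} (hC : 0 ≤ C) (h : ∀ i j, |A i j| ≤ C) : matNorm A ≤ n * C := by
  refine ContinuousLinearMap.opNorm_le_bound _ (by positivity) fun y => ?_
  have e : ∀ i, ((LinearMap.toContinuousLinearMap (Matrix.toEuclideanLin A)) y) i = ∑ j, A i j * y j := by
    intro i; simp [Matrix.toLpLin_apply, Matrix.mulVec, dotProduct]
  rw [EuclideanSpace.norm_eq]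
  refine Real.sqrt_le_iff.2 ⟨by positivity, ?_⟩
  have hy : ‖y‖^2 = ∑ i, y i^2 := by
    rw [EuclideanSpace.norm_sq_eq]; simp
  calc ∑ i, ‖((LinearMap.toContinuousLinearMap (Matrix.toEuclideanLin A)) y) i‖^2 ≤ ∑ i : Fin n, (n * C^2) * ‖y‖^2 := by
        refine Finset.sum_le_sum fun i _ => ?_
        rw [e, Real.norm_eq_abs, sq_abs, hy]
        refine (Finset.sum_mul_sq_le_sq_mul_sq _ _ _).trans ?_
        refine mul_le_mul_of_nonneg_right ?_ (Finset.sum_nonneg fun i _ => sq_nonneg _)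
        calc ∑ j, A i j^2 ≤ ∑ j : Fin n, C^2 := Finset.sum_le_sum fun j _ => by
              rw [← sq_abs]; exact pow_le_pow_left₀ (abs_nonneg _) (h i j) 2
          _ = n * C^2 := by simp
    _ = (n * C * ‖y‖)^2 := by rw [Finset.sum_const, Finset.card_fin, nsmul_eq_mul]; ring

lemma entry_le_vnorm (ξ : Fin n → ℝ) (i : Fin n) : |ξ i| ≤ vnorm ξ := by
  unfold vnorm
  rw [← Real.sqrt_sq_eq_abs]
  exact Real.sqrt_le_sqrt (Finset.single_le_sum (f := fun i => ξ i^2) (fun j _ => sq_nonneg _) (Finset.mem_univ i))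

lemma vnorm_cont : Continuous (vnorm : (Fin n → ℝ) → ℝ) := by
  unfold vnorm
  fun_prop

lemma hess_contOn {Ω : Set (Fin n → ℝ)} (hΩ : IsOpen Ω) {u : (Fin n → ℝ) → ℝ} (hu : ContDiffOn ℝ 2 u Ω) (i j : Fin n) :
    ContinuousOn (pd i (pd j u)) Ω :=
  (pd_contDiffOn (m := 0) hΩ (pd_contDiffOn (m := 1) hΩ hu (by norm_num) j) (by norm_num) i).continuousOn

/-- everything used from the Sobolev bound -/
lemma w2p_facts {Ω : Set (Fin n → ℝ)} (hΩ : IsOpen Ω) {u : (Fin n → ℝ) → ℝ} (hu : ContDiffOn ℝ 2 u Ω) {x₀ : Fin n → ℝ} {R p M : ℝ}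
    (hR : 0 < R) (hball : closure (ball x₀ (2*R)) ⊆ Ω) (hp : 1 < p) (hM : 0 < M) (hW : W2pNorm p u (ball x₀ (2*R)) ≤ M) :
    (∀ w : (Fin n → ℝ) → ℝ, ContinuousOn w Ω → (∀ x, |w x| ≤ |u x| ∨ |w x| ≤ vnorm (grad u x) ∨ |w x| ≤ matNorm (hess u x)) →
      IntegrableOn (fun y => |w y| ^ p) (ball x₀ (2*R)) ∧ ∫ y in ball x₀ (2*R), |w y| ^ p ≤ M ^ p) ∧
    IntegrableOn (fun y => matNorm (hess u y) ^ p) (ball x₀ (2*R)) ∧ ∫ y in ball x₀ (2*R), matNorm (hess u y) ^ p ≤ M ^ p := by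
  have hcl : closure (ball x₀ (2*R)) = closedBall x₀ (2*R) := closure_ball x₀ (by positivity)
  rw [hcl] at hball
  have hp0 : 0 ≤ p := by linarith
  have io : ∀ F : (Fin n → ℝ) → ℝ, ContinuousOn F Ω → IntegrableOn F (ball x₀ (2*R)) := fun F hF =>
    ((hF.mono hball).integrableOn_compact (isCompact_closedBall _ _)).mono_set ball_subset_closedBall
  have cr : ∀ F : (Fin n → ℝ) → ℝ, ContinuousOn F Ω → ContinuousOn (fun x => F x ^ p) Ω := fun F hF =>
    hF.rpow_const fun x _ => Or.inr hp0
  have cu : ContinuousOn (fun x => |u x| ^ p) Ω := cr _ hu.continuousOn.abs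
  have cg : ContinuousOn (fun x => vnorm (grad u x) ^ p) Ω := cr _ (vnorm_cont.comp_continuousOn (continuousOn_pi.2 fun i => (pd_contDiffOn (m := 1) hΩ hu (by norm_num) i).continuousOn))
  have ch : ContinuousOn (fun x => matNorm (hess u x) ^ p) Ω := cr _ (matNorm_cont.comp_continuousOn (continuousOn_pi.2 fun i => continuousOn_pi.2 fun j => hess_contOn hΩ hu i j))
  have ci := io _ ((cu.add cg).add ch)
  have nn : ∀ x, 0 ≤ |u x| ^ p + vnorm (grad u x) ^ p + matNorm (hess u x) ^ p := fun x =>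
    add_nonneg (add_nonneg (Real.rpow_nonneg (abs_nonneg _) _) (Real.rpow_nonneg (Real.sqrt_nonneg _) _)) (Real.rpow_nonneg (matNorm_nonneg _) _)
  have tot : ∫ x in ball x₀ (2*R), (|u x| ^ p + vnorm (grad u x) ^ p + matNorm (hess u x) ^ p) ≤ M ^ p := by
    have h0 : 0 ≤ ∫ x in ball x₀ (2*R), (|u x| ^ p + vnorm (grad u x) ^ p + matNorm (hess u x) ^ p) := integral_nonneg nn
    have := Real.rpow_le_rpow (Real.rpow_nonneg h0 _) hW hp0
    rwa [← Real.rpow_mul h0, one_div_mul_cancel (by linarith), Real.rpow_one] at this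
  have a1 : ∀ x, 0 ≤ |u x| ^ p := fun x => Real.rpow_nonneg (abs_nonneg _) _
  have a2 : ∀ x, 0 ≤ vnorm (grad u x) ^ p := fun x => Real.rpow_nonneg (Real.sqrt_nonneg _) _
  have a3 : ∀ x, 0 ≤ matNorm (hess u x) ^ p := fun x => Real.rpow_nonneg (matNorm_nonneg _) _
  refine ⟨fun w hw hb => ?_, io _ ch, ?_⟩
  · have wi := io _ (cr _ hw.abs)
    refine ⟨wi, (setIntegral_mono wi ci fun x => ?_).trans tot⟩
    have := a1 x
    have := a2 x
    have := a3 x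
    rcases hb x with h | h | h
    · have := Real.rpow_le_rpow (abs_nonneg _) h hp0
      show |w x| ^ p ≤ |u x| ^ p + vnorm (grad u x) ^ p + matNorm (hess u x) ^ p
      linarith
    · have := Real.rpow_le_rpow (abs_nonneg _) h hp0
      show |w x| ^ p ≤ |u x| ^ p + vnorm (grad u x) ^ p + matNorm (hess u x) ^ p
      linarith
    · have := Real.rpow_le_rpow (abs_nonneg _) h hp0
      show |w x| ^ p ≤ |u x| ^ p + vnorm (grad u x) ^ p + matNorm (hess u x) ^ p
      linarith
  · refine (setIntegral_mono (io _ ch) ci fun x => ?_).trans tot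
    have := a1 x
    have := a2 x
    show matNorm (hess u x) ^ p ≤ |u x| ^ p + vnorm (grad u x) ^ p + matNorm (hess u x) ^ p
    linarith

/-- Morrey bound for `u` and its gradient -/
noncomputable def mK (n : ℕ) (R p M : ℝ) : ℝ :=
  (qvol n (R/16))⁻¹ * ((qvol n (R/16)) ^ (1 - 1/p) * (M^p) ^ (1/p) * (1 + n * (R/16) / (1 - n/p)))

lemma c1_bound {Ω : Set (Fin n → ℝ)} (hΩ : IsOpen Ω) {u : (Fin n → ℝ) → ℝ} (hu : ContDiffOn ℝ 2 u Ω) {x₀ : Fin n → ℝ} {R p M : ℝ}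
    (hR : 0 < R) (hball : closure (ball x₀ (2*R)) ⊆ Ω) (hp : 1 < p) (hpn : (n:ℝ) < p) (hM : 0 < M) (hW : W2pNorm p u (ball x₀ (2*R)) ≤ M)
    {x : Fin n → ℝ} (hx : x ∈ closedBall x₀ (15*R/8)) : |u x| ≤ mK n R p M ∧ ∀ i, |pd i u x| ≤ mK n R p M := by
  obtain ⟨F, -, -⟩ := w2p_facts hΩ hu hR hball hp hM hW
  have hDU : ball x₀ (2*R) ⊆ Ω := subset_closure.trans hball
  have hxy : ∀ y ∈ closedBall (0 : Fin n → ℝ) (R/16), x + y ∈ ball x₀ (2*R) := fun y hy => by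
    rw [mem_closedBall, dist_eq_norm] at hx
    rw [mem_closedBall_zero_iff] at hy
    rw [mem_ball, dist_eq_norm]
    have := norm_add_le (x - x₀) y
    rw [show x + y - x₀ = x - x₀ + y by abel]
    linarith
  have cpd := fun i => pd_contDiffOn (m := 1) hΩ hu (by norm_num) i
  have B0 := F u hu.continuousOn fun x => Or.inl le_rfl
  have B1 := fun i => F (pd i u) (cpd i).continuousOn fun x => Or.inr (Or.inl (entry_le_vnorm (grad u x) i))
  have B2 := fun i j => F (pd i (pd j u)) (hess_contOn hΩ hu i j) fun x => Or.inr (Or.inr (entry_le_matNorm (hess u x) i j))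
  exact ⟨morrey (by positivity) hp hpn hΩ hDU measurableSet_ball hxy (hu.of_le (by norm_num)) B0.1 B0.2 (fun i => (B1 i).1) (fun i => (B1 i).2),
    fun j => morrey (by positivity) hp hpn hΩ hDU measurableSet_ball hxy (cpd j) (B1 j).1 (B1 j).2 (fun i => (B2 i j).1) (fun i => (B2 i j).2)⟩

lemma mK_nonneg {R p M : ℝ} (hR : 0 < R) (hp : 1 < p) (hpn : (n:ℝ) < p) (hM : 0 < M) : 0 ≤ mK n R p M := by
  have hq := qvol_pos (n := n) (ρ := R/16) (by positivity)
  have h1 : 0 < 1 - n/p := by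
    have : (n:ℝ)/p < 1 := (div_lt_one (by linarith)).2 hpn
    linarith
  unfold mK
  positivity
end

section
variable {n : ℕ}

lemma Pack.mono {E : Type*} [NormedAddCommGroup E] [NormedSpace ℝ E] {Φ : E → ℝ} {S : Set E} {L L' : ℝ} (P : Pack Φ S L) (h : L ≤ L') : Pack Φ S L' where
  b0 y hy := (P.b0 y hy).trans h
  b1 y hy := (P.b1 y hy).trans h
  l1 y hy y' hy' := (P.l1 y hy y' hy').trans (mul_le_mul_of_nonneg_right h (norm_nonneg _))
  l0 y hy y' hy' := (P.l0 y hy y' hy').trans (mul_le_mul_of_nonneg_right h (norm_nonneg _))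
  t2 y hy y' hy' := (P.t2 y hy y' hy').trans (mul_le_mul_of_nonneg_right h (by positivity))

lemma rpow_add_le2 {a b p : ℝ} (ha : 0 ≤ a) (hb : 0 ≤ b) (hp : 0 ≤ p) : (a + b) ^ p ≤ 2 ^ p * (a ^ p + b ^ p) := by
  have h1 : a + b ≤ 2 * max a b := by linarith [le_max_left a b, le_max_right a b]
  have h2 := Real.rpow_le_rpow (by positivity) h1 hp
  rw [Real.mul_rpow (by norm_num) (ha.trans (le_max_left _ _))] at h2
  refine h2.trans (mul_le_mul_of_nonneg_left ?_ (by positivity))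
  have := Real.rpow_nonneg ha p
  have := Real.rpow_nonneg hb p
  rcases max_choice a b with h | h <;> rw [h] <;> linarith

lemma v_int {v N : (Fin n → ℝ) → ℝ} {Q D : Set (Fin n → ℝ)} (hQD : Q ⊆ D) (hQ : MeasurableSet Q) (hDf : volume D < ⊤) {p A c : ℝ} (hp : 0 ≤ p)
    (hc : 0 ≤ c) (hN0 : ∀ x, 0 ≤ N x) (hv0 : ∀ x ∈ Q, 0 ≤ v x) (hv : ∀ x ∈ Q, v x ≤ n * N x + c)
    (hi : IntegrableOn (fun x => N x ^ p) D) (hA : ∫ x in D, N x ^ p ≤ A) :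
    ∫ x in Q, v x ^ p ≤ 2 ^ p * ((n:ℝ) ^ p * A + c ^ p * (volume D).toReal) := by
  have hci : IntegrableOn (fun x : Fin n → ℝ => c ^ p) D := integrableOn_const hDf.ne
  have hG : IntegrableOn (fun x => 2 ^ p * ((n:ℝ) ^ p * N x ^ p + c ^ p)) D := ((hi.const_mul _).add hci).const_mul _
  have pt : ∀ x ∈ Q, v x ^ p ≤ 2 ^ p * ((n:ℝ) ^ p * N x ^ p + c ^ p) := fun x hx => by
    have h1 := (Real.rpow_le_rpow (hv0 x hx) (hv x hx) hp).trans (rpow_add_le2 (mul_nonneg (Nat.cast_nonneg n) (hN0 x)) hc hp)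
    rwa [Real.mul_rpow (Nat.cast_nonneg n) (hN0 x)] at h1
  have nn : ∀ x, 0 ≤ 2 ^ p * ((n:ℝ) ^ p * N x ^ p + c ^ p) := fun x => by
    have := Real.rpow_nonneg (hN0 x) p
    positivity
  calc ∫ x in Q, v x ^ p ≤ ∫ x in Q, 2 ^ p * ((n:ℝ) ^ p * N x ^ p + c ^ p) := by
        refine integral_mono_of_nonneg ?_ (hG.mono_set hQD) ?_
        · exact (ae_restrict_iff' hQ).2 (Filter.Eventually.of_forall fun x hx => Real.rpow_nonneg (hv0 x hx) _)
        · exact (ae_restrict_iff' hQ).2 (Filter.Eventually.of_forall pt)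
    _ ≤ ∫ x in D, 2 ^ p * ((n:ℝ) ^ p * N x ^ p + c ^ p) :=
        setIntegral_mono_set hG (Filter.Eventually.of_forall nn) (Filter.Eventually.of_forall hQD)
    _ = 2 ^ p * ((n:ℝ) ^ p * (∫ x in D, N x ^ p) + c ^ p * (volume D).toReal) := by
        rw [integral_const_mul, integral_add (hi.const_mul _) hci, integral_const_mul, setIntegral_const]
        simp [Measure.real, mul_comm]
    _ ≤ _ := by gcongr

lemma exists_cut (x₀ : Fin n → ℝ) {R : ℝ} (hR : 0 < R) : ∃ (η : (Fin n → ℝ) → ℝ) (E : ℝ), ContDiff ℝ 1 η ∧ (∀ x, 0 ≤ η x) ∧ (∀ x, η x ≤ 1) ∧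
    tsupport η ⊆ closedBall x₀ (3*R/2) ∧ (∀ x ∈ ball x₀ R, η x = 1) ∧ 0 ≤ E ∧ ∀ x, ∀ i, |pd i η x| ≤ E := by
  let φ : ContDiffBump x₀ := ⟨R, 3*R/2, hR, by linarith⟩
  have hφ : ContDiff ℝ 1 φ := φ.contDiff
  obtain ⟨C, hC⟩ := hφ.lipschitzWith_of_hasCompactSupport φ.hasCompactSupport (by norm_num)
  refine ⟨φ, C, hφ, fun x => φ.nonneg, fun x => φ.le_one, φ.tsupport_eq.le, fun x hx => φ.one_of_mem_closedBall (ball_subset_closedBall hx), C.2, fun x i => ?_⟩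
  have h1 := norm_fderiv_le_of_lipschitz ℝ hC (x₀ := x)
  refine ((fderiv ℝ φ x).le_opNorm _).trans ?_
  calc _ ≤ (C:ℝ) * 1 := mul_le_mul h1 (norm_single_one i) (norm_nonneg _) C.2
    _ = C := mul_one _

lemma final_aux (hn : 3 ≤ n) (κ : ℕ) (hκ : κ + 2 ≤ n)
    (Ω : Set (Fin n → ℝ)) (hΩ : IsOpen Ω)
    (p : ℝ) (hp : ((κ:ℝ)+3)*n/2 < p)
    (f : ((Fin n → ℝ) × ℝ × (Fin n → ℝ)) → ℝ)
    (hfpos : ∀ y ∈ Ω ×ˢ ((univ : Set ℝ) ×ˢ (univ : Set (Fin n → ℝ))), 0 < f y)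
    (hf : C11On f (Ω ×ˢ ((univ : Set ℝ) ×ˢ (univ : Set (Fin n → ℝ)))))
    (H : ((Fin n → ℝ) × ℝ × (Fin n → ℝ)) → ℝ)
    (hH : C11On H (Ω ×ˢ ((univ : Set ℝ) ×ˢ (univ : Set (Fin n → ℝ)))))
    (x₀ : Fin n → ℝ) (R : ℝ) (hR : 0 < R)
    (hball : closure (ball x₀ (2 * R)) ⊆ Ω)
    (M : ℝ) (hM : 0 < M) :
    ∃ C : ℝ, ∀ u : (Fin n → ℝ) → ℝ,
      ContDiffOn ℝ 2 u Ω →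
      (∀ x ∈ Ω, esymmMat (κ+2) (augM u (fun z => H (jet u z)) x) = f (jet u x) ^ (κ+2) ∧ GammaPlus (κ+2) (augM u (fun z => H (jet u z)) x)) →
      W2pNorm p u (ball x₀ (2 * R)) ≤ M →
      ∀ x ∈ ball x₀ R, matNorm (hess u x) ≤ C := by
  have hn3 : (3:ℝ) ≤ n := by exact_mod_cast hn
  have hpn : (n:ℝ) < p := by
    have : (0:ℝ) ≤ κ * n := by positivity
    nlinarith
  have hp1 : 1 < p := by linarith
  set K1 := mK n R p M with hK1d
  have hK1 : 0 ≤ K1 := mK_nonneg hR hp1 hpn hM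
  set O := Ω ×ˢ ((univ : Set ℝ) ×ˢ (univ : Set (Fin n → ℝ))) with hOd
  have hO : IsOpen O := hΩ.prod (isOpen_univ.prod isOpen_univ)
  set B := closedBall x₀ (15*R/8) with hBd
  have hBD : B ⊆ ball x₀ (2*R) := closedBall_subset_ball (by linarith)
  have hBΩ : B ⊆ Ω := hBD.trans (subset_closure.trans hball)
  have hBc : IsCompact B := isCompact_closedBall _ _
  set 𝒦 : Set ((Fin n → ℝ) × ℝ × (Fin n → ℝ)) := B ×ˢ (closedBall (0:ℝ) K1 ×ˢ closedBall (0 : Fin n → ℝ) K1) with h𝒦d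
  have h𝒦c : IsCompact 𝒦 := hBc.prod ((isCompact_closedBall _ _).prod (isCompact_closedBall _ _))
  have h𝒦v : Convex ℝ 𝒦 := (convex_closedBall _ _).prod ((convex_closedBall _ _).prod (convex_closedBall _ _))
  have h𝒦O : 𝒦 ⊆ O := prod_mono hBΩ (subset_univ _ |>.trans (by simp))
  have h𝒦b : ∀ y ∈ 𝒦, ∀ i, |y.2.2 i| ≤ K1 := fun y hy i => 
    (norm_le_pi_norm y.2.2 i).trans (mem_closedBall_zero_iff.1 hy.2.2)
  obtain ⟨L1, hL1, p1, p2, p3, p4, p5⟩ := c11_pack hO hf h𝒦c h𝒦v h𝒦O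
  obtain ⟨L2, hL2, q1, q2, q3, q4, q5⟩ := c11_pack hO hH h𝒦c h𝒦v h𝒦O
  set L := max L1 L2 with hLd
  have hL : 1 ≤ L := hL1.trans (le_max_left _ _)
  have Pf : Pack f 𝒦 L := (Pack.mk p1 p2 p3 p4 p5).mono (le_max_left _ _)
  have PH : Pack H 𝒦 L := (Pack.mk q1 q2 q3 q4 q5).mono (le_max_right _ _)
  obtain ⟨m, hm, fm⟩ : ∃ m : ℝ, 0 < m ∧ ∀ y ∈ 𝒦, m ≤ f y := by
    obtain ⟨y, hy, hy'⟩ := h𝒦c.exists_isMinOn ⟨(x₀, 0, 0), ⟨mem_closedBall_self (by positivity), mem_closedBall_self hK1, mem_closedBall_self hK1⟩⟩ (hf.1.continuousOn.mono h𝒦O)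
    exact ⟨f y, hfpos y (h𝒦O hy), fun z hz => hy' hz⟩
  obtain ⟨η, E, hη, hη0, hη1, hηs, hηo, hE, hEb⟩ := exists_cut x₀ hR
  obtain ⟨K, hK, k1, k3, k4, k5, k6, k7, k8⟩ : ∃ K : ℝ, 1 ≤ K ∧ ((n:ℝ)+1)^(κ+1) ≤ K ∧ ((κ:ℝ)+2)*L^(κ+1)*L ≤ K ∧ L*(1+K1)+L^2+1 ≤ K ∧ E ≤ K ∧
      (L*(1+K1)+L+2*L^2)*(1+K1) ≤ K ∧ (m^(κ+2))⁻¹ ≤ K ∧ ((((κ:ℝ)+2)*L^(κ+1) + n) * ((1+((n+1)*L+3))*L + 2*n*L*(n*K1+1)^2)) ≤ K := by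
    have hL0 : 0 ≤ L := by linarith
    have e1 : 0 ≤ ((n:ℝ)+1)^(κ+1) := by positivity
    have e2 : 0 ≤ ((κ:ℝ)+2)*L^(κ+1)*L := by positivity
    have e3 : 0 ≤ L*(1+K1)+L^2+1 := by positivity
    have e4 : 0 ≤ (L*(1+K1)+L+2*L^2)*(1+K1) := by positivity
    have e5 : 0 ≤ (m^(κ+2))⁻¹ := by positivity
    have e6 : 0 ≤ ((((κ:ℝ)+2)*L^(κ+1) + n) * ((1+((n+1)*L+3))*L + 2*n*L*(n*K1+1)^2)) := by positivity
    refine ⟨1 + ((n:ℝ)+1)^(κ+1) + ((κ:ℝ)+2)*L^(κ+1)*L + (L*(1+K1)+L^2+1) + E + (L*(1+K1)+L+2*L^2)*(1+K1) + (m^(κ+2))⁻¹ +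
      ((((κ:ℝ)+2)*L^(κ+1) + n) * ((1+((n+1)*L+3))*L + 2*n*L*(n*K1+1)^2)), ?_, ?_, ?_, ?_, ?_, ?_, ?_, ?_⟩ <;> linarith
  set Vb := max 1 (2 ^ p * ((n:ℝ) ^ p * M ^ p + ((n+1)*L+4) ^ p * (volume (ball x₀ (2*R))).toReal)) with hVb
  obtain ⟨C, hC⟩ := moser_full hn hκ hp hK (le_max_left _ _ : 1 ≤ Vb) (show 0 < 3*R/2 by positivity) (show 3*R/2 < 7*R/4 by linarith) x₀
  refine ⟨n * C, fun u hu he hW x hx => ?_⟩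
  have cb : ∀ x ∈ B, |u x| ≤ K1 ∧ ∀ i, |pd i u x| ≤ K1 := fun x hx => c1_bound hΩ hu hR hball hp1 hpn hM hW hx
  have jO : ∀ x ∈ Ω, jet u x ∈ O := fun x hx => ⟨hx, mem_univ _, mem_univ _⟩
  have S : Sol κ Ω B 𝒦 f H L m K1 u :=
    { hn := hn, hκ := hκ, hΩ := hΩ, hB := hBc, hBΩ := hBΩ, hL := hL, hm := hm, hK1 := hK1, pf := Pf, pH := PH
      df := fun x hx => (hf.1.contDiffAt (hO.mem_nhds (jO x hx))).differentiableAt (by norm_num)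
      cH := hH.1.comp (jet_contDiffOn hΩ hu) jO
      dH := fun x hx => (hH.1.contDiffAt (hO.mem_nhds (jO x hx))).differentiableAt (by norm_num)
      fm := fm
      fp := fun x hx => hfpos _ (jO x hx)
      hu := hu
      he := he
      jm := fun x hx => ⟨hx, mem_closedBall_zero_iff.2 (cb x hx).1, mem_closedBall_zero_iff.2 ((pi_norm_le_iff_of_nonneg hK1).2 (cb x hx).2)⟩
      bu := fun x hx => (cb x hx).2 }
  obtain ⟨h0, hh0, hsm⟩ := S.small
  obtain ⟨h, hh, hlt⟩ := exists_between (lt_min hh0 (show 0 < R/8 by positivity))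
  have hlt1 : h < h0 := hlt.trans_le (min_le_left _ _)
  have hlt2 : h < R/8 := hlt.trans_le (min_le_right _ _)
  set U := ball x₀ (7*R/4) with hUd
  have hUB : ∀ z ∈ U, closedBall z h ⊆ B := fun z hz => closedBall_subset_closedBall' (by
    have := mem_ball.1 hz
    linarith)
  have hs := fun x (hx : x ∈ U) => hsm h hh hlt1 x (hUB x hx)
  have hQU : closedBall x₀ (3*R/2) ⊆ U := closedBall_subset_ball (by linarith)
  have hUB' : U ⊆ B := ball_subset_closedBall.trans (closedBall_subset_closedBall (by linarith))
  have F := fun x (hx : x ∈ U) => S.facts (hUB' hx) (hs x hx).1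
  obtain ⟨ct, hct, hcore⟩ := S.core h𝒦b isOpen_ball hh hUB (isCompact_closedBall x₀ (3*R/2)) hQU (η := η) hs k1 k3 k4 (fun x i => (hEb x i).trans k5) k6 k7 k8
  obtain ⟨-, wi, wb⟩ := w2p_facts hΩ hu hR hball hp1 hM hW
  have hV : ∫ x in closedBall x₀ (3*R/2), vf u L h x ^ p ≤ Vb := by
    refine (v_int (N := fun x => matNorm (hess u x)) (D := ball x₀ (2*R)) (closedBall_subset_ball (by linarith)) measurableSet_closedBall measure_ball_lt_top (by linarith) (by positivity)
      (fun x => matNorm_nonneg _) (fun x hx => by linarith [(F x (hQU hx)).1]) (fun x hx => ?_) wi wb).trans (le_max_right _ _)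
    refine (F x (hQU hx)).2.2.2.trans (add_le_add ?_ le_rfl)
    calc lapl u x ≤ ∑ l : Fin n, matNorm (hess u x) := Finset.sum_le_sum fun l _ => (le_abs_self _).trans (entry_le_matNorm (hess u x) l l)
      _ = n * matNorm (hess u x) := by simp
  have hUΩ : U ⊆ Ω := hUB'.trans hBΩ
  have fin := hC (hu.mono hUΩ) (S.cH.mono hUΩ) (S.vf_cd hh hUB) hct hη hη0 hη1 hηs (fun x hx => by linarith [(F x hx).1]) hcore hV x (ball_subset_ball (by linarith) hx)
  rw [hηo x hx, one_pow, one_mul] at fin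
  have hxU : x ∈ U := ball_subset_ball (by linarith) hx
  have Fx := F x hxU
  exact matNorm_le _ (by linarith) fun i j => (Fx.2.2.1 i j).trans fin
end

/-- Interior Hessian estimate for augmented Hessian equations,
scalar case (a priori form of Theorem 1.4, Case 2). -/
theorem interior_hessian_estimate_augmented_case2
    {n : ℕ} (hn : 3 ≤ n) (k : ℕ) (hk2 : 2 ≤ k) (hkn : k ≤ n)
    (Ω : Set (Fin n → ℝ)) (hΩ : IsOpen Ω)
    (p : ℝ) (hp : ((k + 1) * n : ℝ) / 2 < p)
    (f : ((Fin n → ℝ) × ℝ × (Fin n → ℝ)) → ℝ)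
    (hfpos : ∀ y ∈ Ω ×ˢ ((univ : Set ℝ) ×ˢ (univ : Set (Fin n → ℝ))), 0 < f y)
    (hf : C11On f (Ω ×ˢ ((univ : Set ℝ) ×ˢ (univ : Set (Fin n → ℝ)))))
    (H₂ : ((Fin n → ℝ) × ℝ × (Fin n → ℝ)) → ℝ)
    (hH₂ : C11On H₂ (Ω ×ˢ ((univ : Set ℝ) ×ˢ (univ : Set (Fin n → ℝ)))))
    (x₀ : Fin n → ℝ) (R : ℝ) (hR : 0 < R)
    (hball : closure (ball x₀ (2 * R)) ⊆ Ω)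
    (M : ℝ) (hM : 0 < M) :
    ∃ C : ℝ, ∀ u : (Fin n → ℝ) → ℝ,
      ContDiffOn ℝ 2 u Ω →
      (∀ x ∈ Ω,
        esymmMat k (hess u x -
            H₂ (x, u x, grad u x) • (1 : Matrix (Fin n) (Fin n) ℝ))
          = f (x, u x, grad u x) ^ k ∧
        GammaPlus k (hess u x -
            H₂ (x, u x, grad u x) • (1 : Matrix (Fin n) (Fin n) ℝ))) →
      W2pNorm p u (ball x₀ (2 * R)) ≤ M →
      ∀ x ∈ ball x₀ R, matNorm (hess u x) ≤ C := by
  obtain ⟨κ, rfl⟩ := Nat.exists_eq_add_of_le' hk2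
  have hp' : ((κ:ℝ)+3)*n/2 < p := by
    refine lt_of_eq_of_lt ?_ hp
    push_cast
    ring
  exact final_aux hn κ hkn Ω hΩ p hp' f hfpos hf H₂ hH₂ x₀ R hR hball M hM
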